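/- Let g be the finite-dimensional simple Lie algebra of type E₇ over ℂ (so dim g = 133). Every nilpotent element e of g with dim g_e ∈ {99, 81, 69, 63, 51, 43} satisfies g_e = [g_e,g_e]. (These dimensions correspond to the rigid orbits A₁, 2A₁, (3A₁)′, 4A₁, A₂+2A₁, 2A₂+A₁ of E₇, which are strongly reachable.) -/

import Mathlib

/-- The centralizer `g_e` of `e`, i.e. the kernel of `ad e`. -/
noncomputable def centralizer (e : LieAlgebra.e₇ ℂ) : Submodule ℂ (LieAlgebra.e₇ ℂ) :=
  LinearMap.ker (LieAlgebra.ad ℂ (LieAlgebra.e₇ ℂ) e)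

/-- The derived subalgebra `[g_e, g_e]` of the centralizer, as the linear span of all
brackets of pairs of elements of `g_e`. -/
noncomputable def derived (e : LieAlgebra.e₇ ℂ) : Submodule ℂ (LieAlgebra.e₇ ℂ) :=
  Submodule.span ℂ
    {z : LieAlgebra.e₇ ℂ | ∃ x ∈ centralizer e, ∃ y ∈ centralizer e, ⁅x, y⁆ = z}

namespace E7

/-- The root lattice of type `E₇`, in coordinates with respect to the simple roots. -/
abbrev V := Fin 7 → ℤ

/-- The invariant form of the root lattice. -/
def ip (a b : V) : ℤ :=
  2 * (a 0 * b 0 + a 1 * b 1 + a 2 * b 2 + a 3 * b 3 + a 4 * b 4 + a 5 * b 5 + a 6 * b 6)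
  - (a 0 * b 2 + a 2 * b 3 + a 1 * b 3 + a 3 * b 4 + a 4 * b 5 + a 5 * b 6)
  - (b 0 * a 2 + b 2 * a 3 + b 1 * a 3 + b 3 * a 4 + b 4 * a 5 + b 5 * a 6)

/-- The bilinear form whose parity is the sign cocycle. -/
def ef (a b : V) : ℤ :=
  (a 0 * b 0 + a 1 * b 1 + a 2 * b 2 + a 3 * b 3 + a 4 * b 4 + a 5 * b 5 + a 6 * b 6)
  + (a 0 * b 2 + a 2 * b 3 + a 1 * b 3 + a 3 * b 4 + a 4 * b 5 + a 5 * b 6)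

/-- The sign cocycle. -/
def eps (a b : V) : ℤ := if ef a b % 2 = 0 then 1 else -1

/-- The simple roots. -/
def s (i : Fin 7) : V := Pi.single i 1

/-- The height of an element of the root lattice. -/
def ht (a : V) : ℤ := a 0 + a 1 + a 2 + a 3 + a 4 + a 5 + a 6

/-- The positive roots. -/
def IsPos (a : V) : Prop := ip a a = 2 ∧ ∀ i, 0 ≤ a i

variable (a b c : V) (i j k : Fin 7)

lemma ip_comm : ip a b = ip b a := by unfold ip; ring
@[simp] lemma ip_add_left : ip (a + b) c = ip a c + ip b c := by simp only [ip, Pi.add_apply]; ring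
@[simp] lemma ip_add_right : ip a (b + c) = ip a b + ip a c := by
  simp only [ip, Pi.add_apply]; ring
@[simp] lemma ip_sub_left : ip (a - b) c = ip a c - ip b c := by simp only [ip, Pi.sub_apply]; ring
@[simp] lemma ip_sub_right : ip a (b - c) = ip a b - ip a c := by
  simp only [ip, Pi.sub_apply]; ring
@[simp] lemma ip_neg_left : ip (-a) b = -ip a b := by simp only [ip, Pi.neg_apply]; ring
@[simp] lemma ip_neg_right : ip a (-b) = -ip a b := by simp only [ip, Pi.neg_apply]; ring

@[simp] lemma ef_add_left : ef (a + b) c = ef a c + ef b c := by simp only [ef, Pi.add_apply]; ring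
@[simp] lemma ef_add_right : ef a (b + c) = ef a b + ef a c := by
  simp only [ef, Pi.add_apply]; ring
@[simp] lemma ef_neg_left : ef (-a) b = -ef a b := by simp only [ef, Pi.neg_apply]; ring
@[simp] lemma ef_neg_right : ef a (-b) = -ef a b := by simp only [ef, Pi.neg_apply]; ring

lemma eps_mul_self : eps a b * eps a b = 1 := by unfold eps; split_ifs <;> rfl

lemma eps_add_left : eps (a + b) c = eps a c * eps b c := by
  unfold eps; rw [ef_add_left]; split_ifs <;> first | rfl | omega
lemma eps_add_right : eps a (b + c) = eps a b * eps a c := by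
  unfold eps; rw [ef_add_right]; split_ifs <;> first | rfl | omega
lemma eps_neg_left : eps (-a) b = eps a b := by
  unfold eps; rw [ef_neg_left]; split_ifs <;> first | rfl | omega
lemma eps_neg_right : eps a (-b) = eps a b := by
  unfold eps; rw [ef_neg_right]; split_ifs <;> first | rfl | omega
lemma eps_sub_right : eps a (b - c) = eps a b * eps a c := by
  rw [sub_eq_add_neg, eps_add_right, eps_neg_right]

lemma ef_comm : ef a b + ef b a = 4 * (a 0 * b 0 + a 1 * b 1 + a 2 * b 2 + a 3 * b 3 + a 4 * b 4 +
    a 5 * b 5 + a 6 * b 6) - ip a b := by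
  unfold ef ip; ring

lemma eps_comm_of_even (h : ip a b % 2 = 0) : eps b a = eps a b := by
  have := ef_comm a b
  unfold eps; split_ifs <;> omega
lemma eps_comm_of_odd (h : ip a b % 2 = 1) : eps b a = - eps a b := by
  have := ef_comm a b
  unfold eps; split_ifs <;> omega

lemma eps_self (h : ip a a = 2) : eps a a = -1 := by
  have := ef_comm a a
  unfold eps; split_ifs <;> omega

lemma ip_self_even : ip a a % 2 = 0 := by
  have := ef_comm a a
  omega

lemma ip_self_nonneg : 0 ≤ ip a a := by
  have : 12 * ip a a = 6 * (2 * a 0 - a 2)^2 + 6 * (2 * a 1 - a 3)^2 + 2 * (3 * a 2 - 2 * a 3)^2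
    + 6 * (2 * a 6 - a 5) ^ 2 + 2 * (3 * a 5 - 2 * a 4)^2 + (4 * a 4 - 3 * a 3)^2 + a 3 ^ 2 := by
    unfold ip; ring
  have h1 := sq_nonneg (2 * a 0 - a 2)
  have h2 := sq_nonneg (2 * a 1 - a 3)
  have h3 := sq_nonneg (3 * a 2 - 2 * a 3)
  have h4 := sq_nonneg (2 * a 6 - a 5)
  have h5 := sq_nonneg (3 * a 5 - 2 * a 4)
  have h6 := sq_nonneg (4 * a 4 - 3 * a 3)
  have h7 := sq_nonneg (a 3)
  omega

lemma eq_zero_of_ip_self (h : ip a a = 0) : a = 0 := by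
  have : 12 * ip a a = 6 * (2 * a 0 - a 2)^2 + 6 * (2 * a 1 - a 3)^2 + 2 * (3 * a 2 - 2 * a 3)^2
    + 6 * (2 * a 6 - a 5) ^ 2 + 2 * (3 * a 5 - 2 * a 4)^2 + (4 * a 4 - 3 * a 3)^2 + a 3 ^ 2 := by
    unfold ip; ring
  have h1 := sq_nonneg (2 * a 0 - a 2)
  have h2 := sq_nonneg (2 * a 1 - a 3)
  have h3 := sq_nonneg (3 * a 2 - 2 * a 3)
  have h4 := sq_nonneg (2 * a 6 - a 5)
  have h5 := sq_nonneg (3 * a 5 - 2 * a 4)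
  have h6 := sq_nonneg (4 * a 4 - 3 * a 3)
  have h7 := sq_nonneg (a 3)
  have g1 : 2 * a 0 - a 2 = 0 := by rw [← sq_eq_zero_iff]; omega
  have g2 : 2 * a 1 - a 3 = 0 := by rw [← sq_eq_zero_iff]; omega
  have g3 : 3 * a 2 - 2 * a 3 = 0 := by rw [← sq_eq_zero_iff]; omega
  have g4 : 2 * a 6 - a 5 = 0 := by rw [← sq_eq_zero_iff]; omega
  have g5 : 3 * a 5 - 2 * a 4 = 0 := by rw [← sq_eq_zero_iff]; omega
  have g6 : 4 * a 4 - 3 * a 3 = 0 := by rw [← sq_eq_zero_iff]; omega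
  have g7 : a 3 = 0 := by rw [← sq_eq_zero_iff]; omega
  funext i
  fin_cases i <;> simp <;> omega

section roots
variable {a b c}

lemma ip_le (ha : ip a a = 2) (hb : ip b b = 2) : ip a b ≤ 2 := by
  have := ip_self_nonneg (a - b)
  simp only [ip_sub_left, ip_sub_right, ip_comm b a] at this
  omega

lemma le_ip (ha : ip a a = 2) (hb : ip b b = 2) : -2 ≤ ip a b := by
  have := ip_self_nonneg (a + b)
  simp only [ip_add_left, ip_add_right, ip_comm b a] at this
  omega

lemma eq_of_ip (ha : ip a a = 2) (hb : ip b b = 2) (h : ip a b = 2) : a = b := by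
  apply sub_eq_zero.1
  apply eq_zero_of_ip_self
  simp only [ip_sub_left, ip_sub_right, ip_comm b a]
  omega

lemma eq_neg_of_ip (ha : ip a a = 2) (hb : ip b b = 2) (h : ip a b = -2) : a = -b := by
  apply eq_of_ip ha <;> simp [*]

lemma root_add (ha : ip a a = 2) (hb : ip b b = 2) (h : ip a b = -1) : ip (a + b) (a + b) = 2 := by
  simp only [ip_add_left, ip_add_right, ip_comm b a]; omega

lemma root_sub (ha : ip a a = 2) (hb : ip b b = 2) (h : ip a b = 1) : ip (a - b) (a - b) = 2 := by
  simp only [ip_sub_left, ip_sub_right, ip_comm b a]; omega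

lemma root_neg (ha : ip a a = 2) : ip (-a) (-a) = 2 := by simpa

lemma pos_or_neg (ha : ip a a = 2) : IsPos a ∨ IsPos (-a) := by
  let p : V := fun i => max (a i) 0
  let q : V := fun i => max (-a i) 0
  have hp : ∀ i, 0 ≤ p i := fun i => le_max_right _ _
  have hq : ∀ i, 0 ≤ q i := fun i => le_max_right _ _
  have hpq : ∀ i, p i * q i = 0 := by
    intro i
    rcases le_total 0 (a i) with h | h
    · have : q i = 0 := max_eq_right (by omega)
      simp [this]
    · have : p i = 0 := max_eq_right (by omega)
      simp [this]
  have hsub : a = p - q := by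
    funext i
    simp only [Pi.sub_apply, p, q]
    omega
  have hip : ip p q ≤ 0 := by
    have : ip p q = - (p 0 * q 2 + p 2 * q 3 + p 1 * q 3 + p 3 * q 4 + p 4 * q 5 + p 5 * q 6)
      - (q 0 * p 2 + q 2 * p 3 + q 1 * p 3 + q 3 * p 4 + q 4 * p 5 + q 5 * p 6) := by
      unfold ip; rw [hpq, hpq, hpq, hpq, hpq, hpq, hpq]; ring
    have h1 := fun i j => mul_nonneg (hp i) (hq j)
    have h2 := fun i j => mul_nonneg (hq i) (hp j)
    rw [this]
    linarith [h1 0 2, h1 2 3, h1 1 3, h1 3 4, h1 4 5, h1 5 6,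
      h2 0 2, h2 2 3, h2 1 3, h2 3 4, h2 4 5, h2 5 6]
  have h2 : ip a a = ip p p + ip q q - 2 * ip p q := by
    rw [hsub]; simp only [ip_sub_left, ip_sub_right, ip_comm q p]; omega
  have := ip_self_nonneg p
  have := ip_self_nonneg q
  have := ip_self_even p
  have := ip_self_even q
  have h3 : ip p p = 0 ∨ ip q q = 0 := by omega
  rcases h3 with h3 | h3
  · right
    have := eq_zero_of_ip_self _ h3
    refine ⟨root_neg ha, fun i => ?_⟩
    rw [hsub, this]
    simpa using hq i
  · left
    have := eq_zero_of_ip_self _ h3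
    refine ⟨ha, fun i => ?_⟩
    rw [hsub, this]
    simpa using hp i

lemma IsPos.not_neg (ha : IsPos a) : ¬ IsPos (-a) := by
  intro h
  have : a = 0 := by
    funext i
    have h1 := ha.2 i
    have h2 := h.2 i
    simp at *
    omega
  have := ha.1
  subst a
  simp [ip] at this

end roots

lemma ip_s : ip (s i) a = ∑ j, CartanMatrix.E₇ i j * a j := by
  simp only [Fin.sum_univ_succ]
  fin_cases i <;> simp [ip, s, CartanMatrix.E₇] <;> ring

lemma ip_s_s : ip (s i) (s j) = CartanMatrix.E₇ i j := by
  rw [ip_s]; simp [s, Pi.single_apply]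

lemma ip_s_self : ip (s i) (s i) = 2 := by
  rw [ip_s_s]; fin_cases i <;> rfl

lemma ip_s_cases : i = j ∨ ip (s i) (s j) = 0 ∨ ip (s i) (s j) = -1 := by
  rw [ip_s_s]; fin_cases i <;> fin_cases j <;> simp [CartanMatrix.E₇]

lemma ip_s_le {i j} (h : i ≠ j) : ip (s i) (s j) = 0 ∨ ip (s i) (s j) = -1 :=
  (ip_s_cases i j).resolve_left h

lemma isPos_s : IsPos (s i) := ⟨ip_s_self i, fun j => by
  unfold s; rw [Pi.single_apply]; split_ifs <;> simp⟩

@[simp] lemma ht_add : ht (a + b) = ht a + ht b := by simp only [ht, Pi.add_apply]; ring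
@[simp] lemma ht_sub : ht (a - b) = ht a - ht b := by simp only [ht, Pi.sub_apply]; ring
@[simp] lemma ht_s : ht (s i) = 1 := by
  fin_cases i <;> simp [ht, s]

lemma ip_eq_sum : ip a b = ∑ i, a i * ip (s i) b := by
  simp only [ip_s, Fin.sum_univ_succ]
  simp [CartanMatrix.E₇, ip]
  ring

variable {a b i j k}

lemma ht_nonneg (ha : ∀ i, 0 ≤ a i) : 0 ≤ ht a := by
  unfold ht; linarith [ha 0, ha 1, ha 2, ha 3, ha 4, ha 5, ha 6]

lemma IsPos.ht_pos (ha : IsPos a) : 0 < ht a := by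
  rcases (ht_nonneg ha.2).lt_or_eq with h | h
  · exact h
  exfalso
  have h0 : a = 0 := by
    funext i
    have := ha.2
    unfold ht at h
    have h0 := this 0; have h1 := this 1; have h2 := this 2; have h3 := this 3
    have h4 := this 4; have h5 := this 5; have h6 := this 6
    fin_cases i <;> simp <;> omega
  have := ha.1
  simp [h0, ip] at this

lemma IsPos.add_s (ha : IsPos a) (h : ip (s i) a = -1) : IsPos (a + s i) := by
  refine ⟨root_add ha.1 (ip_s_self i) (by rw [ip_comm]; exact h), fun j => ?_⟩
  exact add_nonneg (ha.2 j) ((isPos_s i).2 j)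

lemma IsPos.sub_s (ha : IsPos a) (h : ip (s i) a = 1) : IsPos (a - s i) := by
  have hr : ip (a - s i) (a - s i) = 2 := root_sub ha.1 (ip_s_self i) (by rw [ip_comm]; exact h)
  rcases pos_or_neg hr with h1 | h1
  · exact h1
  exfalso
  -- then `a = m • s i`
  have h2 : a = a i • s i := by
    funext j
    have h3 := h1.2 j
    have h4 := ha.2 j
    by_cases hj : j = i
    · subst hj; simp [s]
    · simp [s, hj] at h3 ⊢
      omega
  have h5 : ip (s i) (a i • s i) = a i * 2 := by
    rw [← ip_s_self i]; simp only [ip, Pi.smul_apply, smul_eq_mul]; ring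
  rw [← h2] at h5
  omega

lemma IsPos.cases (ha : IsPos a) : (∃ i, a = s i) ∨ ∃ i, ip (s i) a = 1 := by
  by_contra! hc
  have h : ∀ i, a i * ip (s i) a ≤ 0 := by
    intro i
    apply mul_nonpos_of_nonneg_of_nonpos (ha.2 i)
    have h1 := ip_le (ip_s_self i) ha.1
    have h2 := hc.2 i
    have h3 : ip (s i) a ≠ 2 := fun h => hc.1 i (eq_of_ip (ip_s_self i) ha.1 h).symm
    omega
  have := Finset.sum_nonpos (s := Finset.univ) fun i _ => h i
  rw [← ip_eq_sum, ha.1] at this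
  omega

end E7

namespace E7

section
variable {L : Type*} [LieRing L]

/-- The Serre relations of type `E₇` for a family of elements of a Lie ring. -/
structure Serre (X : Fin 7 → L) : Prop where
  comm : ∀ i j, ip (s i) (s j) = 0 → ⁅X i, X j⁆ = 0
  serre : ∀ i j, ip (s i) (s j) = -1 → ⁅X i, ⁅X i, X j⁆⁆ = 0

open Classical in
/-- Auxiliary recursion for `rv`. -/
noncomputable def rvAux (X : Fin 7 → L) : ℕ → V → L
  | 0, _ => 0
  | n + 1, a =>
    if h : ∃ i, a = s i then X h.choose
    else if h : ∃ i, ip (s i) a = 1 then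
      eps (s h.choose) (a - s h.choose) • ⁅X h.choose, rvAux X n (a - s h.choose)⁆
    else 0

/-- The root vectors for positive roots built from the simple root vectors `X`. -/
noncomputable def rv (X : Fin 7 → L) (a : V) : L := rvAux X (ht a).toNat a

lemma s_injective : Function.Injective s := fun i j h => by
  by_contra hij
  have := congrFun h i
  simp [s, hij] at this

lemma rv_s (X : Fin 7 → L) (i : Fin 7) : rv X (s i) = X i := by
  have h : ∃ j, s i = s j := ⟨i, rfl⟩
  have h1 := s_injective h.choose_spec
  simp only [rv, ht_s, Int.toNat_one, rvAux]
  rw [dif_pos h, ← h1]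

lemma rv_step (X : Fin 7 → L) {a : V} (ha : IsPos a) (hs : ∀ i, a ≠ s i) :
    ∃ k, ip (s k) a = 1 ∧ rv X a = eps (s k) (a - s k) • ⁅X k, rv X (a - s k)⁆ := by
  have h1 : ¬ ∃ i, a = s i := by simpa using hs
  have h2 : ∃ i, ip (s i) a = 1 := ha.cases.resolve_left h1
  refine ⟨h2.choose, h2.choose_spec, ?_⟩
  have h3 := ha.ht_pos
  obtain ⟨n, hn⟩ : ∃ n : ℕ, ht a = n + 1 := ⟨(ht a - 1).toNat, by omega⟩
  have h4 : (ht a).toNat = n + 1 := by omega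
  have h5 : (ht a - 1).toNat = n := by omega
  simp only [rv, ht_sub, ht_s, h4, h5, rvAux]
  rw [dif_neg h1, dif_pos h2]

variable {X : Fin 7 → L}

lemma Serre.comm_lie (hX : Serre X) {i j : Fin 7} (h : ip (s i) (s j) = 0) (v : L) :
    ⁅X i, ⁅X j, v⁆⁆ = ⁅X j, ⁅X i, v⁆⁆ := by
  rw [leibniz_lie, hX.comm i j h, zero_lie, zero_add]

lemma Serre.serre_lie (hX : Serre X) {i j : Fin 7} (h : ip (s i) (s j) = -1) (v : L) :
    ⁅X i, ⁅X i, ⁅X j, v⁆⁆⁆ + ⁅X j, ⁅X i, ⁅X i, v⁆⁆⁆ = (2 : ℤ) • ⁅X i, ⁅X j, ⁅X i, v⁆⁆⁆ := by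
  have h1 := congrArg (fun z => ⁅z, v⁆) (hX.serre i j h)
  simp only [zero_lie, lie_lie, lie_sub] at h1
  rw [two_smul, ← sub_eq_zero, ← h1]
  abel

lemma smul_eq_imp {a b : V} {x y : L} (h : x = eps a b • y) : y = eps a b • x := by
  rw [h, smul_smul, eps_mul_self, one_smul]

/-- Brackets of simple root vectors with positive root vectors. -/
lemma rv_claim [Module ℂ L] (hX : Serre X) : ∀ (n : ℕ) (a : V), IsPos a → ht a ≤ n → ∀ j,
    (ip (s j) a = -1 → ⁅X j, rv X a⁆ = eps (s j) a • rv X (a + s j)) ∧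
    (0 ≤ ip (s j) a → ⁅X j, rv X a⁆ = 0) := by
  intro n
  induction n with
  | zero =>
    intro a ha hn
    have := ha.ht_pos
    omega
  | succ n ih =>
  intro a ha hn j
  have hle := ip_le (ip_s_self j) ha.1
  have hss := fun i j => ip_comm (s i) (s j)
  constructor
  · intro hj
    have hd : IsPos (a + s j) := ha.add_s hj
    have hds : ∀ i, a + s j ≠ s i := by
      intro i h
      have := congrArg ht h
      have := ha.ht_pos
      simp at *
      omega
    obtain ⟨k, hk, hk2⟩ := rv_step X hd hds
    by_cases hkj : k = j
    · subst hkj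
      rw [add_sub_cancel_right] at hk2
      exact smul_eq_imp hk2
    rw [ip_add_right] at hk
    rcases ip_s_le hkj with hC | hC
    · have hka : ip (s k) a = 1 := by omega
      have he : IsPos (a - s k) := ha.sub_s hka
      have hek : ip (s k) (a - s k) = -1 := by rw [ip_sub_right, ip_s_self]; omega
      have hej : ip (s j) (a - s k) = -1 := by rw [ip_sub_right, hss j k]; omega
      have hn' : ht (a - s k) ≤ n := by simp; omega
      have h1 := smul_eq_imp ((ih _ he hn' k).1 hek)
      have h2 := (ih _ he hn' j).1 hej
      rw [sub_add_cancel] at h1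
      have e1 : a + s j - s k = a - s k + s j := by abel
      rw [e1] at hk2
      rw [h1, lie_zsmul, ← hX.comm_lie hC, h2, lie_zsmul, smul_eq_imp hk2, smul_smul, smul_smul]
      congr 1
      simp only [eps_sub_right, eps_add_right]
      have h3 := eps_comm_of_even (s k) (s j) (by omega)
      have h4 := eps_mul_self (s k) a
      have h5 := eps_mul_self (s k) (s k)
      rw [h3]
      have h6 := eps_mul_self (s k) (s j)
      linear_combination (eps (s k) (s j) ^ 2 * eps (s j) a * eps (s k) (s k) ^ 2) * h4 +
        (eps (s k) (s j) ^ 2 * eps (s j) a) * h5 + eps (s j) a * h6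
    · have hka : a = s k := (eq_of_ip (ip_s_self k) ha.1 (by omega)).symm
      subst hka
      rw [add_sub_cancel_left, rv_s] at hk2
      rw [hk2, smul_smul, rv_s, eps_comm_of_odd (s k) (s j) (by omega), neg_mul, eps_mul_self,
        neg_smul, one_smul, lie_skew]
  · intro h0
    obtain hj | hj | hj : ip (s j) a = 2 ∨ ip (s j) a = 1 ∨ ip (s j) a = 0 := by omega
    · have : a = s j := (eq_of_ip (ip_s_self j) ha.1 hj).symm
      rw [this, rv_s, lie_self]
    · have hg : IsPos (a - s j) := ha.sub_s hj
      have hgj : ip (s j) (a - s j) = -1 := by rw [ip_sub_right, ip_s_self]; omega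
      have hgn : ht (a - s j) ≤ n := by simp; omega
      have h1 := smul_eq_imp ((ih _ hg hgn j).1 hgj)
      rw [sub_add_cancel] at h1
      rw [h1, lie_zsmul]
      suffices h : ⁅X j, ⁅X j, rv X (a - s j)⁆⁆ = 0 by rw [h, smul_zero]
      by_cases hsim : ∃ k, a - s j = s k
      · obtain ⟨k, hk⟩ := hsim
        rw [hk, rv_s]
        rw [hk] at hgj
        exact hX.serre j k hgj
      obtain ⟨k, hk, hk2⟩ := rv_step X hg (by simpa using hsim)
      have hkj : k ≠ j := by rintro rfl; omega
      set b := a - s j - s k with hb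
      have hbp : IsPos b := hg.sub_s hk
      have hbn : ht b ≤ n := by simp [hb]; omega
      have hbj : ip (s j) b = -1 - ip (s k) (s j) := by rw [hb, ip_sub_right, hgj, hss j k]
      rw [hk2, lie_zsmul, lie_zsmul]
      suffices h : ⁅X j, ⁅X j, ⁅X k, rv X b⁆⁆⁆ = 0 by rw [h, smul_zero]
      rcases ip_s_le hkj with hC | hC
      · have hC' : ip (s j) (s k) = 0 := by rw [hss, hC]
        rw [hX.comm_lie hC', hX.comm_lie hC', (ih b hbp hbn j).1 (by omega), lie_zsmul,
          (ih (b + s j) (hbp.add_s (by omega)) (by simp [hb]; omega) j).2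
            (by rw [ip_add_right, ip_s_self]; omega)]
        simp
      · have hC' : ip (s j) (s k) = -1 := by rw [hss, hC]
        have h2 := hX.serre_lie hC' (rv X b)
        rw [(ih b hbp hbn j).2 (by omega)] at h2
        simpa using h2
    · by_cases hsim : ∃ k, a = s k
      · obtain ⟨k, rfl⟩ := hsim
        rw [rv_s]
        exact hX.comm j k hj
      obtain ⟨k, hk, hk2⟩ := rv_step X ha (by simpa using hsim)
      have hkj : k ≠ j := by rintro rfl; omega
      set b := a - s k with hb
      have hbp : IsPos b := ha.sub_s hk
      have hbn : ht b ≤ n := by simp [hb]; omega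
      have hbj : ip (s j) b = - ip (s k) (s j) := by rw [hb, ip_sub_right, hj, hss j k]; simp
      have hbk : ip (s k) b = -1 := by rw [hb, ip_sub_right, ip_s_self]; omega
      rw [hk2, lie_zsmul]
      suffices h : ⁅X j, ⁅X k, rv X b⁆⁆ = 0 by rw [h, smul_zero]
      rcases ip_s_le hkj with hC | hC
      · have hC' : ip (s j) (s k) = 0 := by rw [hss, hC]
        rw [hX.comm_lie hC', (ih b hbp hbn j).2 (by omega), lie_zero]
      · have hC' : ip (s j) (s k) = -1 := by rw [hss, hC]
        have hbj1 : ip (s j) b = 1 := by omega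
        have hg : IsPos (b - s j) := hbp.sub_s hbj1
        have hgn : ht (b - s j) ≤ n := by simp; omega
        have hgj : ip (s j) (b - s j) = -1 := by rw [ip_sub_right, ip_s_self]; omega
        have hgk : ip (s k) (b - s j) = 0 := by rw [ip_sub_right, hbk, hC]; rfl
        have h1 := (ih _ hg hgn j).1 hgj
        rw [sub_add_cancel] at h1
        have h2 := hX.serre_lie hC' (rv X (b - s j))
        rw [(ih _ hg hgn k).2 hgk.ge, h1, lie_zsmul, lie_zsmul, lie_zsmul,
          (ih b hbp hbn j).2 (by omega)] at h2
        simp only [lie_zero, smul_zero, add_zero, lie_zsmul] at h2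
        have h3 := congrArg (fun z => ((1 / 2 : ℂ) * eps (s j) (b - s j)) • z) h2
        simp only [smul_zero, ← Int.cast_smul_eq_zsmul ℂ, smul_smul] at h3
        have h4 : ((eps (s j) (b - s j) : ℤ) : ℂ) * (eps (s j) (b - s j) : ℤ) = 1 := by
          rw [← Int.cast_mul, eps_mul_self, Int.cast_one]
        have h5 : (1 / 2 : ℂ) * (eps (s j) (b - s j) : ℤ) * ((2 : ℤ) * (eps (s j) (b - s j) : ℤ))
            = 1 := by
          push_cast; linear_combination h4
        rw [h5, one_smul] at h3
        exact h3.symm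

lemma rv_add [Module ℂ L] (hX : Serre X) {a : V} (ha : IsPos a) {j : Fin 7}
    (h : ip (s j) a = -1) : ⁅X j, rv X a⁆ = eps (s j) a • rv X (a + s j) :=
  (rv_claim hX (ht a).toNat a ha (by omega) j).1 h

lemma rv_zero [Module ℂ L] (hX : Serre X) {a : V} (ha : IsPos a) {j : Fin 7}
    (h : 0 ≤ ip (s j) a) : ⁅X j, rv X a⁆ = 0 :=
  (rv_claim hX (ht a).toNat a ha (by omega) j).2 h

end

end E7

namespace E7

section
variable {L : Type*} [LieRing L]

/-- Chevalley relations of type `E₇`; the family `G` is the negative of the usual `F`. -/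
structure Chev (E G H : Fin 7 → L) : Prop where
  serreE : Serre E
  serreG : Serre G
  hh : ∀ i j, ⁅H i, H j⁆ = 0
  eg : ∀ i j, i ≠ j → ⁅E i, G j⁆ = 0
  eg_self : ∀ i, ⁅E i, G i⁆ = - H i
  he : ∀ i j, ⁅H i, E j⁆ = ip (s i) (s j) • E j
  hg : ∀ i j, ⁅H i, G j⁆ = -ip (s i) (s j) • G j

variable {E G H : Fin 7 → L}

lemma Chev.swap (h : Chev E G H) : Chev G E (fun i => - H i) where
  serreE := h.serreG
  serreG := h.serreE
  hh i j := by simp [h.hh]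
  eg i j hij := by rw [← lie_skew, h.eg j i hij.symm, neg_zero]
  eg_self i := by rw [← lie_skew, h.eg_self i]
  he i j := by rw [neg_lie, h.hg i j, neg_smul, neg_neg]
  hg i j := by rw [neg_lie, h.he i j, neg_smul]

lemma Chev.h_rv (h : Chev E G H) : ∀ (n : ℕ) (a : V), IsPos a → ht a ≤ n → ∀ i,
    ⁅H i, rv E a⁆ = ip (s i) a • rv E a := by
  intro n
  induction n with
  | zero =>
    intro a ha hn
    have := ha.ht_pos
    omega
  | succ n ih =>
  intro a ha hn i
  by_cases hsim : ∃ k, a = s k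
  · obtain ⟨k, rfl⟩ := hsim
    rw [rv_s, h.he]
  obtain ⟨k, hk, hk2⟩ := rv_step E ha (by simpa using hsim)
  have h1 := ih _ (ha.sub_s hk) (by simp; omega) i
  have h5 : ip (s i) (s k) + ip (s i) (a - s k) = ip (s i) a := by rw [ip_sub_right]; ring
  rw [hk2, lie_zsmul, leibniz_lie, h1, h.he, lie_zsmul, zsmul_lie, ← add_smul, h5, smul_comm]

lemma Chev.mixed [Module ℂ L] (h : Chev E G H) : ∀ (n : ℕ) (a : V), IsPos a → ht a ≤ n → ∀ i,
    (ip (s i) a = 1 → ⁅E i, rv G a⁆ = eps (s i) a • rv G (a - s i)) ∧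
    (ip (s i) a = 2 → ⁅E i, rv G a⁆ = - H i) ∧
    (ip (s i) a ≤ 0 → ⁅E i, rv G a⁆ = 0) := by
  intro n
  induction n with
  | zero =>
    intro a ha hn
    have := ha.ht_pos
    omega
  | succ n ih =>
  intro a ha hn i
  have hss := fun i j => ip_comm (s i) (s j)
  have h2 : ip (s i) a = 2 → ⁅E i, rv G a⁆ = - H i := by
    intro hi
    have : a = s i := (eq_of_ip (ip_s_self i) ha.1 hi).symm
    rw [this, rv_s, h.eg_self]
  by_cases hsim : ∃ k, a = s k
  · obtain ⟨k, rfl⟩ := hsim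
    refine ⟨fun hi => ?_, h2, fun hi => ?_⟩
    · rcases ip_s_cases i k with h1 | h1 | h1
      · rw [h1, ip_s_self] at hi; omega
      · omega
      · omega
    · rw [rv_s]
      apply h.eg
      rintro rfl
      rw [ip_s_self] at hi
      omega
  obtain ⟨k, hk, hk2⟩ := rv_step G ha (by simpa using hsim)
  set b := a - s k with hb
  have hab : a = b + s k := by simp [hb]
  have hbp : IsPos b := ha.sub_s hk
  have hbn : ht b ≤ n := by rw [hb, ht_sub, ht_s]; omega
  have hbk : ip (s k) b = -1 := by rw [hb, ip_sub_right, ip_s_self]; omega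
  clear_value b
  have hbi : ip (s i) a = ip (s i) b + ip (s i) (s k) := by rw [hab, ip_add_right]
  have hai : ip (s i) a ≠ 2 := fun hi => hsim ⟨i, (eq_of_ip (ip_s_self i) ha.1 hi).symm⟩
  have hbi2 := ip_le (ip_s_self i) hbp.1
  obtain ⟨ih1, ih2, ih3⟩ := ih b hbp hbn i
  have e1 : ⁅E i, rv G a⁆ = eps (s k) b • (⁅⁅E i, G k⁆, rv G b⁆ + ⁅G k, ⁅E i, rv G b⁆⁆) := by
    rw [hk2, lie_zsmul, ← leibniz_lie]
  by_cases hik : i = k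
  · subst hik
    refine ⟨fun hi => ?_, fun hi => absurd hi hai, fun hi => by omega⟩
    have h4 : ⁅-H i, rv G b⁆ = _ := h.swap.h_rv n b hbp hbn i
    rw [e1, ih3 (by omega), h.eg_self, ← hb, h4, hbk, lie_zero, add_zero, hab, eps_add_right,
      eps_self _ (ip_s_self i), neg_smul,
      one_smul, mul_neg, mul_one, neg_smul, smul_neg]
  have hik' := ip_s_le hik
  rw [h.eg i k hik, zero_lie, zero_add] at e1
  refine ⟨fun hi => ?_, fun hi => absurd hi hai, fun hi => ?_⟩
  · rcases hik' with hC | hC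
    · have h3 : IsPos (b - s i) := hbp.sub_s (by omega)
      rw [e1, ih1 (by omega), lie_zsmul,
      rv_add h.serreG h3 (by rw [ip_sub_right, hbk, hss, hC]; rfl),
        smul_smul, smul_smul, hab]
      have e2 : b - s i + s k = b + s k - s i := by abel
      rw [e2]
      congr 1
      rw [eps_sub_right, eps_add_right, ← eps_comm_of_even (s i) (s k) (by omega)]
      linear_combination (eps (s i) b * eps (s k) (s i)) * eps_mul_self (s k) b
    · have h3 : b = s i := (eq_of_ip (ip_s_self i) hbp.1 (by omega)).symm
      have h4 := h.hg i k
      rw [hC, neg_neg, one_smul] at h4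
      rw [e1, ih2 (by omega), lie_neg, lie_skew, h4, hab, h3, add_sub_cancel_left, rv_s,
        eps_add_right, eps_self _ (ip_s_self i), eps_comm_of_odd (s i) (s k) (by omega)]
      simp
  · by_cases h1 : ip (s i) b = 1
    · have h3 : IsPos (b - s i) := hbp.sub_s (by omega)
      rw [e1, ih1 h1, lie_zsmul, rv_zero h.serreG h3 (by rw [ip_sub_right, hbk, hss]; omega)]
      simp
    · rw [e1, ih3 (by omega)]
      simp

/-- The root vectors for all roots. -/
noncomputable def bv (E G : Fin 7 → L) (a : V) : L :=
  open Classical in if IsPos a then rv E a else rv G (-a)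

lemma bv_pos {a : V} (ha : IsPos a) : bv E G a = rv E a := if_pos ha

lemma bv_neg {a : V} (ha : IsPos a) : bv E G (-a) = rv G a := by
  rw [bv, if_neg ha.not_neg, neg_neg]

lemma bv_swap {a : V} (ha : ip a a = 2) : bv G E a = bv E G (-a) := by
  rcases pos_or_neg ha with h | h
  · rw [bv_pos h, bv_neg h]
  · rw [bv_pos h]
    have := bv_neg (E := G) (G := E) h
    rwa [neg_neg] at this

/-- The coroot of `a`. -/
noncomputable def hv (H : Fin 7 → L) (a : V) : L := ∑ i, a i • H i

lemma hv_neg (a : V) : hv H (-a) = - hv H a := by simp [hv]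
lemma hv_swap (a : V) : hv (fun i => - H i) a = - hv H a := by simp [hv]
lemma hv_add (a b : V) : hv H (a + b) = hv H a + hv H b := by
  simp [hv, add_smul, Finset.sum_add_distrib]
lemma hv_s (i : Fin 7) : hv H (s i) = H i := by
  simp [hv, s, Pi.single_apply]

lemma Chev.h_bv (h : Chev E G H) {a : V} (ha : ip a a = 2) (i : Fin 7) :
    ⁅H i, bv E G a⁆ = ip (s i) a • bv E G a := by
  rcases pos_or_neg ha with h1 | h1
  · rw [bv_pos h1]
    exact h.h_rv (ht a).toNat a h1 (by omega) i
  · have := h.swap.h_rv (ht (-a)).toNat (-a) h1 (by omega) i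
    rw [← neg_neg a, bv_neg h1, ip_neg_right, neg_smul, ← this, neg_lie, neg_neg]

lemma Chev.hv_bv (h : Chev E G H) {a : V} (ha : ip a a = 2) (b : V) :
    ⁅hv H b, bv E G a⁆ = ip b a • bv E G a := by
  rw [hv, sum_lie, ip_eq_sum, Finset.sum_smul]
  simp_rw [zsmul_lie, h.h_bv ha, smul_smul]

/-- The statement of the bracket rules for the root vector of `a` with all root vectors. -/
def Table (E G H : Fin 7 → L) (a : V) : Prop :=
  ∀ b, ip b b = 2 →
    (ip a b = -1 → ⁅bv E G a, bv E G b⁆ = eps a b • bv E G (a + b)) ∧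
    (b = -a → ⁅bv E G a, bv E G b⁆ = - hv H a) ∧
    (0 ≤ ip a b → ⁅bv E G a, bv E G b⁆ = 0)

lemma Chev.table_s [Module ℂ L] (h : Chev E G H) (i : Fin 7) : Table E G H (s i) := by
  intro b hb
  rw [bv_pos (isPos_s i), rv_s, hv_s]
  rcases pos_or_neg hb with h1 | h1
  · rw [bv_pos h1]
    refine ⟨fun h2 => ?_, ?_, fun h2 => rv_zero h.serreE h1 h2⟩
    · have := h1.add_s h2
      rw [add_comm (s i), bv_pos this, rv_add h.serreE h1 h2]
    · rintro rfl
      exact absurd h1 (isPos_s i).not_neg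
  · obtain ⟨m1, m2, m3⟩ := h.mixed (ht (-b)).toNat (-b) h1 (by omega) i
    rw [← neg_neg b, bv_neg h1]
    refine ⟨fun h2 => ?_, fun h2 => ?_, fun h2 => ?_⟩
    · rw [ip_neg_right] at h2
      rw [m1 (by omega), eps_neg_right _ (-b)]
      congr 1
      have e : s i + - -b = - (-b - s i) := by abel
      rw [e, bv_neg (h1.sub_s (by omega))]
    · apply m2
      have := neg_injective h2
      rw [this, ip_s_self]
    · rw [ip_neg_right] at h2
      exact m3 (by omega)

lemma Table.swap {a : V} (ha : ip a a = 2) (h : Table G E (fun i => - H i) a) :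
    Table E G H (-a) := by
  intro b hb
  obtain ⟨h1, h2, h3⟩ := h (-b) (root_neg hb)
  rw [bv_swap ha, bv_swap (root_neg hb), neg_neg] at h1 h2 h3
  refine ⟨fun h4 => ?_, fun h4 => ?_, fun h4 => ?_⟩
  · have h5 : ip a (-b) = -1 := by rw [ip_neg_left] at h4; rw [ip_neg_right, h4]
    rw [h1 h5, eps_neg_left, eps_neg_right, bv_swap (root_add ha (root_neg hb) h5)]
    congr 2; abel
  · rw [h2 (by rw [h4, neg_neg]), hv_swap, hv_neg]
  · apply h3
    rw [ip_neg_left] at h4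
    rwa [ip_neg_right]

lemma Table.step [Module ℂ L] (h : Chev E G H) {a' c : V} (hc : ip c c = 2) (ha : ip a' a' = 2)
    (hac : ip c a' = -1) (h1 : Table E G H c) (h2 : Table E G H a') : Table E G H (c + a') := by
  have hra : ip (c + a') (c + a') = 2 := root_add hc ha hac
  have hac' : ip a' c = -1 := by rw [ip_comm, hac]
  have hbr := smul_eq_imp ((h1 a' ha).1 hac)
  intro b hb
  have key : ⁅bv E G (c + a'), bv E G b⁆ = eps c a' • (⁅bv E G c, ⁅bv E G a', bv E G b⁆⁆ -
      ⁅bv E G a', ⁅bv E G c, bv E G b⁆⁆) := by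
    rw [hbr, zsmul_lie, lie_lie]
  have ip1 := le_ip hc hb
  have ip2 := ip_le hc hb
  have ip3 := le_ip ha hb
  have ip4 := ip_le ha hb
  have ip5 := le_ip hra hb
  have ip6 := ip_le hra hb
  have hsum : ip (c + a') b = ip c b + ip a' b := ip_add_left _ _ _
  obtain ⟨c1, c2, c3⟩ := h1 b hb
  obtain ⟨a1, a2, a3⟩ := h2 b hb
  by_cases hcm2 : ip c b = -2
  · have hbc : b = -c := by rw [eq_neg_of_ip hc hb hcm2, neg_neg]
    have hba : ip a' b = 1 := by rw [hbc, ip_neg_right, hac']; rfl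
    refine ⟨fun _ => ?_, ?_, fun h0 => by omega⟩
    · rw [key, a3 (by omega), c2 hbc, lie_zero, zero_sub, lie_neg, neg_neg, ← lie_skew,
        h.hv_bv ha, hac, hbc, eps_neg_right, eps_add_left, eps_self _ hc,
        eps_comm_of_odd c a' (by omega)]
      simp
    · intro hb'
      have : ip (c + a') b = -2 := by rw [hb', ip_neg_right, hra]
      omega
  by_cases ham2 : ip a' b = -2
  · have hbc : b = -a' := by rw [eq_neg_of_ip ha hb ham2, neg_neg]
    have hba : ip c b = 1 := by rw [hbc, ip_neg_right, hac]; rfl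
    refine ⟨fun _ => ?_, ?_, fun h0 => by omega⟩
    · rw [key, c3 (by omega), a2 hbc, lie_zero, sub_zero, lie_neg, lie_skew,
        h.hv_bv hc, hac', hbc, eps_neg_right, eps_add_left, eps_self _ ha]
      simp
    · intro hb'
      have : ip (c + a') b = -2 := by rw [hb', ip_neg_right, hra]
      omega
  by_cases hcm1 : ip c b = -1
  · have hcb : ip (c + b) (c + b) = 2 := root_add hc hb hcm1
    obtain ⟨d1, d2, d3⟩ := h2 (c + b) hcb
    have hd : ip a' (c + b) = -1 + ip a' b := by rw [ip_add_right, hac']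
    by_cases ham1 : ip a' b = -1
    · have hbe : b = -(c + a') := by
        rw [eq_neg_of_ip hra hb (by omega), neg_neg]
      have hab : ip (a' + b) (a' + b) = 2 := root_add ha hb ham1
      refine ⟨fun h0 => by omega, fun _ => ?_, fun h0 => by omega⟩
      rw [key, a1 ham1, c1 hcm1, lie_zsmul, lie_zsmul, d2 (by rw [hbe]; abel),
        (h1 (a' + b) hab).2.1 (by rw [hbe]; abel), hv_add, hbe, eps_neg_right, eps_neg_right,
        eps_add_right, eps_add_right, eps_self _ hc, eps_self _ ha,
        eps_comm_of_odd c a' (by omega)]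
      simp only [mul_neg, neg_mul, mul_one, one_mul, smul_neg, neg_smul, neg_neg,
        sub_eq_add_neg, smul_add, smul_smul, eps_mul_self, one_smul]
      abel
    · refine ⟨fun h0 => ?_, ?_, fun h0 => ?_⟩
      · have h0' : ip a' b = 0 := by omega
        rw [key, a3 (by omega), c1 hcm1, lie_zsmul, d1 (by omega), lie_zero, zero_sub, smul_smul,
          smul_neg, smul_smul, ← neg_smul]
        have e : a' + (c + b) = c + a' + b := by abel
        rw [e, eps_add_left, eps_add_right, eps_comm_of_odd c a' (by omega)]
        congr 1
        linear_combination eps c b * eps a' b * eps_mul_self c a'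
      · intro hb'
        have : ip (c + a') b = -2 := by rw [hb', ip_neg_right, hra]
        omega
      · rw [key, a3 (by omega), c1 hcm1, lie_zsmul, d3 (by omega)]
        simp
  by_cases ham1 : ip a' b = -1
  · have hab : ip (a' + b) (a' + b) = 2 := root_add ha hb ham1
    obtain ⟨d1, d2, d3⟩ := h1 (a' + b) hab
    have hd : ip c (a' + b) = -1 + ip c b := by rw [ip_add_right, hac]
    refine ⟨fun h0 => ?_, ?_, fun h0 => ?_⟩
    · have h0' : ip c b = 0 := by omega
      rw [key, c3 (by omega), a1 ham1, lie_zsmul, d1 (by omega), lie_zero, sub_zero, smul_smul,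
        smul_smul]
      have e : c + (a' + b) = c + a' + b := by abel
      rw [e, eps_add_left, eps_add_right]
      congr 1
      linear_combination eps c b * eps a' b * eps_mul_self c a'
    · intro hb'
      have : ip (c + a') b = -2 := by rw [hb', ip_neg_right, hra]
      omega
    · rw [key, c3 (by omega), a1 ham1, lie_zsmul, d3 (by omega)]
      simp
  refine ⟨fun h0 => by omega, ?_, fun h0 => ?_⟩
  · intro hb'
    have : ip (c + a') b = -2 := by rw [hb', ip_neg_right, hra]
    omega
  · rw [key, c3 (by omega), a3 (by omega)]
    simp

lemma Chev.table_pos [Module ℂ L] (h : Chev E G H) : ∀ (n : ℕ) (a : V), IsPos a → ht a ≤ n →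
    Table E G H a := by
  intro n
  induction n with
  | zero =>
    intro a ha hn
    have := ha.ht_pos
    omega
  | succ n ih =>
  intro a ha hn
  rcases ha.cases with ⟨k, rfl⟩ | ⟨k, hk⟩
  · exact h.table_s k
  have hb := ha.sub_s hk
  have := Table.step h (ip_s_self k) hb.1 (by rw [ip_sub_right, hk, ip_s_self]; rfl)
    (h.table_s k) (ih _ hb (by simp; omega))
  rwa [add_sub_cancel] at this

lemma Chev.table [Module ℂ L] (h : Chev E G H) {a : V} (ha : ip a a = 2) : Table E G H a := by
  rcases pos_or_neg ha with h1 | h1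
  · exact h.table_pos (ht a).toNat a h1 (by omega)
  · have := Table.swap h1.1 (h.swap.table_pos (ht (-a)).toNat (-a) h1 (by omega))
    rwa [neg_neg] at this

end

end E7

namespace E7

/-- Octal encodings of the positive roots. -/
def posCodes : List ℕ :=
  [1, 8, 64, 512, 4096, 32768, 262144, 65, 520, 576, 4608, 36864, 294912, 577, 584, 4616, 4672,
  37376, 299008, 585, 4673, 4680, 37384, 37440, 299520, 4681, 5192, 37441, 37448, 299528, 299584,
  5193, 37449, 37960, 299585, 299592, 5257, 37961, 42056, 299593, 300104, 38025, 42057, 300105,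
  304200, 42121, 300169, 304201, 336968, 42633, 304265, 336969, 42641, 304777, 337033, 304785,
  337545, 337553, 341641, 341649, 342161, 342225, 342226]

/-- The element of the root lattice with octal encoding `n`. -/
def dec (n : ℕ) : V := fun i => ((n / 8 ^ (i : ℕ) % 8 : ℕ) : ℤ)

lemma posCodes_isPos : ∀ n ∈ posCodes, ip (dec n) (dec n) = 2 := by decide +kernel

lemma posCodes_add : ∀ n ∈ posCodes, ∀ i : Fin 7, ip (s i) (dec n) = -1 →
    n + 8 ^ (i : ℕ) ∈ posCodes ∧ ∀ j, dec (n + 8 ^ (i : ℕ)) j = dec n j + s i j := by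
  decide +kernel

lemma dec_isPos {n : ℕ} (hn : n ∈ posCodes) : IsPos (dec n) :=
  ⟨posCodes_isPos n hn, fun i => by unfold dec; positivity⟩

lemma posCodes_s : ∀ i : Fin 7, 8 ^ (i : ℕ) ∈ posCodes ∧ ∀ j, dec (8 ^ (i : ℕ)) j = s i j := by
  decide +kernel

lemma exists_dec : ∀ (m : ℕ) (a : V), IsPos a → ht a ≤ m → ∃ n ∈ posCodes, dec n = a := by
  intro m
  induction m with
  | zero =>
    intro a ha hn
    have := ha.ht_pos
    omega
  | succ m ih =>
  intro a ha hn
  rcases ha.cases with ⟨k, rfl⟩ | ⟨k, hk⟩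
  · exact ⟨_, (posCodes_s k).1, funext (posCodes_s k).2⟩
  have hb := ha.sub_s hk
  obtain ⟨n, h1, h2⟩ := ih _ hb (by rw [ht_sub, ht_s]; omega)
  have h3 := posCodes_add n h1 k (by rw [h2, ip_sub_right, hk, ip_s_self]; rfl)
  refine ⟨_, h3.1, ?_⟩
  funext j
  rw [h3.2 j, h2]
  simp

lemma IsPos.exists_dec {a : V} (ha : IsPos a) : ∃ n ∈ posCodes, dec n = a :=
  E7.exists_dec (ht a).toNat a ha (by omega)

lemma root_bound {a : V} (ha : ip a a = 2) (i : Fin 7) : -7 ≤ a i ∧ a i ≤ 7 := by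
  rcases pos_or_neg ha with h | h
  · obtain ⟨n, -, rfl⟩ := h.exists_dec
    unfold dec
    omega
  · obtain ⟨n, -, h2⟩ := h.exists_dec
    have := congrFun h2 i
    unfold dec at this
    simp only [Pi.neg_apply] at this
    omega

/-- The type of roots. -/
abbrev Rt := {a : V // ip a a = 2}

instance : Finite Rt := by
  have : Finite {a : V | ∃ n ∈ posCodes, dec n = a ∨ dec n = -a} := by
    have h : {a : V | ∃ n ∈ posCodes, dec n = a ∨ dec n = -a} ⊆
        dec '' {n | n ∈ posCodes} ∪ (fun n => - dec n) '' {n | n ∈ posCodes} := by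
      rintro a ⟨n, hn, h | h⟩
      · exact Or.inl ⟨n, hn, h⟩
      · exact Or.inr ⟨n, hn, by simp [h]⟩
    exact ((posCodes.finite_toSet.image _).union (posCodes.finite_toSet.image _)).subset h
  apply Finite.of_injective (β := {a : V | ∃ n ∈ posCodes, dec n = a ∨ dec n = -a})
    (fun a => ⟨a.1, by
      rcases pos_or_neg a.2 with h | h
      · obtain ⟨n, h1, h2⟩ := h.exists_dec
        exact ⟨n, h1, Or.inl h2⟩
      · obtain ⟨n, h1, h2⟩ := h.exists_dec
        exact ⟨n, h1, Or.inr h2⟩⟩)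
  intro a b h
  simpa [Subtype.ext_iff] using h

noncomputable instance : Fintype Rt := Fintype.ofFinite _

/-- The pairing of the root lattice with the space of labels. -/
noncomputable def wt (a : V) (w : Fin 7 → ℂ) : ℂ := ∑ j, (a j : ℂ) * w j

lemma wt_neg (a : V) (w : Fin 7 → ℂ) : wt (-a) w = - wt a w := by
  simp [wt]
lemma wt_s (i : Fin 7) (w : Fin 7 → ℂ) : wt (s i) w = w i := by
  simp [wt, s, Pi.single_apply]

/-- Twice the inverse Cartan matrix. -/
def minv : Matrix (Fin 7) (Fin 7) ℤ :=
  !![4, 4, 6, 8, 6, 4, 2; 4, 7, 8, 12, 9, 6, 3; 6, 8, 12, 16, 12, 8, 4; 8, 12, 16, 24, 18, 12, 6;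
    6, 9, 12, 18, 15, 10, 5; 4, 6, 8, 12, 10, 8, 4; 2, 3, 4, 6, 5, 4, 3]

lemma minv_ip (a : V) (j : Fin 7) : ∑ i, minv j i * ip (s i) a = 2 * a j := by
  simp only [ip_s, Fin.sum_univ_succ]
  fin_cases j <;> simp [minv, CartanMatrix.E₇] <;> ring

/-- A regular integral label. -/
def wreg : Fin 7 → ℂ := fun j => ((32 ^ (j : ℕ) : ℕ) : ℂ)

lemma wt_wreg (a : V) : wt a wreg = ((∑ j, a j * 32 ^ (j : ℕ) : ℤ) : ℂ) := by
  simp [wt, wreg]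

lemma wt_wreg_inj {a b : V} (ha : ip a a = 2) (hb : ip b b = 2) (h : wt a wreg = wt b wreg) :
    a = b := by
  rw [wt_wreg, wt_wreg] at h
  have hs : ∀ a : V, ∑ j, a j * 32 ^ (j : ℕ) = a 0 + 32 * a 1 + 1024 * a 2 + 32768 * a 3 +
      1048576 * a 4 + 33554432 * a 5 + 1073741824 * a 6 := by
    intro a
    simp [Fin.sum_univ_seven]
    ring
  have h := Int.cast_injective h
  rw [hs, hs] at h
  have ha := root_bound ha
  have hb := root_bound hb
  have := ha 0; have := ha 1; have := ha 2; have := ha 3; have := ha 4; have := ha 5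
  have := ha 6; have := hb 0; have := hb 1; have := hb 2; have := hb 3; have := hb 4
  have := hb 5; have := hb 6
  have h0 : a 0 = b 0 := by omega
  have h1 : a 1 = b 1 := by omega
  have h2 : a 2 = b 2 := by omega
  have h3 : a 3 = b 3 := by omega
  have h4 : a 4 = b 4 := by omega
  have h5 : a 5 = b 5 := by omega
  have h6 : a 6 = b 6 := by omega
  funext i
  fin_cases i <;> assumption

lemma wt_wreg_ne_zero {a : V} (ha : ip a a = 2) : wt a wreg ≠ 0 := by
  intro h
  have h2 := wt_neg a wreg
  rw [h, neg_zero, ← h] at h2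
  have := wt_wreg_inj (root_neg ha) ha h2
  have h4 := root_neg ha
  have h3 : ip (-a) a = - ip a a := ip_neg_left _ _
  rw [this] at h3
  omega

variable {L : Type*} [LieRing L] [LieAlgebra ℂ L]

/-- Chevalley generators of type `E₇` for a complex Lie algebra. -/
structure Data (L : Type*) [LieRing L] [LieAlgebra ℂ L] where
  E : Fin 7 → L
  G : Fin 7 → L
  H : Fin 7 → L
  chev : Chev E G H
  gen : ∀ K : LieSubalgebra ℂ L, (∀ i, E i ∈ K) → (∀ i, G i ∈ K) → K = ⊤

namespace Data

variable (D : Data L)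

/-- The root vectors. -/
noncomputable def b (a : V) : L := bv D.E D.G a

/-- The coroots. -/
noncomputable def h (a : V) : L := hv D.H a

/-- The element of the Cartan subalgebra on which the simple roots take the values `w`. -/
noncomputable def t (w : Fin 7 → ℂ) : L := ∑ i, (∑ j, w j * (minv j i : ℂ) / 2) • D.H i

lemma H_b {a : V} (ha : ip a a = 2) (i : Fin 7) : ⁅D.H i, D.b a⁆ = ip (s i) a • D.b a :=
  D.chev.h_bv ha i

lemma H_H (i j : Fin 7) : ⁅D.H i, D.H j⁆ = 0 := D.chev.hh i j

lemma b_b {a c : V} (ha : ip a a = 2) (hc : ip c c = 2) (h : ip a c = -1) :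
    ⁅D.b a, D.b c⁆ = eps a c • D.b (a + c) := (D.chev.table ha c hc).1 h

lemma b_neg {a : V} (ha : ip a a = 2) : ⁅D.b a, D.b (-a)⁆ = - D.h a :=
  (D.chev.table ha (-a) (root_neg ha)).2.1 rfl

lemma b_b_zero {a c : V} (ha : ip a a = 2) (hc : ip c c = 2) (h : 0 ≤ ip a c) :
    ⁅D.b a, D.b c⁆ = 0 := (D.chev.table ha c hc).2.2 h

lemma b_s (i : Fin 7) : D.b (s i) = D.E i := by
  rw [b, bv_pos (isPos_s i), rv_s]

lemma b_neg_s (i : Fin 7) : D.b (-s i) = D.G i := by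
  rw [b, bv_neg (isPos_s i), rv_s]

lemma t_H (w : Fin 7 → ℂ) (i : Fin 7) : ⁅D.t w, D.H i⁆ = 0 := by
  simp [t, sum_lie, D.H_H]

lemma t_b (w : Fin 7 → ℂ) {a : V} (ha : ip a a = 2) : ⁅D.t w, D.b a⁆ = wt a w • D.b a := by
  have h1 : ⁅D.t w, D.b a⁆ = (∑ i, (∑ j, w j * (minv j i : ℂ) / 2) * (ip (s i) a : ℂ)) • D.b a := by
    rw [t, sum_lie, Finset.sum_smul]
    refine Finset.sum_congr rfl fun i _ => ?_
    rw [smul_lie, D.H_b ha, ← Int.cast_smul_eq_zsmul ℂ, smul_smul]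
  rw [h1]
  congr 1
  simp_rw [Finset.sum_mul]
  rw [Finset.sum_comm, wt]
  refine Finset.sum_congr rfl fun j _ => ?_
  have h2 : ((∑ i, minv j i * ip (s i) a : ℤ) : ℂ) = ((2 * a j : ℤ) : ℂ) := by rw [minv_ip]
  push_cast at h2
  have h3 : ∀ i, w j * (minv j i : ℂ) / 2 * (ip (s i) a : ℂ) =
    w j / 2 * ((minv j i : ℂ) * (ip (s i) a : ℂ)) := fun i => by ring
  simp_rw [h3]
  rw [← Finset.mul_sum, h2]
  ring

lemma H_eq_t (i : Fin 7) : D.H i = D.t (fun j => (CartanMatrix.E₇ i j : ℂ)) := by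
  have h1 : ∀ k : Fin 7, ∑ j, CartanMatrix.E₇ i j * minv j k = if k = i then 2 else 0 := by
    revert i; decide +kernel
  have h2 : ∀ k : Fin 7, ∑ j, (CartanMatrix.E₇ i j : ℂ) * (minv j k : ℂ) / 2 =
      if k = i then 1 else 0 := by
    intro k
    rw [← Finset.sum_div]
    have h3 : ((∑ j, CartanMatrix.E₇ i j * minv j k : ℤ) : ℂ) =
        ((if k = i then 2 else 0 : ℤ) : ℂ) := by
      rw [h1]
    push_cast at h3
    rw [h3]
    split_ifs <;> simp
  simp [t, h2]

lemma t_add (w v : Fin 7 → ℂ) : D.t (w + v) = D.t w + D.t v := by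
  simp only [t, ← Finset.sum_add_distrib, ← add_smul, Pi.add_apply]
  simp only [add_mul, add_div, Finset.sum_add_distrib]

lemma t_smul (c : ℂ) (w : Fin 7 → ℂ) : D.t (c • w) = c • D.t w := by
  simp only [t, Finset.smul_sum, smul_smul, Pi.smul_apply, smul_eq_mul]
  refine Finset.sum_congr rfl fun i _ => ?_
  rw [Finset.mul_sum]
  congr 1
  refine Finset.sum_congr rfl fun i _ => ?_
  ring

/-- The Chevalley basis. -/
noncomputable def bas : Rt ⊕ Fin 7 → L := Sum.elim (fun a => D.b a.1) D.H

lemma h_mem_span (a : V) : D.h a ∈ Submodule.span ℂ (Set.range D.bas) := by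
  unfold h hv
  refine Submodule.sum_mem _ fun i _ => ?_
  rw [← Int.cast_smul_eq_zsmul ℂ]
  exact Submodule.smul_mem _ _ (Submodule.subset_span ⟨Sum.inr i, rfl⟩)

lemma b_mem_span {a : V} (ha : ip a a = 2) : D.b a ∈ Submodule.span ℂ (Set.range D.bas) :=
  Submodule.subset_span ⟨Sum.inl ⟨a, ha⟩, rfl⟩

lemma bas_lie_bas (k l : Rt ⊕ Fin 7) :
    ⁅D.bas k, D.bas l⁆ ∈ Submodule.span ℂ (Set.range D.bas) := by
  rcases k with ⟨a, ha⟩ | i <;> rcases l with ⟨c, hc⟩ | j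
  · change ⁅D.b a, D.b c⁆ ∈ _
    have h1 := le_ip ha hc
    obtain h | h | h : ip a c = -2 ∨ ip a c = -1 ∨ 0 ≤ ip a c := by omega
    · have : c = -a := by rw [eq_neg_of_ip ha hc h, neg_neg]
      rw [this, D.b_neg ha]
      exact Submodule.neg_mem _ (D.h_mem_span a)
    · rw [D.b_b ha hc h, ← Int.cast_smul_eq_zsmul ℂ]
      exact Submodule.smul_mem _ _ (D.b_mem_span (root_add ha hc h))
    · rw [D.b_b_zero ha hc h]
      exact Submodule.zero_mem _
  · change ⁅D.b a, D.H j⁆ ∈ _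
    rw [← lie_skew, D.H_b ha, ← Int.cast_smul_eq_zsmul ℂ]
    exact Submodule.neg_mem _ (Submodule.smul_mem _ _ (D.b_mem_span ha))
  · change ⁅D.H i, D.b c⁆ ∈ _
    rw [D.H_b hc, ← Int.cast_smul_eq_zsmul ℂ]
    exact Submodule.smul_mem _ _ (D.b_mem_span hc)
  · change ⁅D.H i, D.H j⁆ ∈ _
    rw [D.H_H]
    exact Submodule.zero_mem _

lemma span_bas : Submodule.span ℂ (Set.range D.bas) = ⊤ := by
  let K : LieSubalgebra ℂ L :=
    { Submodule.span ℂ (Set.range D.bas) with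
      lie_mem' := by
        intro x y hx hy
        refine Submodule.span_induction₂ (p := fun x y _ _ => ⁅x, y⁆ ∈
          Submodule.span ℂ (Set.range D.bas)) ?_ ?_ ?_ ?_ ?_ ?_ ?_ hx hy
        · rintro _ _ ⟨k, rfl⟩ ⟨l, rfl⟩
          exact D.bas_lie_bas k l
        · intro y _; rw [zero_lie]; exact Submodule.zero_mem _
        · intro y _; rw [lie_zero]; exact Submodule.zero_mem _
        · intro x y z _ _ _ h1 h2; rw [add_lie]; exact Submodule.add_mem _ h1 h2
        · intro x y z _ _ _ h1 h2; rw [lie_add]; exact Submodule.add_mem _ h1 h2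
        · intro r x y _ _ h1; rw [smul_lie]; exact Submodule.smul_mem _ _ h1
        · intro r x y _ _ h1; rw [lie_smul]; exact Submodule.smul_mem _ _ h1 }
  have h1 : K = ⊤ := by
    apply D.gen
    · intro i
      change D.E i ∈ Submodule.span ℂ (Set.range D.bas)
      rw [← D.b_s]
      exact D.b_mem_span (ip_s_self i)
    · intro i
      change D.G i ∈ Submodule.span ℂ (Set.range D.bas)
      rw [← D.b_neg_s]
      exact D.b_mem_span (root_neg (ip_s_self i))
  exact congrArg LieSubalgebra.toSubmodule h1

lemma H_eq_zero_of_E {i : Fin 7} (h : D.E i = 0) : D.H i = 0 := by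
  have := D.chev.eg_self i
  rw [h, zero_lie] at this
  exact neg_eq_zero.1 this.symm

lemma EG_zero_of_H {i : Fin 7} (h : D.H i = 0) (j : Fin 7) (hij : ip (s i) (s j) ≠ 0) :
    D.E j = 0 ∧ D.G j = 0 := by
  have h1 := D.chev.he i j
  have h2 := D.chev.hg i j
  rw [h, zero_lie, ← Int.cast_smul_eq_zsmul ℂ] at h1 h2
  refine ⟨(smul_eq_zero.1 h1.symm).resolve_left (by exact_mod_cast hij),
    (smul_eq_zero.1 h2.symm).resolve_left (by exact_mod_cast (neg_ne_zero.2 hij))⟩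

lemma E_ne_zero [Nontrivial L] (i : Fin 7) : D.E i ≠ 0 := by
  intro h
  have conn : ∀ i j : Fin 7, ip (s i) (s j) ≠ 0 → D.E i = 0 → D.E j = 0 := fun i j hij hi =>
    (D.EG_zero_of_H (D.H_eq_zero_of_E hi) j hij).1
  have c02 := conn 0 2 (by decide)
  have c20 := conn 2 0 (by decide)
  have c23 := conn 2 3 (by decide)
  have c32 := conn 3 2 (by decide)
  have c13 := conn 1 3 (by decide)
  have c31 := conn 3 1 (by decide)
  have c34 := conn 3 4 (by decide)
  have c43 := conn 4 3 (by decide)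
  have c45 := conn 4 5 (by decide)
  have c54 := conn 5 4 (by decide)
  have c56 := conn 5 6 (by decide)
  have c65 := conn 6 5 (by decide)
  have h3 : D.E 3 = 0 := by
    fin_cases i
    exacts [c23 (c02 h), c13 h, c23 h, h, c43 h, c43 (c54 h), c43 (c54 (c65 h))]
  have hall : ∀ j, D.E j = 0 := by
    intro j
    fin_cases j
    exacts [c20 (c32 h3), c31 h3, c32 h3, h3, c34 h3, c45 (c34 h3), c56 (c45 (c34 h3))]
  have hallG : ∀ j, D.G j = 0 := fun j =>
    (D.EG_zero_of_H (D.H_eq_zero_of_E (hall j)) j (by rw [ip_s_self]; omega)).2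
  have hbot := D.gen ⊥ (fun i => by rw [hall i]; exact zero_mem _)
    (fun i => by rw [hallG i]; exact zero_mem _)
  obtain ⟨x, hx⟩ := exists_ne (0 : L)
  have : x ∈ (⊥ : LieSubalgebra ℂ L) := by rw [hbot]; trivial
  exact hx ((LieSubalgebra.mem_bot x).1 this)

lemma b_ne_zero [Nontrivial L] {a : V} (ha : ip a a = 2) : D.b a ≠ 0 := by
  intro h
  have h1 := D.b_neg ha
  rw [h, zero_lie] at h1
  have h2 : D.h a = 0 := neg_eq_zero.1 h1.symm
  have h3 : ∀ i, ip a (s i) = 0 := by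
    intro i
    have h4 : ⁅D.h a, bv D.E D.G (s i)⁆ = _ := D.chev.hv_bv (ip_s_self i) a
    rw [h2, zero_lie, ← Int.cast_smul_eq_zsmul ℂ] at h4
    have h5 := (smul_eq_zero.1 h4.symm).resolve_right (by
      have := D.b_s i
      rw [b] at this
      rw [this]
      exact D.E_ne_zero i)
    exact_mod_cast h5
  have h6 := ip_eq_sum a a
  simp_rw [fun i => ip_comm (s i) a, h3, mul_zero, Finset.sum_const_zero] at h6
  omega

lemma t_eq_zero [Nontrivial L] {w : Fin 7 → ℂ} (h : D.t w = 0) : w = 0 := by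
  funext i
  have h1 := D.t_b w (ip_s_self i)
  rw [h, zero_lie, wt_s] at h1
  exact (smul_eq_zero.1 h1.symm).resolve_right (D.b_ne_zero (ip_s_self i))

lemma sum_H_eq_t (d : Fin 7 → ℂ) : ∑ i, d i • D.H i = D.t (fun j => ∑ i, d i *
    (CartanMatrix.E₇ i j : ℂ)) := by
  have h1 : (fun j => ∑ i, d i * (CartanMatrix.E₇ i j : ℂ)) =
      ∑ i, d i • (fun j => (CartanMatrix.E₇ i j : ℂ)) := by
    funext j; simp
  have h2 : ∀ (S : Finset (Fin 7)) (f : Fin 7 → Fin 7 → ℂ), D.t (∑ i ∈ S, f i) =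
      ∑ i ∈ S, D.t (f i) := by
    intro S f
    induction S using Finset.cons_induction with
    | empty => simp [t]
    | cons a S ha ih => rw [Finset.sum_cons, Finset.sum_cons, t_add, ih]
  rw [h1, h2]
  refine Finset.sum_congr rfl fun i _ => ?_
  rw [t_smul, ← H_eq_t]

lemma linearIndependent_H [Nontrivial L] {d : Fin 7 → ℂ} (h : ∑ i, d i • D.H i = 0) : d = 0 := by
  rw [sum_H_eq_t] at h
  have h1 := D.t_eq_zero h
  have h2 : Matrix.vecMul d (CartanMatrix.E₇.map (Int.cast : ℤ → ℂ)) = 0 := h1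
  have h3 : CartanMatrix.E₇ * minv = Matrix.diagonal fun _ => (2 : ℤ) := by
    decide +kernel
  have h4 : (CartanMatrix.E₇.map (Int.cast : ℤ → ℂ)) * (minv.map (Int.cast : ℤ → ℂ)) =
      Matrix.diagonal fun _ => (2 : ℂ) := by
    have := congrArg (fun A => Matrix.map A (Int.castRingHom ℂ)) h3
    simp only [Matrix.map_mul] at this
    rw [Matrix.diagonal_map (by simp)] at this
    exact this
  have h5 := congrArg (fun v => Matrix.vecMul v (minv.map (Int.cast : ℤ → ℂ))) h2
  simp only [Matrix.vecMul_vecMul, h4, Matrix.zero_vecMul] at h5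
  funext i
  have h6 := congrFun h5 i
  rw [Matrix.vecMul_diagonal] at h6
  simpa using h6

lemma linearIndependent_bas [Nontrivial L] : LinearIndependent ℂ D.bas := by
  rw [Fintype.linearIndependent_iff]
  intro g hg
  rw [Fintype.sum_sum_type] at hg
  simp only [bas, Sum.elim_inl, Sum.elim_inr] at hg
  set v0 : L := ∑ i, g (Sum.inr i) • D.H i with hv0
  let f := LieAlgebra.ad ℂ L (D.t wreg)
  have hf0 : f v0 = 0 := by
    simp [f, hv0, D.t_H]
  have hinj : Function.Injective (fun a : Rt => wt a.1 wreg) := fun a b h =>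
    Subtype.ext (wt_wreg_inj a.2 b.2 h)
  have hz : v0 = 0 := by
    by_contra hne
    have hli : LinearIndependent ℂ (fun o : Option Rt => o.elim v0 (fun a => D.b a.1)) := by
      apply Module.End.eigenvectors_linearIndependent' f (fun o : Option Rt =>
        o.elim 0 (fun a => wt a.1 wreg))
      · rintro (_ | a) (_ | b) h
        · rfl
        · exact absurd h.symm (wt_wreg_ne_zero b.2)
        · exact absurd h (wt_wreg_ne_zero a.2)
        · rw [hinj h]
      · rintro (_ | a)
        · exact ⟨Module.End.mem_eigenspace_iff.2 (by simpa using hf0), hne⟩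
        · exact ⟨Module.End.mem_eigenspace_iff.2 (D.t_b wreg a.2), D.b_ne_zero a.2⟩
    rw [Fintype.linearIndependent_iff] at hli
    have := hli (fun o => o.elim 1 (fun a => g (Sum.inl a))) (by
      rw [Fintype.sum_option]
      simp only [Option.elim, one_smul]
      rw [add_comm]; exact hg) none
    simp at this
  have hd := D.linearIndependent_H hz
  rw [hz, add_zero] at hg
  have hli : LinearIndependent ℂ (fun a : Rt => D.b a.1) :=
    Module.End.eigenvectors_linearIndependent' f (fun a : Rt => wt a.1 wreg) hinj _
      fun a => ⟨Module.End.mem_eigenspace_iff.2 (D.t_b wreg a.2), D.b_ne_zero a.2⟩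
  rw [Fintype.linearIndependent_iff] at hli
  rintro (a | i)
  · exact hli (fun a => g (Sum.inl a)) hg a
  · exact congrFun hd i

/-- The Chevalley basis as a basis. -/
noncomputable def basis [Nontrivial L] : Module.Basis (Rt ⊕ Fin 7) ℂ L :=
  Module.Basis.mk D.linearIndependent_bas D.span_bas.ge

lemma basis_inl [Nontrivial L] (a : Rt) : D.basis (Sum.inl a) = D.b a.1 := by
  simp [basis, bas]

lemma basis_inr [Nontrivial L] (i : Fin 7) : D.basis (Sum.inr i) = D.H i := by
  simp [basis, bas]

end Data

end E7

namespace E7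

open CartanMatrix

/-- The generators of the free Lie algebra. -/
noncomputable abbrev fgen (x : Generators (Fin 7)) : FreeLieAlgebra ℂ (Generators (Fin 7)) :=
  FreeLieAlgebra.of ℂ x

/-- The linear quotient map from the free Lie algebra. -/
noncomputable def qlin : FreeLieAlgebra ℂ (Generators (Fin 7)) →ₗ[ℂ]
    (FreeLieAlgebra ℂ (Generators (Fin 7)) ⧸ (Relations.toIdeal ℂ CartanMatrix.E₇)) :=
  (LieSubmodule.Quotient.mk' (Relations.toIdeal ℂ CartanMatrix.E₇)).toLinearMap

/-- The quotient map from the free Lie algebra. -/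
noncomputable def qlie : FreeLieAlgebra ℂ (Generators (Fin 7)) →ₗ⁅ℂ⁆
    (FreeLieAlgebra ℂ (Generators (Fin 7)) ⧸ (Relations.toIdeal ℂ CartanMatrix.E₇)) :=
  { qlin with map_lie' := fun {_ _} => rfl }

/-- The quotient map from the free Lie algebra to `e₇`. -/
noncomputable def qmk : FreeLieAlgebra ℂ (Generators (Fin 7)) →ₗ⁅ℂ⁆ LieAlgebra.e₇ ℂ := qlie

lemma qmk_surjective : Function.Surjective qmk :=
  LieSubmodule.Quotient.surjective_mk' (Relations.toIdeal ℂ CartanMatrix.E₇)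

lemma qmk_eq_zero {x : FreeLieAlgebra ℂ (Generators (Fin 7))}
    (h : x ∈ Relations.toSet ℂ CartanMatrix.E₇) : qmk x = 0 :=
  (LieSubmodule.Quotient.mk_eq_zero' (N := Relations.toIdeal ℂ CartanMatrix.E₇) (m := x)).2
    (LieSubmodule.subset_lieSpan h)

noncomputable def gE (i : Fin 7) : LieAlgebra.e₇ ℂ := qmk (fgen (.E i))
noncomputable def gF (i : Fin 7) : LieAlgebra.e₇ ℂ := qmk (fgen (.F i))
noncomputable def gH (i : Fin 7) : LieAlgebra.e₇ ℂ := qmk (fgen (.H i))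

lemma rel_HH (i j : Fin 7) : ⁅gH i, gH j⁆ = 0 := by
  rw [gH, gH, ← LieHom.map_lie]
  apply qmk_eq_zero
  simp only [Relations.toSet, Set.mem_union]
  exact Or.inl <| Or.inl <| Or.inl <| Or.inl <| Or.inl ⟨(i, j), rfl⟩

lemma rel_EF (i j : Fin 7) (h : i ≠ j) : ⁅gE i, gF j⁆ = 0 := by
  rw [gE, gF, ← LieHom.map_lie]
  apply qmk_eq_zero
  simp only [Relations.toSet, Set.mem_union]
  exact Or.inl <| Or.inl <| Or.inl <| Or.inl <| Or.inr ⟨(i, j), if_neg h⟩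

lemma rel_EF_self (i : Fin 7) : ⁅gE i, gF i⁆ = gH i := by
  rw [gE, gF, gH, ← LieHom.map_lie, ← sub_eq_zero, ← map_sub]
  apply qmk_eq_zero
  simp only [Relations.toSet, Set.mem_union]
  exact Or.inl <| Or.inl <| Or.inl <| Or.inl <| Or.inr ⟨(i, i), if_pos rfl⟩

lemma rel_HE (i j : Fin 7) : ⁅gH i, gE j⁆ = CartanMatrix.E₇ i j • gE j := by
  rw [gE, gH, ← LieHom.map_lie, ← sub_eq_zero, ← map_zsmul, ← map_sub]
  apply qmk_eq_zero
  simp only [Relations.toSet, Set.mem_union]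
  exact Or.inl <| Or.inl <| Or.inl <| Or.inr ⟨(i, j), rfl⟩

lemma rel_HF (i j : Fin 7) : ⁅gH i, gF j⁆ = -CartanMatrix.E₇ i j • gF j := by
  rw [gF, gH, ← LieHom.map_lie, neg_smul, eq_neg_iff_add_eq_zero, ← map_zsmul, ← map_add]
  apply qmk_eq_zero
  simp only [Relations.toSet, Set.mem_union]
  exact Or.inl <| Or.inl <| Or.inr ⟨(i, j), rfl⟩

lemma rel_adE_zero (i j : Fin 7) (h : CartanMatrix.E₇ i j = 0) : ⁅gE i, gE j⁆ = 0 := by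
  have h1 : qmk (Relations.adE ℂ CartanMatrix.E₇ (i, j)) = 0 := by
    apply qmk_eq_zero
    simp only [Relations.toSet, Set.mem_union]
    exact Or.inl <| Or.inr ⟨(i, j), rfl⟩
  simp only [Relations.adE, Function.uncurry_apply_pair, h] at h1
  rw [gE, gE, ← LieHom.map_lie]
  simpa using h1

lemma rel_adE_one (i j : Fin 7) (h : CartanMatrix.E₇ i j = -1) : ⁅gE i, ⁅gE i, gE j⁆⁆ = 0 := by
  have h1 : qmk (Relations.adE ℂ CartanMatrix.E₇ (i, j)) = 0 := by
    apply qmk_eq_zero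
    simp only [Relations.toSet, Set.mem_union]
    exact Or.inl <| Or.inr ⟨(i, j), rfl⟩
  simp only [Relations.adE, Function.uncurry_apply_pair, h] at h1
  rw [gE, gE, ← LieHom.map_lie, ← LieHom.map_lie]
  simpa using h1

lemma rel_adF_zero (i j : Fin 7) (h : CartanMatrix.E₇ i j = 0) : ⁅gF i, gF j⁆ = 0 := by
  have h1 : qmk (Relations.adF ℂ CartanMatrix.E₇ (i, j)) = 0 := by
    apply qmk_eq_zero
    simp only [Relations.toSet, Set.mem_union]
    exact Or.inr ⟨(i, j), rfl⟩
  simp only [Relations.adF, Function.uncurry_apply_pair, h] at h1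
  rw [gF, gF, ← LieHom.map_lie]
  simpa using h1

lemma rel_adF_one (i j : Fin 7) (h : CartanMatrix.E₇ i j = -1) : ⁅gF i, ⁅gF i, gF j⁆⁆ = 0 := by
  have h1 : qmk (Relations.adF ℂ CartanMatrix.E₇ (i, j)) = 0 := by
    apply qmk_eq_zero
    simp only [Relations.toSet, Set.mem_union]
    exact Or.inr ⟨(i, j), rfl⟩
  simp only [Relations.adF, Function.uncurry_apply_pair, h] at h1
  rw [gF, gF, ← LieHom.map_lie, ← LieHom.map_lie]
  simpa using h1

lemma chev_e7 : Chev gE (fun i => - gF i) gH where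
  serreE := ⟨fun i j h => rel_adE_zero i j (by rwa [ip_s_s] at h),
    fun i j h => rel_adE_one i j (by rwa [ip_s_s] at h)⟩
  serreG := ⟨fun i j h => by rw [neg_lie, lie_neg, rel_adF_zero i j (by rwa [ip_s_s] at h)]; simp,
    fun i j h => by
      rw [neg_lie, neg_lie, lie_neg, lie_neg, lie_neg, rel_adF_one i j (by rwa [ip_s_s] at h)]
      simp⟩
  hh := rel_HH
  eg i j h := by rw [lie_neg, rel_EF i j h, neg_zero]
  eg_self i := by rw [lie_neg, rel_EF_self i]
  he i j := by rw [rel_HE, ip_s_s]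
  hg i j := by rw [lie_neg, rel_HF, ip_s_s, smul_neg]

lemma gen_free (K : LieSubalgebra ℂ (FreeLieAlgebra ℂ (Generators (Fin 7))))
    (h : ∀ x, FreeLieAlgebra.of ℂ x ∈ K) : K = ⊤ := by
  let f : FreeLieAlgebra ℂ (Generators (Fin 7)) →ₗ⁅ℂ⁆ K :=
    FreeLieAlgebra.lift ℂ fun x => ⟨FreeLieAlgebra.of ℂ x, h x⟩
  have h1 : K.incl.comp f = LieHom.id := by
    ext x
    simp [f]
  rw [eq_top_iff]
  intro x _
  have := congrArg (fun g => g x) h1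
  simp only [LieHom.comp_apply, LieHom.id_apply] at this
  rw [← this]
  exact (f x).2

/-- The Chevalley generators of `e₇`. -/
noncomputable def e7data : Data (LieAlgebra.e₇ ℂ) where
  E := gE
  G := fun i => - gF i
  H := gH
  chev := chev_e7
  gen K hE hG := by
    have hF : ∀ i, gF i ∈ K := fun i => by simpa using K.neg_mem (hG i)
    have h1 : K.comap qmk = ⊤ := by
      apply gen_free
      rintro (i | i | i)
      · change gH i ∈ K
        rw [← rel_EF_self]
        exact K.lie_mem (hE i) (hF i)
      · exact hE i
      · exact hF i
    rw [eq_top_iff]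
    intro x _
    obtain ⟨y, rfl⟩ := qmk_surjective x
    have : y ∈ K.comap qmk := by rw [h1]; trivial
    exact this

end E7

namespace E7

lemma mem_of_sum_mem {ι M : Type*} [AddCommGroup M] [Module ℂ M] (f : Module.End ℂ M)
    (p : Submodule ℂ M) (hp : ∀ x ∈ p, f x ∈ p) (μ : ι → ℂ) (hμ : Function.Injective μ)
    (S : Finset ι) : ∀ v : ι → M, (∀ i ∈ S, f (v i) = μ i • v i) → ∑ i ∈ S, v i ∈ p →
    ∀ i ∈ S, v i ∈ p := by
  induction S using Finset.cons_induction with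
  | empty => simp
  | cons a S ha ih =>
    intro v hv h
    rw [Finset.sum_cons] at h
    have h1 : f (v a + ∑ i ∈ S, v i) - μ a • (v a + ∑ i ∈ S, v i) ∈ p :=
      p.sub_mem (hp _ h) (p.smul_mem _ h)
    have h2 : f (v a + ∑ i ∈ S, v i) - μ a • (v a + ∑ i ∈ S, v i) =
        ∑ i ∈ S, (μ i - μ a) • v i := by
      rw [map_add, hv a (Finset.mem_cons_self _ _), map_sum, smul_add, add_sub_add_left_eq_sub,
        Finset.smul_sum, ← Finset.sum_sub_distrib]
      refine Finset.sum_congr rfl fun i hi => ?_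
      rw [hv i (Finset.mem_cons_of_mem hi), sub_smul]
    rw [h2] at h1
    have h3 := ih (fun i => (μ i - μ a) • v i) (fun i hi => by
      rw [map_smul, hv i (Finset.mem_cons_of_mem hi), smul_comm]) h1
    have h4 : ∀ i ∈ S, v i ∈ p := by
      intro i hi
      have hne : μ i - μ a ≠ 0 := sub_ne_zero.2 fun e => ha (hμ e ▸ hi)
      exact (p.smul_mem_iff hne).1 (h3 i hi)
    intro i hi
    rcases Finset.mem_cons.1 hi with rfl | hi
    · have := p.sub_mem h (p.sum_mem h4)
      rwa [add_sub_cancel_right] at this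
    · exact h4 i hi

namespace Data

variable {L : Type*} [LieRing L] [LieAlgebra ℂ L] (D : Data L)

include D in
lemma finiteDimensional : FiniteDimensional ℂ L := by
  have : (⊤ : Submodule ℂ L).FG := by
    rw [← D.span_bas]
    exact Submodule.fg_span (Set.finite_range _)
  exact Module.finite_def.2 this

lemma h_b {a c : V} (hc : ip c c = 2) : ⁅D.h a, D.b c⁆ = ip a c • D.b c := D.chev.hv_bv hc a

include D in
lemma hasTrivialRadical [Nontrivial L] : LieAlgebra.HasTrivialRadical ℂ L := by
  have := D.finiteDimensional
  rw [LieAlgebra.hasTrivialRadical_iff_no_abelian_ideals]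
  intro I hI
  have hab : ∀ x ∈ I, ∀ y ∈ I, ⁅x, y⁆ = 0 := by
    intro x hx y hy
    have := LieModule.IsTrivial.trivial (⟨x, hx⟩ : I) (⟨y, hy⟩ : I)
    exact congrArg Subtype.val this
  have hb : ∀ a : V, ip a a = 2 → D.b a ∉ I := by
    intro a ha h
    have h1 : ⁅D.b a, D.b (-a)⁆ ∈ I := lie_mem_left ℂ L I _ _ h
    rw [D.b_neg ha, neg_mem_iff] at h1
    have h2 := hab _ h1 _ h
    rw [D.h_b ha, ha, ← Int.cast_smul_eq_zsmul ℂ] at h2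
    exact (smul_ne_zero (by norm_num) (D.b_ne_zero ha)) h2
  rw [LieSubmodule.eq_bot_iff]
  intro x hx
  have hx2 := D.basis.sum_repr x
  set c := D.basis.repr x
  clear_value c
  rw [Fintype.sum_sum_type] at hx2
  simp only [basis_inl, basis_inr] at hx2
  let v : Option Rt → L := fun o => o.elim (∑ i, c (Sum.inr i) • D.H i)
    (fun a => c (Sum.inl a) • D.b a.1)
  have hd : ∀ o : Option Rt, v o ∈ I.toSubmodule := by
    intro o
    refine mem_of_sum_mem (LieAlgebra.ad ℂ L (D.t wreg)) I.toSubmodule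
      (fun x hx => lie_mem_right ℂ L I _ _ hx) (fun o : Option Rt => o.elim 0 fun a => wt a.1 wreg)
      ?_ Finset.univ v ?_ ?_ o (Finset.mem_univ _)
    · rintro (_ | a) (_ | b) h
      · rfl
      · exact absurd h.symm (wt_wreg_ne_zero b.2)
      · exact absurd h (wt_wreg_ne_zero a.2)
      · exact congrArg some (Subtype.ext (wt_wreg_inj a.2 b.2 h))
    · rintro (_ | a) -
      · simp [v, D.t_H]
      · change ⁅D.t wreg, c (Sum.inl a) • D.b a.1⁆ = wt a.1 wreg • c (Sum.inl a) • D.b a.1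
        rw [lie_smul, D.t_b wreg a.2, smul_comm]
    · rw [Fintype.sum_option]
      simp only [v, Option.elim]
      rw [add_comm, hx2]
      exact hx
  have hc : ∀ a : Rt, c (Sum.inl a) = 0 := by
    intro a
    by_contra hne
    exact hb a.1 a.2 ((I.toSubmodule.smul_mem_iff hne).1 (hd (some a)))
  have h0 := hd none
  simp only [hc, zero_smul, Finset.sum_const_zero, zero_add] at hx2
  rw [sum_H_eq_t] at hx2
  set w := fun j => ∑ i, c (Sum.inr i) * (CartanMatrix.E₇ i j : ℂ)
  clear_value w
  have hw : w = 0 := by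
    funext i
    by_contra hne
    have h1 : ⁅x, D.b (s i)⁆ ∈ I := lie_mem_left ℂ L I _ _ hx
    rw [← hx2, D.t_b _ (ip_s_self i), wt_s] at h1
    exact hb (s i) (ip_s_self i) ((I.toSubmodule.smul_mem_iff hne).1 h1)
  rw [← hx2, hw]
  simp [t]

include D in
lemma isKilling [Nontrivial L] : LieAlgebra.IsKilling ℂ L := by
  have := D.finiteDimensional
  have := D.hasTrivialRadical
  infer_instance

end Data

end E7

namespace E7

section Linear

variable {M : Type*} [AddCommGroup M] [Module ℂ M]

lemma pow_mul_of_commute_lie {R : Type*} [Ring R] {A Z W : R} (hW : A * Z - Z * A = W)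
    (hAW : A * W = W * A) (n : ℕ) : A ^ (n + 1) * Z = Z * A ^ (n + 1) + (n + 1) * (W * A ^ n) := by
  have hZ : A * Z = Z * A + W := by rw [← hW]; abel
  induction n with
  | zero => simp [hZ]
  | succ n ih =>
    rw [pow_succ', mul_assoc, ih, mul_add, ← mul_assoc, hZ, add_mul, mul_assoc, ← pow_succ']
    have h2 : A * ((n + 1) * (W * A ^ n)) = (n + 1) * (W * A ^ (n + 1)) := by
      rw [← mul_assoc, show A * ((n : R) + 1) = (n + 1) * A by
        simp [mul_add, add_mul, (Nat.cast_commute n A).eq], mul_assoc, ← mul_assoc A, hAW,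
        mul_assoc, ← pow_succ']
    rw [h2]
    push_cast
    noncomm_ring

lemma isNilpotent_of_commute_lie {R : Type*} [Ring R] [Algebra ℂ R] {A Z W : R}
    (hW : A * Z - Z * A = W) (hAW : A * W = W * A) (hA : IsNilpotent A) : IsNilpotent W := by
  have key : ∀ m c : ℕ, W ^ c * A ^ m = 0 → IsNilpotent W := by
    intro m
    induction m with
    | zero => intro c h; exact ⟨c, by simpa using h⟩
    | succ m ih =>
      intro c h
      have hc : A ^ (m + 1) * W ^ c = W ^ c * A ^ (m + 1) :=
        ((show Commute A W from hAW).pow_pow _ _).eq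
      have h1 : W ^ c * (A ^ (m + 1) * Z) * W ^ c = 0 := by
        rw [← mul_assoc, h, zero_mul, zero_mul]
      have hn : W ^ c * ((m : R) + 1) = (m + 1) * W ^ c := by
        simp [mul_add, add_mul, (Nat.cast_commute m (W ^ c)).eq]
      rw [pow_mul_of_commute_lie hW hAW, mul_add, add_mul, mul_assoc, mul_assoc, hc, h, mul_zero,
        mul_zero, zero_add, ← mul_assoc, hn, mul_assoc, mul_assoc, mul_assoc,
        ((show Commute A W from hAW).pow_pow m c).eq, ← mul_assoc W, ← pow_succ',
        ← mul_assoc (W ^ c), ← pow_add] at h1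
      apply ih (c + (c + 1))
      have h2 : ((m : ℂ) + 1) • (W ^ (c + (c + 1)) * A ^ m) = 0 := by
        rw [Algebra.smul_def]
        simpa using h1
      exact (smul_eq_zero.1 h2).resolve_left (by exact_mod_cast Nat.succ_ne_zero m)
  obtain ⟨N, hN⟩ := hA
  exact key N 0 (by simpa using hN)

lemma trace_mul_eq_zero [FiniteDimensional ℂ M] {A Z W : Module.End ℂ M}
    (hW : A * Z - Z * A = W) (hAW : A * W = W * A) (hA : IsNilpotent A) :
    LinearMap.trace ℂ M (A * Z) = 0 := by
  have hWn := isNilpotent_of_commute_lie hW hAW hA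
  have key : ∀ μ : ℂ, (A * Z).HasEigenvalue μ → μ = 0 := by
    intro μ hμ
    obtain ⟨x, hx⟩ := hμ.exists_hasEigenvector
    have hx0 := hx.2
    have hx1 : A (Z x) = μ • x := hx.apply_eq_smul
    obtain ⟨N, hN⟩ := hA
    classical
    have hex : ∃ n, (A ^ n) x = 0 := ⟨N, by rw [hN]; rfl⟩
    set k := Nat.find hex with hk
    have hk0 : k ≠ 0 := by
      intro h
      have := Nat.find_spec hex
      rw [← hk, h] at this
      exact hx0 (by simpa using this)
    obtain ⟨m, hm⟩ := Nat.exists_eq_succ_of_ne_zero hk0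
    have h1 : (A ^ (m + 1)) x = 0 := by
      have := Nat.find_spec hex
      rwa [← hk, hm] at this
    have h2 : (A ^ m) x ≠ 0 := Nat.find_min hex (by omega)
    have h3 := LinearMap.congr_fun (pow_mul_of_commute_lie hW hAW m) x
    rw [Module.End.mul_apply, pow_succ, Module.End.mul_apply, hx1] at h3
    rw [← pow_succ, LinearMap.add_apply, Module.End.mul_apply, h1, map_zero, zero_add,
      map_smul] at h3
    have h4 : W ((A ^ m) x) = (μ / (m + 1)) • (A ^ m) x := by
      have h5 : ((m : Module.End ℂ M) + 1) * (W * A ^ m) = ((m : ℂ) + 1) • (W * A ^ m) := by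
        rw [Algebra.smul_def]; simp
      rw [h5] at h3
      rw [div_eq_inv_mul, mul_smul, h3]
      simp only [LinearMap.smul_apply, Module.End.mul_apply]
      rw [smul_smul, inv_mul_cancel₀ (by exact_mod_cast Nat.succ_ne_zero m), one_smul]
    have h6 : W.HasEigenvalue (μ / (m + 1)) :=
      Module.End.hasEigenvalue_of_hasEigenvector ⟨Module.End.mem_eigenspace_iff.2 h4, h2⟩
    have h7 := h6.isNilpotent_of_isNilpotent hWn
    have h8 := h7.eq_zero
    rw [div_eq_zero_iff] at h8
    exact h8.resolve_right (by exact_mod_cast Nat.succ_ne_zero m)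
  rw [Module.End.trace_eq_sum_roots_charpoly_of_splits (IsAlgClosed.splits _)]
  apply Multiset.sum_eq_zero
  intro μ hμ
  exact key μ ((Module.End.hasEigenvalue_iff_isRoot_charpoly _ _).2
    (Polynomial.isRoot_of_mem_roots hμ))

lemma eigenvalue_nat_of_ker {E Y H : M →ₗ[ℂ] M} (h1 : ∀ x, E (Y x) = Y (E x) + H x)
    (h2 : ∀ x, H (E x) = E (H x) + (2 : ℂ) • E x) (hE : IsNilpotent E) {x : M} (hx : E x = 0)
    (hx0 : x ≠ 0) {μ : ℂ} (hμ : H x = μ • x) : ∃ n : ℕ, μ = n := by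
  have hpow : ∀ (n : ℕ) (w : M), (E ^ (n + 1)) (Y w) =
      Y ((E ^ (n + 1)) w) + ((n : ℂ) + 1) • (H ((E ^ n) w) - (n : ℂ) • (E ^ n) w) := by
    intro n w
    induction n with
    | zero => simp [h1]
    | succ n ih =>
      have h3 : E (H ((E ^ n) w)) = H ((E ^ (n + 1)) w) - (2 : ℂ) • (E ^ (n + 1)) w := by
        rw [pow_succ', Module.End.mul_apply, h2]; abel
      rw [pow_succ', Module.End.mul_apply, ih, map_add, h1, map_smul, map_sub, h3, map_smul,
        ← Module.End.mul_apply E (E ^ n), ← pow_succ', ← Module.End.mul_apply E (E ^ (n + 1)),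
        ← pow_succ']
      push_cast
      module
  by_contra hne
  push Not at hne
  have key : ∀ n : ℕ, ∃ w, (E ^ n) w = x := by
    intro n
    induction n with
    | zero => exact ⟨x, rfl⟩
    | succ n ih =>
      obtain ⟨w, hw⟩ := ih
      have h3 := hpow n w
      rw [pow_succ', Module.End.mul_apply, Module.End.mul_apply, hw, hx, map_zero, zero_add, hμ,
        ← sub_smul, smul_smul] at h3
      have hc : ((n : ℂ) + 1) * (μ - n) ≠ 0 := mul_ne_zero (by exact_mod_cast Nat.succ_ne_zero n)
        (sub_ne_zero.2 (hne n))
      refine ⟨(((n : ℂ) + 1) * (μ - n))⁻¹ • Y w, ?_⟩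
      rw [map_smul, pow_succ', Module.End.mul_apply, h3, smul_smul, inv_mul_cancel₀ hc, one_smul]
  obtain ⟨N, hN⟩ := hE
  obtain ⟨w, hw⟩ := key N
  rw [hN] at hw
  exact hx0 hw.symm

end Linear

end E7

namespace E7

open LieAlgebra

variable {L : Type*} [LieRing L] [LieAlgebra ℂ L]

/-- The element `s` is a characteristic of the nilpotent element `e`. -/
structure IsChar (e s : L) : Prop where
  ss : ⨆ μ, (ad ℂ L s).eigenspace μ = ⊤
  lie_e : ⁅s, e⁆ = (2 : ℂ) • e
  ker_nat : ∀ (x : L) (μ : ℂ), ⁅e, x⁆ = 0 → ⁅s, x⁆ = μ • x → x ≠ 0 → ∃ n : ℕ, μ = n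
  int : ∀ (x : L) (μ : ℂ), ⁅s, x⁆ = μ • x → x ≠ 0 → ∃ n : ℤ, μ = n
  surj : ∀ (z : L) (k : ℤ), 1 ≤ k → ⁅s, z⁆ = (k : ℂ) • z →
    ∃ x, ⁅s, x⁆ = ((k - 2 : ℤ) : ℂ) • x ∧ ⁅e, x⁆ = z

lemma killingForm_eigen {s x y : L} {μ ν : ℂ} (hx : ⁅s, x⁆ = μ • x) (hy : ⁅s, y⁆ = ν • y)
    (h : μ + ν ≠ 0) : killingForm ℂ L x y = 0 := by
  have h1 := LieModule.traceForm_apply_lie_apply' ℂ L L s x y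
  rw [hx, hy, map_smul, map_smul, LinearMap.smul_apply, smul_eq_mul, smul_eq_mul,
    eq_neg_iff_add_eq_zero, ← add_mul] at h1
  exact (mul_eq_zero.1 h1).resolve_left h

lemma eigen_lie {s x y : L} {μ ν : ℂ} (hx : ⁅s, x⁆ = μ • x) (hy : ⁅s, y⁆ = ν • y) :
    ⁅s, ⁅x, y⁆⁆ = (μ + ν) • ⁅x, y⁆ := by
  rw [leibniz_lie, hx, hy, smul_lie, lie_smul, add_smul]

lemma eigen_int {e s : L} (hnil : IsNilpotent (ad ℂ L e)) (hse : ⁅s, e⁆ = (2 : ℂ) • e)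
    (hk : ∀ (x : L) (μ : ℂ), ⁅e, x⁆ = 0 → ⁅s, x⁆ = μ • x → x ≠ 0 → ∃ n : ℕ, μ = n)
    (x : L) (μ : ℂ) (hx : ⁅s, x⁆ = μ • x) (hx0 : x ≠ 0) : ∃ n : ℤ, μ = n := by
  obtain ⟨N, hN⟩ := hnil
  have key : ∀ (n : ℕ) (x : L) (μ : ℂ), ((ad ℂ L e) ^ n) x = 0 → ⁅s, x⁆ = μ • x → x ≠ 0 →
      ∃ n : ℤ, μ = n := by
    intro n
    induction n with
    | zero => intro x μ h _ h0; exact absurd (by simpa using h) h0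
    | succ n ih =>
      intro x μ h h1 h0
      by_cases he : ⁅e, x⁆ = 0
      · obtain ⟨m, hm⟩ := hk x μ he h1 h0
        exact ⟨m, by simpa using hm⟩
      · rw [pow_succ, Module.End.mul_apply] at h
        obtain ⟨m, hm⟩ := ih _ _ h (eigen_lie hse h1) he
        refine ⟨m - 2, ?_⟩
        push_cast
        rw [← hm]
        ring
  exact key N x μ (by rw [hN]; rfl) hx hx0

lemma eq_zero_of_killingForm [IsKilling ℂ L] {u : L} (h : ∀ x, killingForm ℂ L u x = 0) : u = 0 := by
  have h1 : u ∈ LinearMap.ker (killingForm ℂ L) := by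
    rw [LinearMap.mem_ker]; ext x; simpa using h x
  simpa using h1

variable [FiniteDimensional ℂ L] [IsKilling ℂ L]

lemma exists_killingForm_eq (φ : Module.Dual ℂ L) : ∃ u, ∀ x, killingForm ℂ L u x = φ x := by
  obtain ⟨u, hu⟩ := ((killingForm ℂ L).toDual
    (LieAlgebra.IsKilling.killingForm_nondegenerate ℂ L)).surjective φ
  exact ⟨u, fun x => by rw [← hu]; rfl⟩

lemma eigen_surj {e s : L} (hss : ⨆ μ, (ad ℂ L s).eigenspace μ = ⊤) (hse : ⁅s, e⁆ = (2 : ℂ) • e)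
    (hk : ∀ (x : L) (μ : ℂ), ⁅e, x⁆ = 0 → ⁅s, x⁆ = μ • x → x ≠ 0 → ∃ n : ℕ, μ = n)
    (z : L) (k : ℤ) (hk1 : 1 ≤ k) (hz : ⁅s, z⁆ = (k : ℂ) • z) :
    ∃ x, ⁅s, x⁆ = ((k - 2 : ℤ) : ℂ) • x ∧ ⁅e, x⁆ = z := by
  by_contra hne
  set U : Submodule ℂ L := ((ad ℂ L s).eigenspace ((k - 2 : ℤ) : ℂ)).map (ad ℂ L e) with hU
  have hzU : z ∉ U := by
    rintro ⟨x, hx, h⟩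
    exact hne ⟨x, Module.End.mem_eigenspace_iff.1 hx, h⟩
  obtain ⟨φ, h1, h2⟩ := Submodule.exists_le_ker_of_notMem hzU
  have h3 : ∀ u : L, ∃ u', ⁅s, u'⁆ = (-k : ℂ) • u' ∧ ∀ y, ⁅s, y⁆ = (k : ℂ) • y →
      killingForm ℂ L u y = killingForm ℂ L u' y := by
    intro u
    have hu' : u ∈ ⨆ μ, (ad ℂ L s).eigenspace μ := by rw [hss]; trivial
    induction hu' using Submodule.iSup_induction' with
    | mem μ x hx =>
      have hx : ⁅s, x⁆ = μ • x := Module.End.mem_eigenspace_iff.1 hx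
      by_cases h : μ = -k
      · exact ⟨x, by rw [← h]; exact hx, fun _ _ => rfl⟩
      · refine ⟨0, by simp, fun y hy => ?_⟩
        rw [map_zero, LinearMap.zero_apply]
        exact killingForm_eigen hx hy fun h' => h (eq_neg_of_add_eq_zero_left h')
    | zero => exact ⟨0, by simp, fun _ _ => rfl⟩
    | add x y _ _ hx hy =>
      obtain ⟨x', h3, h4⟩ := hx
      obtain ⟨y', h5, h6⟩ := hy
      refine ⟨x' + y', by rw [lie_add, h3, h5, smul_add], fun v hv => ?_⟩
      rw [map_add, map_add, LinearMap.add_apply, LinearMap.add_apply, h4 v hv, h6 v hv]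
  obtain ⟨u, hu⟩ := exists_killingForm_eq φ
  obtain ⟨u', h3, h4⟩ := h3 u
  have h5 : ⁅e, u'⁆ = 0 := by
    apply eq_zero_of_killingForm
    intro x
    have hx' : x ∈ ⨆ μ, (ad ℂ L s).eigenspace μ := by rw [hss]; trivial
    induction hx' using Submodule.iSup_induction' with
    | mem μ x hx =>
      have hx : ⁅s, x⁆ = μ • x := Module.End.mem_eigenspace_iff.1 hx
      by_cases h : μ = ((k - 2 : ℤ) : ℂ)
      · have h6 : ⁅s, ⁅e, x⁆⁆ = (k : ℂ) • ⁅e, x⁆ := by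
          rw [eigen_lie hse hx, h]; push_cast; congr 1; ring
        have h7 : φ ⁅e, x⁆ = 0 :=
          h2 ⟨x, by rw [← h]; exact Module.End.mem_eigenspace_iff.2 hx, rfl⟩
        have h8 := LieModule.traceForm_apply_lie_apply' ℂ L L e u' x
        change killingForm ℂ L _ _ = - killingForm ℂ L _ _ at h8
        rw [h8, ← h4 _ h6, hu, h7, neg_zero]
      · apply killingForm_eigen (eigen_lie hse h3) hx
        intro h'
        apply h
        push_cast
        linear_combination h'
    | zero => simp
    | add x y _ _ hx hy => rw [map_add, hx, hy, add_zero]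
  have h6 : u' = 0 := by
    by_contra h0
    obtain ⟨n, hn⟩ := hk u' _ h5 h3 h0
    have h7 : -k = (n : ℤ) := by exact_mod_cast hn
    omega
  have h7 := h4 z hz
  rw [h6, map_zero, LinearMap.zero_apply, hu] at h7
  exact h1 h7

lemma exists_lie_lie {e : L} (hnil : IsNilpotent (ad ℂ L e)) :
    ∃ y, ⁅e, ⁅e, y⁆⁆ = -((2 : ℂ) • e) := by
  suffices h : e ∈ LinearMap.range (ad ℂ L e * ad ℂ L e) by
    obtain ⟨y, hy⟩ := h
    refine ⟨-((2 : ℂ) • y), ?_⟩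
    rw [lie_neg, lie_neg, lie_smul, lie_smul]
    rw [Module.End.mul_apply] at hy
    exact congrArg (fun x => -((2 : ℂ) • x)) hy
  by_contra hne
  obtain ⟨φ, h1, h2⟩ := Submodule.exists_le_ker_of_notMem hne
  obtain ⟨u, hu⟩ := exists_killingForm_eq φ
  have h3 : ⁅e, ⁅e, u⁆⁆ = 0 := by
    apply eq_zero_of_killingForm
    intro x
    have h8 := LieModule.traceForm_apply_lie_apply' ℂ L L e ⁅e, u⁆ x
    have h9 := LieModule.traceForm_apply_lie_apply' ℂ L L e u ⁅e, x⁆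
    change killingForm ℂ L _ _ = - killingForm ℂ L _ _ at h8 h9
    rw [h8, h9, hu, neg_neg]
    exact h2 ⟨x, rfl⟩
  apply h1
  rw [← hu, LieModule.traceForm_comm, LieModule.traceForm_apply_apply]
  have h4 : ad ℂ L e * ad ℂ L u - ad ℂ L u * ad ℂ L e = ad ℂ L ⁅e, u⁆ := by
    ext x
    exact (lie_lie e u x).symm
  have h5 : ad ℂ L e * ad ℂ L ⁅e, u⁆ = ad ℂ L ⁅e, u⁆ * ad ℂ L e := by
    ext x
    have := lie_lie e ⁅e, u⁆ x
    rw [h3, zero_lie] at this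
    exact sub_eq_zero.1 this.symm
  exact trace_mul_eq_zero h4 h5 hnil

lemma exists_derivation (h : L) : ∃ s : L, ⨆ μ, (ad ℂ L s).eigenspace μ = ⊤ ∧
    (∀ (x : L) (μ : ℂ), ⁅s, x⁆ = μ • x ↔ x ∈ (ad ℂ L h).maxGenEigenspace μ) := by
  obtain ⟨N, -, S, hS₀, hN, hS, hSN⟩ := (ad ℂ L h).exists_isNilpotent_isSemisimple
  replace hS₀ : Commute (ad ℂ L h) S := Algebra.commute_of_mem_adjoin_self hS₀
  have hNS : N = ad ℂ L h - S := by rw [hSN]; abel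
  rw [hNS] at hN
  have aux : ∀ (x : L) (μ : ℂ), x ∈ (ad ℂ L h).maxGenEigenspace μ → S x = μ • x := by
    intro x μ hx
    exact Module.End.apply_eq_of_mem_of_comm_of_isFinitelySemisimple_of_isNil hx hS₀
      hS.isFinitelySemisimple hN
  have aux2 : ∀ (x : L) (μ : ℂ), S x = μ • x → x ∈ (ad ℂ L h).maxGenEigenspace μ := by
    intro x μ hx
    have hx2 : x ∈ S.eigenspace μ := Module.End.mem_eigenspace_iff.2 hx
    rw [Module.End.mem_maxGenEigenspace]
    obtain ⟨k, hk⟩ := hN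
    refine ⟨k, ?_⟩
    have h1 : ∀ n : ℕ, (((ad ℂ L h) - μ • 1) ^ n) x = (((ad ℂ L h) - S) ^ n) x := by
      intro n
      induction n with
      | zero => rfl
      | succ n ih =>
        have hc : Commute (ad ℂ L h - S) S := hS₀.sub_left rfl
        have hc2 := LinearMap.congr_fun (hc.pow_left n).eq x
        rw [Module.End.mul_apply, Module.End.mul_apply, hx, map_smul] at hc2
        rw [pow_succ', Module.End.mul_apply, ih, pow_succ', Module.End.mul_apply]
        simp only [LinearMap.sub_apply, LinearMap.smul_apply, Module.End.one_apply, ← hc2]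
    rw [h1, hk]
    rfl
  have h_der : ∀ y z : L, S ⁅y, z⁆ = ⁅S y, z⁆ + ⁅y, S z⁆ := by
    intro y z
    have hy : y ∈ ⨆ μ, S.eigenspace μ := by rw [hS.iSup_eigenspace_eq_top]; trivial
    have hz : z ∈ ⨆ μ, S.eigenspace μ := by rw [hS.iSup_eigenspace_eq_top]; trivial
    induction hy using Submodule.iSup_induction' with
    | mem α y hy =>
      induction hz using Submodule.iSup_induction' with
      | mem β z hz =>
        have hy := Module.End.mem_eigenspace_iff.1 hy
        have hz := Module.End.mem_eigenspace_iff.1 hz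
        have h1 : ⁅y, z⁆ ∈ (ad ℂ L h).maxGenEigenspace (α + β) :=
          LieModule.lie_mem_maxGenEigenspace_toEnd (aux2 y α hy) (aux2 z β hz)
        rw [aux _ _ h1, hy, hz, smul_lie, lie_smul, add_smul]
      | zero => simp
      | add _ _ _ _ h h' => simp only [lie_add, map_add, h, h']; abel
    | zero => simp
    | add _ _ _ _ h h' => simp only [add_lie, map_add, h, h']; abel
  replace h_der : ∀ y z : L, S ⁅y, z⁆ = ⁅y, S z⁆ - ⁅z, S y⁆ := by
    simp_rw [← lie_skew (S _) _, add_comm, ← sub_eq_add_neg] at h_der; assumption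
  let S' : LieDerivation ℂ L L := ⟨S, h_der⟩
  obtain ⟨s, hs⟩ := LieDerivation.IsKilling.exists_eq_ad S'
  have hsS : ad ℂ L s = S := by
    rw [← LieDerivation.coe_ad_apply_eq_ad_apply s, hs]
  refine ⟨s, by rw [hsS]; exact hS.iSup_eigenspace_eq_top, fun x μ => ?_⟩
  have : ⁅s, x⁆ = S x := by rw [← hsS]; rfl
  rw [this]
  exact ⟨aux2 x μ, aux x μ⟩

lemma exists_isChar {e : L} (hnil : IsNilpotent (ad ℂ L e)) : ∃ s, IsChar e s := by
  obtain ⟨y, hy⟩ := exists_lie_lie hnil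
  obtain ⟨s, hss, hs⟩ := exists_derivation ⁅e, y⁆
  have hhe : ⁅⁅e, y⁆, e⁆ = (2 : ℂ) • e := by rw [← lie_skew, hy, neg_neg]
  have hse : ⁅s, e⁆ = (2 : ℂ) • e := by
    rw [hs]
    exact (ad ℂ L ⁅e, y⁆).genEigenspace_le_maximal _ 1
      (Module.End.mem_eigenspace_iff.2 hhe)
  have hk : ∀ (x : L) (μ : ℂ), ⁅e, x⁆ = 0 → ⁅s, x⁆ = μ • x → x ≠ 0 → ∃ n : ℕ, μ = n := by
    intro x μ hx hμ hx0
    rw [hs, Module.End.mem_maxGenEigenspace] at hμ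
    obtain ⟨k, hk⟩ := hμ
    induction k generalizing x with
    | zero => exact absurd (by simpa using hk) hx0
    | succ k ih =>
      set x' := ((ad ℂ L ⁅e, y⁆) - μ • 1) x with hx'
      have hx'2 : x' = ⁅⁅e, y⁆, x⁆ - μ • x := rfl
      by_cases h0 : x' = 0
      · rw [hx'2, sub_eq_zero] at h0
        refine eigenvalue_nat_of_ker (E := ad ℂ L e) (Y := ad ℂ L y) (H := ad ℂ L ⁅e, y⁆)
          (fun z => ?_) (fun z => ?_) hnil hx hx0 h0
        · simp only [ad_apply]
          rw [leibniz_lie e y z, add_comm]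
        · simp only [ad_apply]
          rw [leibniz_lie ⁅e, y⁆ e z, hhe, smul_lie, add_comm]
      · refine ih x' ?_ h0 ?_
        · rw [hx'2, lie_sub, lie_smul, hx, smul_zero, sub_zero, leibniz_lie e ⁅e, y⁆ x, hx,
            lie_zero, add_zero, hy, neg_lie, smul_lie, hx, smul_zero, neg_zero]
        · rw [hx', ← Module.End.mul_apply, ← pow_succ]; exact hk
  exact ⟨s, hss, hse, hk, eigen_int hnil hse hk, eigen_surj hss hse hk⟩

end E7

namespace E7

open NormedSpace

section Exp

variable {W : Type*} [NormedAddCommGroup W] [NormedSpace ℂ W] [CompleteSpace W]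

lemma exp_mul_exp_neg (D : W →L[ℂ] W) : exp D * exp (-D) = 1 := by
  let := NormedAlgebra.restrictScalars ℚ ℂ (W →L[ℂ] W)
  rw [← exp_add_of_commute (Commute.neg_right rfl), add_neg_cancel, exp_zero]

lemma exp_neg_mul_exp (D : W →L[ℂ] W) : exp (-D) * exp D = 1 := by
  simpa using exp_mul_exp_neg (-D)

omit [CompleteSpace W] in
lemma hasDerivAt_bilin (B : W →L[ℂ] W →L[ℂ] W) {f g : ℂ → W} {f' g' : W} {t : ℂ}
    (hf : HasDerivAt f f' t) (hg : HasDerivAt g g' t) :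
    HasDerivAt (fun t => B (f t) (g t)) (B f' (g t) + B (f t) g') t := by
  have h : HasDerivAt (fun t => B (f t)) (B f') t := B.hasFDerivAt.comp_hasDerivAt t hf
  exact h.clm_apply hg

lemma exp_derivation (B : W →L[ℂ] W →L[ℂ] W) (D : W →L[ℂ] W)
    (hD : ∀ u v, D (B u v) = B (D u) v + B u (D v)) (u v : W) :
    exp D (B u v) = B (exp D u) (exp D v) := by
  have h1 : ∀ (w : W) (t : ℂ), HasDerivAt (fun t : ℂ => exp (t • D) w) (D (exp (t • D) w)) t := by
    intro w t
    have := (hasDerivAt_exp_smul_const' (𝕂 := ℂ) D t).clm_apply (hasDerivAt_const t w)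
    simpa using this
  have h2 : ∀ t : ℂ, HasDerivAt (fun t : ℂ => B (exp (t • D) u) (exp (t • D) v))
      (D (B (exp (t • D) u) (exp (t • D) v))) t := by
    intro t
    rw [hD]
    exact hasDerivAt_bilin B (h1 u t) (h1 v t)
  have h3 : ∀ t : ℂ, HasDerivAt
      (fun t : ℂ => exp (t • (-D)) (B (exp (t • D) u) (exp (t • D) v))) 0 t := by
    intro t
    have := (hasDerivAt_exp_smul_const (𝕂 := ℂ) (-D) t).clm_apply (h2 t)
    simpa using this
  have h4 := is_const_of_deriv_eq_zero (fun t => (h3 t).differentiableAt)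
    (fun t => (h3 t).deriv) 1 0
  simp only [one_smul, zero_smul, exp_zero, one_apply_eq_self] at h4
  rw [← h4, ← mul_apply_eq_comp, exp_mul_exp_neg, one_apply_eq_self]

lemma exp_apply_of_eigen (D : W →L[ℂ] W) (v : W) (μ : ℂ) (h : D v = μ • v) :
    exp D v = Complex.exp μ • v := by
  have h3 : ∀ t : ℂ, HasDerivAt (fun t : ℂ => Complex.exp (t * -μ) • exp (t • D) v) 0 t := by
    intro t
    have h1 := (hasDerivAt_exp_smul_const (𝕂 := ℂ) D t).clm_apply (hasDerivAt_const t v)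
    have h2 := ((hasDerivAt_mul_const (x := t) (-μ)).cexp).smul h1
    convert! h2 using 1
    simp [h, smul_smul]
  have h4 := is_const_of_deriv_eq_zero (fun t => (h3 t).differentiableAt)
    (fun t => (h3 t).deriv) 1 0
  simp only [one_mul, one_smul, zero_mul, zero_smul, exp_zero, one_apply_eq_self,
    Complex.exp_zero] at h4
  conv_rhs => rw [← h4]
  rw [smul_smul, ← Complex.exp_add, add_neg_cancel, Complex.exp_zero, one_smul]

lemma exp_map_nhds {Q : Type*} [NormedAddCommGroup Q] [NormedSpace ℂ Q] [CompleteSpace Q]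
    (A : W →L[ℂ] W →L[ℂ] W) (r p q : Q →L[ℂ] W) (x : W)
    (h : ∀ z, ∃ c, A (r c) x + p c + q c = z) :
    ∀ᶠ z in nhds x, ∃ c, exp (A (r c)) (x + p c) + q c = z := by
  set f : Q → W := fun c => exp (A (r c)) (x + p c) + q c
  set f' : Q →L[ℂ] W := (A.flip x).comp r + p + q
  have hf : HasStrictFDerivAt f f' 0 := by
    have h1 : HasStrictFDerivAt (fun c => A (r c)) (A.comp r) 0 := (A.comp r).hasStrictFDerivAt
    have h2 : HasStrictFDerivAt (exp : (W →L[ℂ] W) → _) (1 : (W →L[ℂ] W) →L[ℂ] _)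
        (A (r 0)) := by
      simpa using hasStrictFDerivAt_exp_zero (𝕂 := ℂ) (𝔸 := W →L[ℂ] W)
    have h3 := h2.comp (0 : Q) h1
    have h4 : HasStrictFDerivAt (fun c => x + p c) p 0 := p.hasStrictFDerivAt.const_add x
    convert! (h3.clm_apply h4).add q.hasStrictFDerivAt using 1
    ext c
    simp [f', add_comm]
  have hs : f'.range = ⊤ := LinearMap.range_eq_top.2 h
  have h7 := hf.map_nhds_eq_of_surj hs
  have h8 : f 0 = x := by simp [f]
  rw [h8] at h7
  rw [← h7, Filter.eventually_map]
  exact Filter.Eventually.of_forall fun c => ⟨c, rfl⟩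

end Exp

section Lie

variable {L : Type*} [LieRing L] [LieAlgebra ℂ L] [FiniteDimensional ℂ L]

lemma exists_equiv_exp {W : Type*} [NormedAddCommGroup W] [NormedSpace ℂ W] [CompleteSpace W]
    (e : L ≃ₗ[ℂ] W) (y : L) (A : W →L[ℂ] W) (hA : ∀ v, A v = e ⁅y, e.symm v⁆) :
    ∃ φ : L ≃ₗ⁅ℂ⁆ L, ∀ v, φ v = e.symm (exp A (e v)) := by
  have : FiniteDimensional ℂ W := e.finiteDimensional
  let B' : W →ₗ[ℂ] W →L[ℂ] W :=
    { toFun := fun y => LinearMap.toContinuousLinearMap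
        (e.toLinearMap ∘ₗ (LieAlgebra.ad ℂ L (e.symm y) : L →ₗ[ℂ] L) ∘ₗ e.symm.toLinearMap)
      map_add' := fun y z => by ext v; simp
      map_smul' := fun c y => by ext v; simp }
  let B : W →L[ℂ] W →L[ℂ] W := LinearMap.toContinuousLinearMap B'
  have hB : ∀ y v, B y v = e ⁅e.symm y, e.symm v⁆ := fun y v => rfl
  clear_value B
  have hder : ∀ u v, A (B u v) = B (A u) v + B u (A v) := by
    intro u v
    simp only [hA, hB, LinearEquiv.symm_apply_apply]
    rw [← map_add, ← leibniz_lie]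
  exact ⟨{
      toFun := fun v => e.symm (exp A (e v))
      invFun := fun v => e.symm (exp (-A) (e v))
      map_add' := fun u v => by simp
      map_smul' := fun c u => by simp
      map_lie' := fun {u v} => by
        have h1 := exp_derivation B A hder (e u) (e v)
        rw [hB, hB] at h1
        simp only [LinearEquiv.symm_apply_apply] at h1
        rw [h1]
        simp
      left_inv := fun v => by
        simp [← mul_apply_eq_comp, exp_neg_mul_exp]
      right_inv := fun v => by
        simp [← mul_apply_eq_comp, exp_mul_exp_neg] }, fun v => rfl⟩

/-- The automorphism `exp (ad y)`. -/
lemma exists_equiv_eigen (y : L) : ∃ φ : L ≃ₗ⁅ℂ⁆ L, ∀ (v : L) (μ : ℂ), ⁅y, v⁆ = μ • v →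
    φ v = Complex.exp μ • v := by
  let W := EuclideanSpace ℂ (Fin (Module.finrank ℂ L))
  let e : L ≃ₗ[ℂ] W := LinearEquiv.ofFinrankEq _ _ (by simp [W])
  let A : W →L[ℂ] W := LinearMap.toContinuousLinearMap
    (e.toLinearMap ∘ₗ (LieAlgebra.ad ℂ L y : L →ₗ[ℂ] L) ∘ₗ e.symm.toLinearMap)
  have hA : ∀ v, A v = e ⁅y, e.symm v⁆ := fun v => rfl
  obtain ⟨φ, hφ⟩ := exists_equiv_exp e y A hA
  refine ⟨φ, fun v μ h => ?_⟩
  rw [hφ, exp_apply_of_eigen A (e v) μ (by rw [hA, e.symm_apply_apply, h, map_smul]), map_smul,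
    e.symm_apply_apply]

variable [TopologicalSpace L] [IsTopologicalAddGroup L] [ContinuousSMul ℂ L] [T2Space L]

/-- Local surjectivity of `(y, a, b) ↦ exp (ad y) (x + a) + b`. -/
lemma eventually_exists_equiv (x : L) (S₀ S₁ S₂ : Submodule ℂ L)
    (h : ∀ z, ∃ y ∈ S₀, ∃ a ∈ S₁, ∃ b ∈ S₂, ⁅y, x⁆ + a + b = z) :
    ∀ᶠ z in nhds x, ∃ φ : L ≃ₗ⁅ℂ⁆ L, (∀ v, (∀ y ∈ S₀, ⁅y, v⁆ = 0) → φ v = v) ∧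
      ∃ a ∈ S₁, ∃ b ∈ S₂, φ (x + a) + b = z := by
  let W := EuclideanSpace ℂ (Fin (Module.finrank ℂ L))
  let e : L ≃L[ℂ] W := ContinuousLinearEquiv.ofFinrankEq (by simp [W])
  let A' : W →ₗ[ℂ] W →L[ℂ] W :=
    { toFun := fun y => LinearMap.toContinuousLinearMap
        (e.toLinearMap ∘ₗ (LieAlgebra.ad ℂ L (e.symm y) : L →ₗ[ℂ] L) ∘ₗ e.symm.toLinearMap)
      map_add' := fun y z => by ext v; simp
      map_smul' := fun c y => by ext v; simp }
  let A : W →L[ℂ] W →L[ℂ] W := LinearMap.toContinuousLinearMap A'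
  have hA : ∀ y v, A y v = e ⁅e.symm y, e.symm v⁆ := fun y v => rfl
  clear_value A
  have hφ : ∀ y, ∃ φ : L ≃ₗ⁅ℂ⁆ L, ∀ v, φ v = e.symm (exp (A y) (e v)) := fun y =>
    exists_equiv_exp e.toLinearEquiv (e.symm y) (A y) (hA y)
  choose φ hφ using hφ
  let T (S : Submodule ℂ L) : Submodule ℂ W := S.map e.toLinearMap
  have hT : ∀ S v, v ∈ T S ↔ e.symm v ∈ S := by
    intro S v
    constructor
    · rintro ⟨u, hu, rfl⟩
      simpa using hu
    · exact fun h => ⟨_, h, by simp⟩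
  clear_value T
  have : CompleteSpace (T S₀ × T S₁ × T S₂) := FiniteDimensional.complete ℂ _
  have key := exp_map_nhds (Q := T S₀ × T S₁ × T S₂) A
    ((T S₀).subtypeL ∘L ContinuousLinearMap.fst ℂ _ _)
    ((T S₁).subtypeL ∘L ContinuousLinearMap.fst ℂ _ _ ∘L ContinuousLinearMap.snd ℂ _ _)
    ((T S₂).subtypeL ∘L ContinuousLinearMap.snd ℂ _ _ ∘L ContinuousLinearMap.snd ℂ _ _) (e x) (by
      intro z
      obtain ⟨y, hy, a, ha, b, hb, hz⟩ := h (e.symm z)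
      refine ⟨(⟨e y, by simpa [hT] using hy⟩, ⟨e a, by simpa [hT] using ha⟩,
        ⟨e b, by simpa [hT] using hb⟩), ?_⟩
      have := congrArg e hz
      simpa [hA] using this)
  have h2 : Filter.Tendsto e (nhds x) (nhds (e x)) := e.continuous.tendsto x
  filter_upwards [h2.eventually key] with z hz
  obtain ⟨⟨⟨y, hy⟩, ⟨a, ha⟩, ⟨b, hb⟩⟩, hz⟩ := hz
  refine ⟨φ y, fun v hv => ?_, e.symm a, (hT _ _).1 ha, e.symm b, (hT _ _).1 hb, ?_⟩
  · rw [hφ, exp_apply_of_eigen _ _ 0, Complex.exp_zero, one_smul, e.symm_apply_apply]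
    rw [hA, e.symm_apply_apply, hv _ ((hT _ _).1 hy), map_zero, zero_smul]
  · apply e.injective
    rw [← hz, hφ]
    simp

end Lie

end E7

namespace E7

open LieAlgebra LieSubalgebra

lemma rel_of_finite_line {L : Type*} [AddCommGroup L] [Module ℂ L]
    [TopologicalSpace L] [IsTopologicalAddGroup L] [ContinuousSMul ℂ L] {R : Set L}
    {r : L → L → Prop} (hr : ∀ x ∈ R, ∀ᶠ z in nhds x, z ∈ R → r x z)
    (htrans : ∀ x y z, x ∈ R → y ∈ R → z ∈ R → r x y → r y z → r x z)
    (hsymm : ∀ x y, x ∈ R → y ∈ R → r x y → r y x) {x y : L} (hx : x ∈ R) (hy : y ∈ R)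
    (hfin : {c : ℂ | x + c • (y - x) ∉ R}.Finite) : r x y := by
  have hconn := (hfin.countable.isConnected_compl_of_one_lt_rank (E := ℂ)
    (by rw [Complex.rank_real_complex]; norm_num)).isPreconnected
  have hcont : Continuous fun c : ℂ => x + c • (y - x) := by fun_prop
  have h := hconn.induction₂ (fun c d => r (x + c • (y - x)) (x + d • (y - x)))
    (fun c hc => by
      have hc' : x + c • (y - x) ∈ R := by simpa using hc
      have h1 := (hcont.tendsto c).eventually (hr _ hc')
      filter_upwards [nhdsWithin_le_nhds h1, self_mem_nhdsWithin] with d hd hd2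
      exact hd (by simpa using hd2))
    (fun a b c ha hb hc => htrans _ _ _ (by simpa using ha) (by simpa using hb) (by simpa using hc))
    (fun a b ha hb => hsymm _ _ (by simpa using ha) (by simpa using hb))
    (x := 0) (y := 1) (by simpa using hx) (by simpa using hy)
  simpa using h

variable {L : Type*} [LieRing L] [LieAlgebra ℂ L] [FiniteDimensional ℂ L]

lemma finite_not_isRegular {x y : L} (hy : IsRegular ℂ y) :
    {c : ℂ | ¬ IsRegular ℂ (x + c • (y - x))}.Finite := by
  classical
  let b := Module.finBasis ℂ L
  obtain ⟨P, hP⟩ : ∃ P : MvPolynomial (Fin (Module.finrank ℂ L)) ℂ, ∀ x : L,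
      IsRegular ℂ x ↔ MvPolynomial.eval (b.repr x) P ≠ 0 :=
    ⟨_, fun x => isRegular_iff_coeff_polyCharpoly_rank_ne_zero ℂ b x⟩
  let p : Polynomial ℂ := MvPolynomial.aeval
    (fun i => Polynomial.C (b.repr x i) + Polynomial.X * Polynomial.C (b.repr (y - x) i)) P
  have hp : ∀ c, p.eval c = MvPolynomial.eval (b.repr (x + c • (y - x))) P := by
    intro c
    have : p.eval c = Polynomial.aeval c p := by simp
    rw [this, ← AlgHom.comp_apply, MvPolynomial.comp_aeval]
    simp [MvPolynomial.aeval_eq_eval]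
    congr
  have hp0 : p ≠ 0 := by
    intro h
    have h1 := hp 1
    rw [one_smul, add_sub_cancel, h, Polynomial.eval_zero] at h1
    exact (hP y).1 hy h1.symm
  refine (Polynomial.finite_setOfPred_isRoot hp0).subset fun c hc => ?_
  rw [Set.mem_ofPred_eq, hP, not_not] at hc
  exact (hp c).trans hc

lemma exists_isRegular_of_nhds [TopologicalSpace L] [IsTopologicalAddGroup L]
    [ContinuousSMul ℂ L] {x : L} {N : Set L} (hN : N ∈ nhds x) : ∃ z ∈ N, IsRegular ℂ z := by
  obtain ⟨y, hy⟩ := exists_isRegular ℂ L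
  have hcont : Continuous fun c : ℂ => x + c • (y - x) := by fun_prop
  have h0 := hcont.tendsto 0
  simp only [zero_smul, add_zero] at h0
  have h1 : (fun c : ℂ => x + c • (y - x)) ⁻¹' N ∈ nhds (0 : ℂ) := h0 hN
  have h2 := (finite_not_isRegular (x := x) hy)
  obtain ⟨c, hc, hc2⟩ := ((infinite_of_mem_nhds (0 : ℂ) h1).sdiff h2).nonempty
  exact ⟨_, hc, by simpa using hc2⟩

omit [FiniteDimensional ℂ L] in
lemma map_mem_engel (φ : L ≃ₗ⁅ℂ⁆ L) (x z : L) : φ z ∈ engel ℂ (φ x) ↔ z ∈ engel ℂ x := by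
  have h : ∀ (n : ℕ) (z : L), ((ad ℂ L (φ x)) ^ n) (φ z) = φ (((ad ℂ L x) ^ n) z) := by
    intro n
    induction n with
    | zero => intro z; rfl
    | succ n ih =>
      intro z
      rw [pow_succ, pow_succ, Module.End.mul_apply, Module.End.mul_apply, ← ih, ad_apply, ad_apply,
        LieEquiv.map_lie]
  simp only [mem_engel_iff, h]
  exact exists_congr fun n => by rw [map_eq_zero_iff φ φ.injective]

omit [FiniteDimensional ℂ L] in
lemma finrank_engel_map (φ : L ≃ₗ⁅ℂ⁆ L) (x : L) :
    Module.finrank ℂ (engel ℂ (φ x)) = Module.finrank ℂ (engel ℂ x) := by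
  refine (LinearEquiv.finrank_eq (LinearEquiv.ofSubmodules (φ : L ≃ₗ[ℂ] L)
    (engel ℂ x).toSubmodule (engel ℂ (φ x)).toSubmodule ?_)).symm
  ext z
  obtain ⟨z, rfl⟩ := φ.surjective z
  constructor
  · rintro ⟨w, hw, h⟩
    rw [← h]
    exact (map_mem_engel φ x w).2 hw
  · exact fun h => ⟨z, (map_mem_engel φ x z).1 h, rfl⟩

lemma isRegular_map (φ : L ≃ₗ⁅ℂ⁆ L) (x : L) : IsRegular ℂ (φ x) ↔ IsRegular ℂ x := by
  rw [isRegular_iff_finrank_engel_eq_rank, isRegular_iff_finrank_engel_eq_rank, finrank_engel_map]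

lemma engel_eq_of_isRegular {x y : L} (hx : IsRegular ℂ x) (hy : IsRegular ℂ y)
    (hxy : y ∈ engel ℂ x) : engel ℂ y = engel ℂ x := by
  rw [isRegular_iff_finrank_engel_eq_rank] at hx hy
  have hle : engel ℂ x ≤ engel ℂ y := by
    refine engel_isBot_of_isMin (K := ℂ) ?_ (engel ℂ x)
      ⟨engel ℂ x, x, self_mem_engel ℂ x, rfl⟩ le_rfl ?_ ⟨engel ℂ y, y, hxy, rfl⟩
    · rw [Cardinal.mk_complex]
      exact (Cardinal.natCast_lt_aleph0.trans Cardinal.aleph0_lt_continuum).le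
    · rintro ⟨_, z, hz, rfl⟩ h
      have h' : (engel ℂ z).toSubmodule ≤ (engel ℂ x).toSubmodule := h
      have := Submodule.eq_of_le_of_finrank_le h' (hx.trans_le (rank_le_finrank_engel ℂ z))
      exact this.ge
  have h' : (engel ℂ x).toSubmodule ≤ (engel ℂ y).toSubmodule := hle
  have := Submodule.eq_of_le_of_finrank_le h' (hy.trans hx.symm).le
  exact LieSubalgebra.toSubmodule_injective this.symm

lemma exists_lie_add_mem_engel (x z : L) : ∃ y : L, ∃ a ∈ engel ℂ x, ⁅y, x⁆ + a = z := by
  have h := LinearMap.isCompl_iSup_ker_pow_iInf_range_pow (ad ℂ L x)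
  have hz : z ∈ (⨆ n, LinearMap.ker ((ad ℂ L x) ^ n)) ⊔ ⨅ n, LinearMap.range ((ad ℂ L x) ^ n) := by
    rw [h.sup_eq_top]; trivial
  obtain ⟨a, ha, c, hc, rfl⟩ := Submodule.mem_sup.1 hz
  obtain ⟨y, hy⟩ := (Submodule.mem_iInf _).1 hc 1
  refine ⟨-y, a, ?_, ?_⟩
  · rw [mem_engel_iff]
    have hmono : Monotone fun n => LinearMap.ker ((ad ℂ L x) ^ n) := by
      intro m n hmn v hv
      obtain ⟨k, rfl⟩ := Nat.exists_eq_add_of_le' hmn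
      change ((ad ℂ L x) ^ (k + m)) v = 0
      rw [pow_add, Module.End.mul_apply, show ((ad ℂ L x) ^ m) v = 0 from hv, map_zero]
    obtain ⟨n, hn⟩ := (Submodule.mem_iSup_of_directed _ hmono.directed_le).1 ha
    exact ⟨n, hn⟩
  · rw [← lie_skew, lie_neg, neg_neg, add_comm]
    rw [← hy, pow_one]; rfl

end E7

namespace E7

open LieAlgebra LieSubalgebra

variable {L : Type*} [LieRing L] [LieAlgebra ℂ L] [FiniteDimensional ℂ L]

section Topology

variable [TopologicalSpace L] [IsTopologicalAddGroup L] [ContinuousSMul ℂ L] [T2Space L]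

lemma exists_equiv_engel {x y : L} (hx : IsRegular ℂ x) (hy : IsRegular ℂ y) :
    ∃ φ : L ≃ₗ⁅ℂ⁆ L, ∀ z, φ z ∈ engel ℂ y ↔ z ∈ engel ℂ x := by
  refine rel_of_finite_line (R := {x | IsRegular ℂ x})
    (r := fun x y => ∃ φ : L ≃ₗ⁅ℂ⁆ L, ∀ z, φ z ∈ engel ℂ y ↔ z ∈ engel ℂ x)
    (fun x hx => ?_) ?_ ?_ hx hy (finite_not_isRegular hy)
  · have h := eventually_exists_equiv x ⊤ (engel ℂ x).toSubmodule ⊥ (fun z => by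
      obtain ⟨y, a, ha, h⟩ := exists_lie_add_mem_engel x z
      exact ⟨y, trivial, a, ha, 0, zero_mem _, by rw [add_zero, h]⟩)
    filter_upwards [h] with z ⟨φ, _, a, ha, b, hb, h⟩ hz
    rw [(Submodule.mem_bot ℂ).1 hb, add_zero] at h
    subst h
    refine ⟨φ, fun w => ?_⟩
    rw [map_mem_engel, engel_eq_of_isRegular hx ((isRegular_map φ _).1 hz)
      (add_mem (self_mem_engel ℂ x) ha)]
  · rintro x y z - - - ⟨φ, h⟩ ⟨ψ, h'⟩
    exact ⟨φ.trans ψ, fun w => (h' _).trans (h w)⟩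
  · rintro x y - - ⟨φ, h⟩
    refine ⟨φ.symm, fun w => ?_⟩
    rw [← h, LieEquiv.apply_symm_apply]

omit [FiniteDimensional ℂ L] [TopologicalSpace L] [IsTopologicalAddGroup L]
  [ContinuousSMul ℂ L] [T2Space L] in
lemma exists_ker_add_range {s : L} (hs : ⨆ μ, (ad ℂ L s).eigenspace μ = ⊤) (z : L) :
    ∃ y : L, ∃ a : L, ⁅s, a⁆ = 0 ∧ ⁅y, s⁆ + a = z := by
  have hz : z ∈ ⨆ μ, (ad ℂ L s).eigenspace μ := by rw [hs]; trivial
  induction hz using Submodule.iSup_induction' with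
  | mem μ x hx =>
    have hx : ⁅s, x⁆ = μ • x := Module.End.mem_eigenspace_iff.1 hx
    by_cases h : μ = 0
    · exact ⟨0, x, by rw [hx, h, zero_smul], by simp⟩
    · refine ⟨-(μ⁻¹ • x), 0, by simp, ?_⟩
      rw [← lie_skew, lie_neg, neg_neg, lie_smul, hx, smul_smul, inv_mul_cancel₀ h, one_smul,
        add_zero]
  | zero => exact ⟨0, 0, by simp, by simp⟩
  | add x y _ _ hx hy =>
    obtain ⟨y₁, a₁, h₁, rfl⟩ := hx
    obtain ⟨y₂, a₂, h₂, rfl⟩ := hy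
    exact ⟨y₁ + y₂, a₁ + a₂, by rw [lie_add, h₁, h₂, add_zero], by rw [add_lie]; abel⟩

/-- Regular elements commuting with a given semisimple element. -/
lemma exists_isRegular_lie_eq_zero {s : L} (hs : ⨆ μ, (ad ℂ L s).eigenspace μ = ⊤) :
    ∃ a : L, ⁅s, a⁆ = 0 ∧ IsRegular ℂ (s + a) := by
  have h := eventually_exists_equiv s ⊤ (LinearMap.ker (ad ℂ L s)) ⊥ (fun z => by
      obtain ⟨y, a, ha, h⟩ := exists_ker_add_range hs z
      exact ⟨y, trivial, a, ha, 0, zero_mem _, by rw [add_zero, h]⟩)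
  obtain ⟨z, ⟨φ, -, a, ha, b, hb, h⟩, hz⟩ := exists_isRegular_of_nhds h
  rw [(Submodule.mem_bot ℂ).1 hb, add_zero] at h
  subst h
  exact ⟨a, ha, (isRegular_map φ _).1 hz⟩

lemma exists_equiv_mem_engel {s x : L} (hs : ⨆ μ, (ad ℂ L s).eigenspace μ = ⊤)
    (hx : IsRegular ℂ x) : ∃ φ : L ≃ₗ⁅ℂ⁆ L, φ s ∈ engel ℂ x := by
  obtain ⟨a, ha, h⟩ := exists_isRegular_lie_eq_zero hs
  obtain ⟨φ, hφ⟩ := exists_equiv_engel h hx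
  refine ⟨φ, (hφ s).2 ?_⟩
  rw [mem_engel_iff]
  refine ⟨1, ?_⟩
  rw [pow_one, ad_apply, add_lie, lie_self, zero_add, ← lie_skew, ha, neg_zero]

/-- An element is regular if it commutes only with an abelian subalgebra, locally of constant
dimension. -/
lemma isRegular_of_engel {x : L} (h : ∀ a ∈ engel ℂ x, engel ℂ x ≤ engel ℂ (x + a)) :
    IsRegular ℂ x := by
  have h1 := eventually_exists_equiv x ⊤ (engel ℂ x).toSubmodule ⊥ (fun z => by
      obtain ⟨y, a, ha, h⟩ := exists_lie_add_mem_engel x z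
      exact ⟨y, trivial, a, ha, 0, zero_mem _, by rw [add_zero, h]⟩)
  obtain ⟨z, ⟨φ, -, a, ha, b, hb, h2⟩, hz⟩ := exists_isRegular_of_nhds h1
  rw [(Submodule.mem_bot ℂ).1 hb, add_zero] at h2
  subst h2
  rw [isRegular_map, isRegular_iff_finrank_engel_eq_rank] at hz
  rw [isRegular_iff_finrank_engel_eq_rank]
  refine le_antisymm ?_ (rank_le_finrank_engel ℂ x)
  rw [← hz]
  exact Submodule.finrank_mono (show (engel ℂ x).toSubmodule ≤
    (engel ℂ (x + a)).toSubmodule from h a ha)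

/-- Generic elements of an eigenspace are conjugate. -/
lemma exists_equiv_of_surj {s : L} {μ : ℂ} (hs : ⨆ μ, (ad ℂ L s).eigenspace μ = ⊤) {x y : L}
    (hx : ⁅s, x⁆ = μ • x) (hy : ⁅s, y⁆ = μ • y)
    (hx' : ∀ z : L, ⁅s, z⁆ = μ • z → ∃ u : L, ⁅s, u⁆ = 0 ∧ ⁅x, u⁆ = z)
    (hy' : ∀ z : L, ⁅s, z⁆ = μ • z → ∃ u : L, ⁅s, u⁆ = 0 ∧ ⁅y, u⁆ = z) :
    ∃ φ : L ≃ₗ⁅ℂ⁆ L, φ s = s ∧ φ x = y := by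
  set K := LinearMap.ker (ad ℂ L s) with hK
  set V := (ad ℂ L s).eigenspace μ with hV
  have hVm : ∀ v, v ∈ V ↔ ⁅s, v⁆ = μ • v := fun v => Module.End.mem_eigenspace_iff
  have hKm : ∀ v, v ∈ K ↔ ⁅s, v⁆ = 0 := fun v => Iff.rfl
  refine rel_of_finite_line (R := {x | x ∈ V ∧ ∀ z ∈ V, ∃ u ∈ K, ⁅x, u⁆ = z})
    (r := fun x y => ∃ φ : L ≃ₗ⁅ℂ⁆ L, φ s = s ∧ φ x = y) ?_ ?_ ?_
    ⟨(hVm _).2 hx, fun z hz => hx' z ((hVm _).1 hz)⟩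
    ⟨(hVm _).2 hy, fun z hz => hy' z ((hVm _).1 hz)⟩ ?_
  · rintro x ⟨hx, hx'⟩
    set C := ⨆ (ν) (_ : ν ≠ μ), (ad ℂ L s).eigenspace ν with hC
    have hdisj : Disjoint V C := (ad ℂ L s).eigenspaces_iSupIndep μ
    have hcodisj : V ⊔ C = ⊤ := by
      rw [eq_top_iff, ← hs]
      refine iSup_le fun ν => ?_
      by_cases h : ν = μ
      · rw [h]; exact le_sup_left
      · have : (ad ℂ L s).eigenspace ν ≤ C :=
          le_iSup₂ (f := fun ν (_ : ν ≠ μ) => (ad ℂ L s).eigenspace ν) ν h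
        exact this.trans le_sup_right
    have h := eventually_exists_equiv x K ⊥ C (fun z => by
      have hz : z ∈ V ⊔ C := by rw [hcodisj]; trivial
      obtain ⟨v, hv, c, hc, rfl⟩ := Submodule.mem_sup.1 hz
      obtain ⟨u, hu, h⟩ := hx' v hv
      exact ⟨-u, neg_mem hu, 0, zero_mem _, c, hc, by rw [neg_lie, lie_skew, h, add_zero]⟩)
    filter_upwards [h] with z ⟨φ, hφ, a, ha, c, hc, h⟩ hz
    rw [(Submodule.mem_bot ℂ).1 ha, add_zero] at h
    have hφs : φ s = s := hφ s fun y hy => by rw [← lie_skew, (hKm y).1 hy, neg_zero]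
    refine ⟨φ, hφs, ?_⟩
    have hφx : φ x ∈ V := by
      rw [hVm]
      nth_rw 1 [← hφs]
      rw [← LieEquiv.map_lie, (hVm x).1 hx, map_smul]
    have hcV : c ∈ V := by
      have : c = z - φ x := by rw [← h]; abel
      rw [this]
      exact sub_mem hz.1 hφx
    have : c = 0 := Submodule.disjoint_def.1 hdisj c hcV hc
    rw [← h, this, add_zero]
  · rintro x y z - - - ⟨φ, h1, h2⟩ ⟨ψ, h3, h4⟩
    exact ⟨φ.trans ψ, by simp [h1, h3], by simp [h2, h4]⟩
  · rintro x y - - ⟨φ, h1, h2⟩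
    exact ⟨φ.symm, by rw [LieEquiv.symm_apply_eq, h1], by rw [LieEquiv.symm_apply_eq, h2]⟩
  · have hxV := (hVm _).2 hx
    have hyV := (hVm _).2 hy
    have hVK : ∀ v ∈ V, ∀ u ∈ K, ⁅v, u⁆ ∈ V := by
      intro v hv u hu
      rw [hVm, leibniz_lie, (hKm u).1 hu, lie_zero, add_zero, (hVm v).1 hv, smul_lie]
    let T (v : L) (hv : v ∈ V) : K →ₗ[ℂ] V := LinearMap.restrict (ad ℂ L v) (hVK v hv)
    have hT : ∀ v hv u, (T v hv u : L) = ⁅v, (u : L)⁆ := fun v hv u => rfl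
    clear_value T
    have hsurj : Function.Surjective (T x hxV) := by
      rintro ⟨z, hz⟩
      obtain ⟨u, hu, h⟩ := hx' z ((hVm z).1 hz)
      exact ⟨⟨u, hu⟩, Subtype.ext (by rw [hT]; exact h)⟩
    obtain ⟨σ, hσ⟩ := (T x hxV).exists_rightInverse_of_surjective (LinearMap.range_eq_top.2 hsurj)
    have hσ' : ∀ z : V, ⁅x, (σ z : L)⁆ = z := fun z => by
      rw [← hT x hxV]; exact congrArg Subtype.val (LinearMap.congr_fun hσ z)
    set B : Module.End ℂ V := (T (y - x) (sub_mem hyV hxV)) ∘ₗ σ with hB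
    have hfin := Module.End.finite_hasEigenvalue B
    refine (hfin.image fun ν => - ν⁻¹).subset fun c hc => ?_
    by_contra hne
    apply hc
    have hxc : x + c • (y - x) ∈ V := add_mem hxV (Submodule.smul_mem _ _ (sub_mem hyV hxV))
    refine ⟨hxc, ?_⟩
    have hinj : Function.Injective (1 + c • B : Module.End ℂ V) := by
      rw [injective_iff_map_eq_zero]
      intro z hz
      by_contra hz0
      apply hne
      have hz' : z + c • B z = 0 := hz
      have hc0 : c ≠ 0 := by
        rintro rfl
        rw [zero_smul, add_zero] at hz'
        exact hz0 hz'
      refine ⟨-c⁻¹, ?_, by simp⟩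
      refine Module.End.hasEigenvalue_of_hasEigenvector (x := z)
        ⟨Module.End.mem_eigenspace_iff.2 ?_, hz0⟩
      rw [neg_smul, eq_neg_iff_add_eq_zero]
      have := congrArg (fun w => c⁻¹ • w) hz'
      simp only [smul_add, smul_zero, smul_smul, inv_mul_cancel₀ hc0, one_smul] at this
      rw [add_comm, this]
    have hsur := LinearMap.surjective_of_injective hinj
    intro z hz
    obtain ⟨w, hw⟩ := hsur ⟨z, hz⟩
    refine ⟨σ w, (σ w).2, ?_⟩
    have h1 : (w : L) + c • (B w : L) = z := congrArg Subtype.val hw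
    rw [add_lie, hσ', smul_lie, ← h1, hB, LinearMap.comp_apply, hT]

end Topology

end E7

namespace E7

open LieAlgebra LieSubalgebra

variable {L : Type*} [LieRing L] [LieAlgebra ℂ L]

lemma equiv_lie_eq (φ : L ≃ₗ⁅ℂ⁆ L) {a b c : L} : ⁅φ a, b⁆ = φ c ↔ ⁅a, φ.symm b⁆ = c := by
  have h : ⁅φ a, b⁆ = φ ⁅a, φ.symm b⁆ := by
    have h1 : φ ⁅a, φ.symm b⁆ = ⁅φ a, φ (φ.symm b)⁆ := φ.toLieHom.map_lie _ _
    rw [h1, φ.apply_symm_apply]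
  rw [h]
  exact φ.injective.eq_iff

lemma equiv_lie_eq_smul (φ : L ≃ₗ⁅ℂ⁆ L) {a b : L} {μ : ℂ} :
    ⁅φ a, b⁆ = μ • b ↔ ⁅a, φ.symm b⁆ = μ • φ.symm b := by
  rw [← equiv_lie_eq φ]
  have h1 : φ (μ • φ.symm b) = μ • φ (φ.symm b) := φ.toLinearEquiv.map_smul _ _
  rw [h1, φ.apply_symm_apply]

lemma equiv_lie_eq_zero (φ : L ≃ₗ⁅ℂ⁆ L) {a b : L} : ⁅φ a, b⁆ = 0 ↔ ⁅a, φ.symm b⁆ = 0 := by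
  rw [← equiv_lie_eq φ]
  have h1 : φ 0 = 0 := φ.toLinearEquiv.map_zero
  rw [h1]

lemma iSup_eigenspace_map {s : L} (h : ⨆ μ, (ad ℂ L s).eigenspace μ = ⊤) (φ : L ≃ₗ⁅ℂ⁆ L) :
    ⨆ μ, (ad ℂ L (φ s)).eigenspace μ = ⊤ := by
  rw [eq_top_iff]
  have h1 : (⊤ : Submodule ℂ L) = (⨆ μ, (ad ℂ L s).eigenspace μ).map
      (φ.toLinearEquiv : L →ₗ[ℂ] L) := by
    rw [h, Submodule.map_top, LinearEquiv.range]
  rw [h1, Submodule.map_iSup]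
  refine iSup_mono fun μ => ?_
  rintro _ ⟨x, hx, rfl⟩
  have hx : x ∈ (ad ℂ L s).eigenspace μ := hx
  rw [Module.End.mem_eigenspace_iff, ad_apply] at hx ⊢
  change ⁅φ s, φ x⁆ = μ • φ x
  rw [equiv_lie_eq_smul, φ.symm_apply_apply, hx]

lemma IsChar.map {e s : L} (h : IsChar e s) (φ : L ≃ₗ⁅ℂ⁆ L) : IsChar (φ e) (φ s) where
  ss := iSup_eigenspace_map h.ss φ
  lie_e := by
    rw [equiv_lie_eq_smul, φ.symm_apply_apply, h.lie_e]
  ker_nat := fun x μ h1 h2 h3 => h.ker_nat (φ.symm x) μ ((equiv_lie_eq_zero φ).1 h1)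
    ((equiv_lie_eq_smul φ).1 h2) ((LinearEquiv.map_ne_zero_iff φ.symm.toLinearEquiv).2 h3)
  int := fun x μ h2 h3 => h.int (φ.symm x) μ
    ((equiv_lie_eq_smul φ).1 h2) ((LinearEquiv.map_ne_zero_iff φ.symm.toLinearEquiv).2 h3)
  surj := fun z k hk hz => by
    obtain ⟨x, hx, hx'⟩ := h.surj (φ.symm z) k hk ((equiv_lie_eq_smul φ).1 hz)
    refine ⟨φ x, ?_, ?_⟩
    · rwa [equiv_lie_eq_smul, φ.symm_apply_apply]
    · have h1 : ⁅φ e, φ x⁆ = φ (φ.symm z) := by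
        rwa [equiv_lie_eq, φ.symm_apply_apply]
      rwa [φ.apply_symm_apply] at h1

namespace Data

variable (D : Data L)

lemma t_t (w v : Fin 7 → ℂ) : ⁅D.t w, D.t v⁆ = 0 := by
  conv_lhs => rw [t.eq_1 D v]
  simp [lie_sum, D.t_H]

lemma h_s (i : Fin 7) : D.h (s i) = D.H i := hv_s i

section

variable [Nontrivial L]

lemma repr_t_lie (w : Fin 7 → ℂ) (x : L) (a : Rt) :
    D.basis.repr ⁅D.t w, x⁆ (Sum.inl a) = wt a.1 w * D.basis.repr x (Sum.inl a) := by
  have h : D.basis.coord (Sum.inl a) ∘ₗ (ad ℂ L (D.t w) : L →ₗ[ℂ] L) =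
      wt a.1 w • D.basis.coord (Sum.inl a) := by
    refine D.basis.ext fun k => ?_
    rcases k with c | i
    · have h1 : ⁅D.t w, D.basis (Sum.inl c)⁆ = wt c.1 w • D.basis (Sum.inl c) := by
        rw [basis_inl, D.t_b w c.2]
      simp only [LinearMap.comp_apply, ad_apply, LinearMap.smul_apply,
        Module.Basis.coord_apply]
      rw [h1, map_smul, Module.Basis.repr_self, Finsupp.smul_apply]
      by_cases h2 : c = a
      · rw [h2]
      · rw [Finsupp.single_eq_of_ne (by simpa [eq_comm] using h2)]
        simp
    · have h1 : ⁅D.t w, D.basis (Sum.inr i)⁆ = 0 := by rw [basis_inr, D.t_H]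
      simp [h1]
  exact LinearMap.congr_fun h x

lemma eq_t_of_repr {x : L} (h : ∀ a, D.basis.repr x (Sum.inl a) = 0) : ∃ v, x = D.t v := by
  have h1 := D.basis.sum_repr x
  rw [Fintype.sum_sum_type] at h1
  simp only [h, zero_smul, Finset.sum_const_zero, zero_add, basis_inr] at h1
  rw [sum_H_eq_t] at h1
  exact ⟨_, h1.symm⟩

lemma mem_engel_wreg {x : L} (h : x ∈ engel ℂ (D.t wreg)) : ∃ v, x = D.t v := by
  rw [mem_engel_iff] at h
  obtain ⟨n, hn⟩ := h
  refine D.eq_t_of_repr fun a => ?_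
  have h1 : ∀ n : ℕ, D.basis.repr (((ad ℂ L (D.t wreg)) ^ n) x) (Sum.inl a) =
      wt a.1 wreg ^ n * D.basis.repr x (Sum.inl a) := by
    intro n
    induction n with
    | zero => simp
    | succ n ih =>
      rw [pow_succ', Module.End.mul_apply, ad_apply, repr_t_lie, ih, pow_succ']
      ring
  have h2 := h1 n
  rw [hn] at h2
  simpa [wt_wreg_ne_zero a.2] using h2.symm

lemma exists_equiv_t {s : L} (hs : ⨆ μ, (ad ℂ L s).eigenspace μ = ⊤) :
    ∃ (φ : L ≃ₗ⁅ℂ⁆ L) (w : Fin 7 → ℂ), φ s = D.t w := by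
  have := D.finiteDimensional
  let f : L ≃ₗ[ℂ] (Fin (Module.finrank ℂ L) → ℂ) := LinearEquiv.ofFinrankEq _ _ (by simp)
  let : TopologicalSpace L := TopologicalSpace.induced f inferInstance
  have hc : Continuous f := continuous_induced_dom
  have : IsTopologicalAddGroup L := topologicalAddGroup_induced f
  have : ContinuousSMul ℂ L := continuousSMul_induced f
  have : T2Space L := T2Space.of_injective_continuous f.injective hc
  have hr : IsRegular ℂ (D.t wreg) := by
    refine isRegular_of_engel fun a ha b hb => ?_
    obtain ⟨v, rfl⟩ := D.mem_engel_wreg ha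
    obtain ⟨u, rfl⟩ := D.mem_engel_wreg hb
    rw [mem_engel_iff]
    exact ⟨1, by rw [pow_one, ad_apply, add_lie, t_t, t_t, add_zero]⟩
  obtain ⟨φ, hφ⟩ := exists_equiv_mem_engel hs hr
  obtain ⟨v, hv⟩ := D.mem_engel_wreg hφ
  exact ⟨φ, v, hv⟩

end

lemma exists_reflection [FiniteDimensional ℂ L] (i : Fin 7) (w : Fin 7 → ℂ) :
    ∃ φ : L ≃ₗ⁅ℂ⁆ L, φ (D.t w) = D.t (fun j => w j - w i * (CartanMatrix.E₇ i j : ℂ)) := by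
  set c : ℂ := Real.pi / 2 with hc
  obtain ⟨φ, hφ⟩ := exists_equiv_eigen (c • (D.E i + D.G i))
  have hs := ip_s_self i
  have h1 : ⁅D.E i, D.G i⁆ = - D.H i := by
    rw [← b_s, ← b_neg_s, D.b_neg hs, h_s]
  have h2 : ∀ v, ⁅D.t v, D.E i⁆ = v i • D.E i := fun v => by rw [← b_s, D.t_b v hs, wt_s]
  have h3 : ∀ v, ⁅D.t v, D.G i⁆ = -(v i • D.G i) := fun v => by
    rw [← b_neg_s, D.t_b v (root_neg hs), wt_neg, wt_s, neg_smul]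
  have h4 : ∀ v, ⁅D.E i + D.G i, D.t v⁆ = v i • (D.G i - D.E i) := fun v => by
    rw [← lie_skew, lie_add, h2, h3, smul_sub]; abel
  have h5 : ⁅D.E i + D.G i, D.G i - D.E i⁆ = -((2 : ℂ) • D.H i) := by
    rw [add_lie, lie_sub, lie_sub, lie_self, lie_self, ← lie_skew (D.G i), h1, two_smul]; abel
  have h6 : ⁅D.E i + D.G i, D.H i⁆ = (2 : ℂ) • (D.G i - D.E i) := by
    rw [H_eq_t, h4, ← ip_s_s, hs]; norm_num
  have h7 : ∀ α : ℂ, α * α = -1 → φ (D.H i + α • (D.G i - D.E i)) =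
      Complex.exp (-(Real.pi * α)) • (D.H i + α • (D.G i - D.E i)) := by
    intro α hα
    refine hφ _ _ ?_
    rw [smul_lie, lie_add, lie_smul, h5, h6, smul_add, smul_add, smul_smul, smul_neg, smul_smul,
      smul_neg, smul_smul, hc]
    rw [smul_smul (-(Real.pi * α)) α,
      show -(Real.pi * α) * α = (Real.pi : ℂ) by linear_combination -(Real.pi : ℂ) * hα]
    module
  have h8 := h7 Complex.I Complex.I_mul_I
  have h9 := h7 (-Complex.I) (by rw [neg_mul_neg, Complex.I_mul_I])
  rw [mul_neg, neg_neg, Complex.exp_pi_mul_I] at h9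
  rw [Complex.exp_neg, Complex.exp_pi_mul_I] at h8
  have h10 : φ (D.H i) = - D.H i := by
    have h11 := congrArg₂ (· + ·) h8 h9
    simp only [← map_add] at h11
    have h12 : D.H i + Complex.I • (D.G i - D.E i) + (D.H i + -Complex.I • (D.G i - D.E i)) =
      (2 : ℂ) • D.H i := by module
    rw [h12, map_smul] at h11
    have h13 := congrArg (fun z => (1 / 2 : ℂ) • z) h11
    simp only [smul_smul] at h13
    norm_num at h13
    rw [h13]
    module
  have h11 : D.t w = D.t (fun j => w j - w i / 2 * (CartanMatrix.E₇ i j : ℂ)) +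
      (w i / 2) • D.H i := by
    rw [H_eq_t, ← t_smul, ← t_add]
    congr 1
    ext j
    simp
  have h12 : φ (D.t (fun j => w j - w i / 2 * (CartanMatrix.E₇ i j : ℂ))) =
      D.t (fun j => w j - w i / 2 * (CartanMatrix.E₇ i j : ℂ)) := by
    rw [hφ _ 0, Complex.exp_zero, one_smul]
    rw [smul_lie, h4, ← ip_s_s, hs]
    norm_num
  refine ⟨φ, ?_⟩
  rw [h11, map_add, map_smul, h12, h10, H_eq_t, ← neg_one_smul ℂ (D.t _), ← t_smul, ← t_smul,
    ← t_add]
  congr 1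
  ext j
  simp
  ring

end Data

end E7

namespace E7

open LieAlgebra LieSubalgebra

variable {L : Type*} [LieRing L] [LieAlgebra ℂ L]

/-- Twice the sum of the rows of the inverse Cartan matrix. -/
def rhoCoef : Fin 7 → ℕ := ![34, 49, 66, 96, 75, 52, 27]

lemma sum_rhoCoef (i : Fin 7) : ∑ j, rhoCoef j * CartanMatrix.E₇ i j = 2 := by
  revert i; decide +kernel

namespace Data

variable (D : Data L) [Nontrivial L]

lemma exists_dominant {e s : L} (h : IsChar e s) :
    ∃ (φ : L ≃ₗ⁅ℂ⁆ L) (n : Fin 7 → ℕ), φ s = D.t (fun j => (n j : ℂ)) := by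
  have := D.finiteDimensional
  set S : Set (Fin 7 → ℂ) := {w | ∃ φ : L ≃ₗ⁅ℂ⁆ L, φ s = D.t w} with hS
  have hE : ∀ w ∈ S, ∀ j, ∃ x : L, x ≠ 0 ∧ ⁅s, x⁆ = w j • x := by
    rintro w ⟨φ, hφ⟩ j
    refine ⟨φ.symm (D.E j),
      (LinearEquiv.map_ne_zero_iff φ.symm.toLinearEquiv).2 (D.E_ne_zero j), ?_⟩
    rw [← equiv_lie_eq_smul, hφ, ← b_s, D.t_b w (ip_s_self j), wt_s]
  have hfin : S.Finite := by
    have h1 : {μ : ℂ | (ad ℂ L s).HasEigenvalue μ}.Finite :=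
      Module.End.finite_hasEigenvalue _
    refine (Set.Finite.pi fun _ : Fin 7 => h1).subset fun w hw j _ => ?_
    obtain ⟨x, hx, hx'⟩ := hE w hw j
    exact Module.End.hasEigenvalue_of_hasEigenvector (x := x)
      ⟨Module.End.mem_eigenspace_iff.2 hx', hx⟩
  have hne : S.Nonempty := by
    obtain ⟨φ, w, hw⟩ := D.exists_equiv_t h.ss
    exact ⟨w, φ, hw⟩
  obtain ⟨w, hw, hmax⟩ := Set.exists_max_image S (fun w => ∑ j, (rhoCoef j : ℝ) * (w j).re) hfin hne
  obtain ⟨φ, hφ⟩ := id hw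
  have hpos : ∀ i, 0 ≤ (w i).re := by
    intro i
    obtain ⟨ψ, hψ⟩ := D.exists_reflection i w
    have h1 := hmax _ ⟨φ.trans ψ, by rw [LieEquiv.trans_apply, hφ, hψ]⟩
    have h2 : ∀ j, (w j - w i * (CartanMatrix.E₇ i j : ℂ)).re =
        (w j).re - (w i).re * (CartanMatrix.E₇ i j : ℝ) := by
      intro j
      rw [Complex.sub_re, ← Complex.ofReal_intCast, Complex.re_mul_ofReal]
    have h3 : ∑ j, (rhoCoef j : ℝ) * ((w j).re - (w i).re * (CartanMatrix.E₇ i j : ℝ)) =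
        ∑ j, (rhoCoef j : ℝ) * (w j).re - 2 * (w i).re := by
      have h4 : ((∑ j, rhoCoef j * CartanMatrix.E₇ i j : ℤ) : ℝ) = 2 := by
        rw [sum_rhoCoef]; norm_num
      push_cast at h4
      rw [← h4, Finset.sum_mul, ← Finset.sum_sub_distrib]
      exact Finset.sum_congr rfl fun j _ => by ring
    simp only [h2] at h1
    rw [h3] at h1
    linarith
  have hnat : ∀ j, ∃ n : ℕ, w j = n := by
    intro j
    obtain ⟨x, hx, hx'⟩ := hE w hw j
    obtain ⟨m, hm⟩ := h.int x _ hx' hx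
    have h1 := hpos j
    rw [hm, Complex.intCast_re] at h1
    obtain ⟨n, rfl⟩ := Int.eq_ofNat_of_zero_le (Int.cast_nonneg_iff.1 h1)
    exact ⟨n, by rw [hm]; simp⟩
  choose n hn using hnat
  exact ⟨φ, n, by rw [hφ, funext hn]⟩

end Data

end E7

namespace E7

open LieAlgebra LieSubalgebra

/-- The degree of a root for the grading with labels `n`. -/
def iw (n : Fin 7 → ℕ) (a : V) : ℤ := ∑ j, a j * n j

lemma wt_nat (n : Fin 7 → ℕ) (a : V) : wt a (fun j => (n j : ℂ)) = (iw n a : ℂ) := by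
  simp [wt, iw]

lemma iw_neg (n : Fin 7 → ℕ) (a : V) : iw n (-a) = - iw n a := by simp [iw]

lemma iw_s (n : Fin 7 → ℕ) (i : Fin 7) : iw n (s i) = n i := by
  simp [iw, s, Pi.single_apply]

lemma IsPos.iw_nonneg {a : V} (ha : IsPos a) (n : Fin 7 → ℕ) : 0 ≤ iw n a :=
  Finset.sum_nonneg fun j _ => mul_nonneg (ha.2 j) (Int.natCast_nonneg _)

/-- The degrees of the basis vectors. -/
def deg (n : Fin 7 → ℕ) : Rt ⊕ Fin 7 → ℤ := Sum.elim (fun a => iw n a.1) (fun _ => 0)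

variable {L : Type*} [LieRing L] [LieAlgebra ℂ L]

namespace Data

variable (D : Data L) [Nontrivial L]

/-- The grading element. -/
noncomputable def tn (n : Fin 7 → ℕ) : L := D.t (fun j => (n j : ℂ))

variable {n : Fin 7 → ℕ}

lemma tn_basis (k : Rt ⊕ Fin 7) : ⁅D.tn n, D.basis k⁆ = (deg n k : ℂ) • D.basis k := by
  rcases k with a | i
  · rw [basis_inl, tn, D.t_b _ a.2, wt_nat]; rfl
  · rw [basis_inr, tn, D.t_H]; simp [deg]

lemma repr_tn_lie (x : L) (k : Rt ⊕ Fin 7) :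
    D.basis.repr ⁅D.tn n, x⁆ k = (deg n k : ℂ) * D.basis.repr x k := by
  have h : D.basis.coord k ∘ₗ (ad ℂ L (D.tn n) : L →ₗ[ℂ] L) =
      (deg n k : ℂ) • D.basis.coord k := by
    refine D.basis.ext fun l => ?_
    simp only [LinearMap.comp_apply, ad_apply, LinearMap.smul_apply,
      Module.Basis.coord_apply]
    rw [tn_basis, map_smul, Module.Basis.repr_self, Finsupp.smul_apply]
    by_cases h2 : l = k
    · rw [h2]
    · rw [Finsupp.single_eq_of_ne (Ne.symm h2), smul_zero, smul_zero]
  exact LinearMap.congr_fun h x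

/-- The span of the basis vectors whose degrees lie in `S`. -/
noncomputable def gr (n : Fin 7 → ℕ) (S : Set ℤ) : Submodule ℂ L :=
  Submodule.span ℂ (D.basis '' {k | deg n k ∈ S})

lemma mem_gr {S : Set ℤ} {x : L} :
    x ∈ D.gr n S ↔ ∀ k, D.basis.repr x k ≠ 0 → deg n k ∈ S := by
  rw [gr, Module.Basis.mem_span_image]
  simp [Set.subset_def]

lemma basis_mem_gr {S : Set ℤ} {k : Rt ⊕ Fin 7} (hk : deg n k ∈ S) : D.basis k ∈ D.gr n S :=
  Submodule.subset_span ⟨k, hk, rfl⟩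

lemma mem_gr_singleton {m : ℤ} {x : L} : x ∈ D.gr n {m} ↔ ⁅D.tn n, x⁆ = (m : ℂ) • x := by
  rw [mem_gr]
  constructor
  · intro h
    refine D.basis.ext_elem fun k => ?_
    rw [repr_tn_lie, map_smul, Finsupp.smul_apply, smul_eq_mul]
    by_cases hk : D.basis.repr x k = 0
    · rw [hk, mul_zero, mul_zero]
    · rw [show deg n k = m from h k hk]
  · intro h k hk
    have h1 := D.repr_tn_lie (n := n) x k
    rw [h, map_smul, Finsupp.smul_apply, smul_eq_mul] at h1
    have h2 := mul_right_cancel₀ hk h1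
    exact (Int.cast_injective h2).symm

lemma gr_mono {S T : Set ℤ} (h : S ⊆ T) : D.gr n S ≤ D.gr n T :=
  Submodule.span_mono (Set.image_mono fun _ hk => h hk)

lemma finrank_gr (n : Fin 7 → ℕ) (S : Set ℤ) :
    Module.finrank ℂ (D.gr n S) = {k | deg n k ∈ S}.ncard := by
  classical
  rw [← Set.ncard_image_of_injective _ D.basis.injective, gr,
    finrank_span_set_eq_card (LinearIndepOn.mono D.basis.linearIndependent.linearIndepOn_id
      (Set.image_subset_range _ _)), Set.ncard_eq_toFinset_card']

variable {e : L}

lemma lie_mem_gr (h : IsChar e (D.tn n)) {m : ℤ} {x : L} (hx : x ∈ D.gr n {m}) :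
    ⁅e, x⁆ ∈ D.gr n {m + 2} := by
  rw [mem_gr_singleton] at hx ⊢
  rw [eigen_lie h.lie_e hx]
  push_cast
  rw [add_comm]

lemma exists_lie_eq (h : IsChar e (D.tn n)) {m : ℤ} (hm : 0 ≤ m) {z : L}
    (hz : z ∈ D.gr n {m + 2}) : ∃ x ∈ D.gr n {m}, ⁅e, x⁆ = z := by
  obtain ⟨x, hx, hx'⟩ := h.surj z (m + 2) (by omega) (D.mem_gr_singleton.1 hz)
  refine ⟨x, D.mem_gr_singleton.2 ?_, hx'⟩
  rw [hx]
  congr 2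
  omega

lemma ncard_deg_le (h : IsChar e (D.tn n)) {m : ℤ} (hm : 0 ≤ m) :
    {k | deg n k = m + 2}.ncard ≤ {k | deg n k = m}.ncard := by
  have := D.finiteDimensional
  have h1 := D.finrank_gr n {m}
  have h2 := D.finrank_gr n {m + 2}
  simp only [Set.mem_singleton_iff] at h1 h2
  rw [← h1, ← h2]
  refine le_trans (Submodule.finrank_mono (t := (D.gr n {m}).map (ad ℂ L e : L →ₗ[ℂ] L)) ?_)
    (Submodule.finrank_map_le _ _)
  intro z hz
  obtain ⟨x, hx, hx'⟩ := D.exists_lie_eq h hm hz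
  exact ⟨x, hx, hx'⟩

lemma ker_le_gr (h : IsChar e (D.tn n)) :
    LinearMap.ker (ad ℂ L e) ≤ D.gr n (Set.Ici 0) := by
  classical
  intro x hx
  have hx : ⁅e, x⁆ = 0 := hx
  rw [mem_gr]
  intro k hk
  let c : ℤ → L := fun m => ∑ k with deg n k = m, D.basis.repr x k • D.basis k
  have hc : ∀ m, ⁅D.tn n, c m⁆ = (m : ℂ) • c m := by
    intro m
    rw [← mem_gr_singleton]
    exact Submodule.sum_mem _ fun k hk => Submodule.smul_mem _ _
      (D.basis_mem_gr (Finset.mem_filter.1 hk).2)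
  have hsum : ∑ m ∈ Finset.univ.image (deg n), c m = x := by
    conv_rhs => rw [← D.basis.sum_repr x]
    exact Finset.sum_fiberwise_of_maps_to (fun k hk => Finset.mem_image_of_mem _ hk) _
  have h1 := mem_of_sum_mem (ad ℂ L (D.tn n) : L →ₗ[ℂ] L) (LinearMap.ker (ad ℂ L e : L →ₗ[ℂ] L))
    (fun y hy => by
      have hy : ⁅e, y⁆ = 0 := hy
      change ⁅e, ⁅D.tn n, y⁆⁆ = 0
      rw [leibniz_lie, hy, lie_zero, add_zero, ← lie_skew e, h.lie_e, neg_lie, smul_lie, hy,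
        smul_zero, neg_zero])
    (fun m : ℤ => (m : ℂ)) Int.cast_injective (Finset.univ.image (deg n)) c (fun m _ => hc m)
    (by rw [hsum]; exact hx) (deg n k) (Finset.mem_image_of_mem _ (Finset.mem_univ k))
  obtain ⟨m, hm⟩ := h.ker_nat (c (deg n k)) (deg n k) h1 (hc _) (by
    intro h0
    have h2 : D.basis.repr (c (deg n k)) k = D.basis.repr x k := by
      simp only [c, map_sum, map_smul, Module.Basis.repr_self, Finsupp.coe_finsetSum,
        Finset.sum_apply, Finsupp.smul_apply, smul_eq_mul]
      rw [Finset.sum_eq_single k]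
      · simp
      · intro l _ hl
        rw [Finsupp.single_eq_of_ne (Ne.symm hl), mul_zero]
      · simp
    rw [h0, map_zero] at h2
    exact hk h2.symm)
  have h3 : deg n k = m := by exact_mod_cast hm
  rw [h3]
  exact Int.natCast_nonneg m

lemma finrank_ker (h : IsChar e (D.tn n)) :
    Module.finrank ℂ (LinearMap.ker (ad ℂ L e)) + {k | 2 ≤ deg n k}.ncard =
      {k | 0 ≤ deg n k}.ncard := by
  have := D.finiteDimensional
  have h1 := D.finrank_gr n (Set.Ici 0)
  have h2 := D.finrank_gr n (Set.Ici 2)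
  simp only [Set.mem_Ici] at h1 h2
  rw [← h1, ← h2]
  have h3 : D.gr n (Set.Ici 2) = (D.gr n (Set.Ici 0)).map (ad ℂ L e : L →ₗ[ℂ] L) := by
    refine le_antisymm ?_ ?_
    · refine Submodule.span_le.2 ?_
      rintro _ ⟨k, hk, rfl⟩
      have hk : 2 ≤ deg n k := hk
      obtain ⟨x, hx, hx'⟩ := D.exists_lie_eq h (m := deg n k - 2) (by omega) (z := D.basis k)
        (D.basis_mem_gr (by simp))
      exact ⟨x, D.gr_mono (by simpa using hk) hx, hx'⟩
    · rw [gr, Submodule.map_span, Submodule.span_le]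
      rintro _ ⟨_, ⟨k, hk, rfl⟩, rfl⟩
      have hk : 0 ≤ deg n k := hk
      refine D.gr_mono (S := {deg n k + 2}) (by simpa using hk) ?_
      exact D.lie_mem_gr h (D.basis_mem_gr (by simp))
  have h4 :=
    ((ad ℂ L e : L →ₗ[ℂ] L).domRestrict (D.gr n (Set.Ici 0))).finrank_range_add_finrank_ker
  rw [LinearMap.range_domRestrict, LinearMap.ker_domRestrict,
    (Submodule.comapSubtypeEquivOfLe (D.ker_le_gr h)).finrank_eq] at h4
  rw [h3, add_comm]
  exact h4

end Data

end E7

namespace E7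

open LieAlgebra LieSubalgebra

lemma dec_nodup : (posCodes.map dec).Nodup := by decide +kernel

lemma sum_roots (f : V → ℕ) :
    ∑ a : Rt, f a.1 = (posCodes.map fun c => f (dec c) + f (-dec c)).sum := by
  classical
  set T : Finset V := (posCodes.map dec).toFinset with hT
  have hTm : ∀ a, a ∈ T ↔ IsPos a := by
    intro a
    rw [hT, List.mem_toFinset, List.mem_map]
    constructor
    · rintro ⟨c, hc, rfl⟩
      exact dec_isPos hc
    · exact fun h => h.exists_dec
  have hd : Disjoint T (T.image fun a => -a) := by
    rw [Finset.disjoint_left]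
    intro a ha h
    obtain ⟨c, hc, rfl⟩ := Finset.mem_image.1 h
    exact ((hTm c).1 hc).not_neg ((hTm _).1 ha)
  have hm : ∀ a, a ∈ T ∪ T.image (fun a => -a) ↔ ip a a = 2 := by
    intro a
    rw [Finset.mem_union, Finset.mem_image]
    constructor
    · rintro (h | ⟨c, hc, rfl⟩)
      · exact ((hTm a).1 h).1
      · exact root_neg ((hTm c).1 hc).1
    · intro h
      rcases pos_or_neg h with h | h
      · exact Or.inl ((hTm a).2 h)
      · exact Or.inr ⟨-a, (hTm _).2 h, neg_neg a⟩
  rw [← Finset.sum_subtype _ hm, Finset.sum_union hd,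
    Finset.sum_image (fun a _ b _ h => neg_injective h), ← Finset.sum_add_distrib, hT,
    List.sum_toFinset _ dec_nodup, List.map_map]
  rfl

/-- The degree of the root with encoding `c`. -/
def wn (n : Fin 7 → ℕ) (c : ℕ) : ℕ := c % 8 * n 0 + c / 8 % 8 * n 1 + c / 64 % 8 * n 2 +
  c / 512 % 8 * n 3 + c / 4096 % 8 * n 4 + c / 32768 % 8 * n 5 + c / 262144 % 8 * n 6

lemma iw_dec (n : Fin 7 → ℕ) (c : ℕ) : iw n (dec c) = wn n c := by
  simp only [iw, Fin.sum_univ_succ, dec, wn]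
  simp
  ring

lemma ncard_deg (n : Fin 7 → ℕ) (p : ℤ → Prop) [DecidablePred p] :
    {k | p (deg n k)}.ncard = (if p 0 then 7 else 0) + (posCodes.countP fun c => p (wn n c)) +
      posCodes.countP fun c => p (-wn n c) := by
  classical
  rw [Set.ncard_eq_toFinset_card', Set.toFinset_ofPred, Finset.card_filter]
  have h0 : (∑ k, if p (deg n k) then 1 else 0) =
      (∑ a : Rt, (fun a => if p (iw n a) then 1 else 0) a.1) + ∑ _i : Fin 7, if p 0 then 1 else 0 :=
    Fintype.sum_sum_type _
  have h1 : (∑ _i : Fin 7, if p 0 then 1 else 0) = if p 0 then 7 else 0 := by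
    split_ifs <;> simp
  have h2 : ∀ l : List ℕ, (l.map fun c => (if p (iw n (dec c)) then 1 else 0) +
      if p (iw n (-dec c)) then 1 else 0).sum =
      (l.countP fun c => p (wn n c)) + l.countP fun c => p (-wn n c) := by
    intro l
    simp only [iw_neg, iw_dec]
    induction l with
    | nil => simp
    | cons c l ih =>
      rw [List.map_cons, List.sum_cons, ih, List.countP_cons, List.countP_cons]
      simp only [decide_eq_true_eq]
      omega
  rw [h0, sum_roots fun a => if p (iw n a) then 1 else 0, h1, h2, add_comm, ← add_assoc]

variable {L : Type*} [LieRing L] [LieAlgebra ℂ L]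

namespace Data

variable (D : Data L) [Nontrivial L] {n : Fin 7 → ℕ}

lemma repr_lie_s {k l : Rt ⊕ Fin 7} (hk : 1 ≤ deg n k) (hl : 1 ≤ deg n l) (i : Fin 7) :
    D.basis.repr ⁅D.basis k, D.basis l⁆ (Sum.inl ⟨s i, ip_s_self i⟩) = 0 := by
  have hp : ∀ {a : Rt}, 1 ≤ iw n a.1 → IsPos a.1 := by
    intro a h
    rcases pos_or_neg a.2 with h1 | h1
    · exact h1
    · have := h1.iw_nonneg n
      rw [iw_neg] at this
      omega
  rcases k with a | j
  · rcases l with c | j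
    · have ha : IsPos a.1 := hp hk
      have hc : IsPos c.1 := hp hl
      rw [basis_inl, basis_inl]
      have h1 := le_ip a.2 c.2
      by_cases h2 : 0 ≤ ip a.1 c.1
      · rw [D.b_b_zero a.2 c.2 h2, map_zero, Finsupp.zero_apply]
      · by_cases h3 : ip a.1 c.1 = -1
        · have h4 := root_add a.2 c.2 h3
          have h5 : D.b (a.1 + c.1) = D.basis (Sum.inl ⟨_, h4⟩) := by rw [basis_inl]
          rw [D.b_b a.2 c.2 h3, h5, map_zsmul, Module.Basis.repr_self, Finsupp.smul_apply,
            Finsupp.single_eq_of_ne, smul_zero]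
          intro h6
          have h7 := congrArg ht (Subtype.ext_iff.1 (Sum.inl_injective h6))
          have h8 := ha.ht_pos
          have h9 := hc.ht_pos
          simp only [ht_add, ht_s] at h7
          omega
        · have h4 := eq_neg_of_ip a.2 c.2 (by omega)
          rw [h4] at ha
          exact absurd ha hc.not_neg
    · simp [deg] at hl
  · simp [deg] at hk

lemma repr_lie_s' {x y : L} (hx : x ∈ D.gr n (Set.Ici 1)) (hy : y ∈ D.gr n (Set.Ici 1))
    (i : Fin 7) : D.basis.repr ⁅x, y⁆ (Sum.inl ⟨s i, ip_s_self i⟩) = 0 := by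
  induction hx, hy using Submodule.span_induction₂ with
  | mem_mem x y hx hy =>
    obtain ⟨k, hk, rfl⟩ := hx
    obtain ⟨l, hl, rfl⟩ := hy
    exact D.repr_lie_s hk hl i
  | zero_left y hy => simp
  | zero_right x hx => simp
  | add_left x y z hx hy hz h1 h2 => rw [add_lie, map_add, Finsupp.add_apply, h1, h2, add_zero]
  | add_right x y z hx hy hz h1 h2 => rw [lie_add, map_add, Finsupp.add_apply, h1, h2, add_zero]
  | smul_left r x y hx hy h => rw [smul_lie, map_smul, Finsupp.smul_apply, h, smul_zero]
  | smul_right r x y hx hy h => rw [lie_smul, map_smul, Finsupp.smul_apply, h, smul_zero]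

lemma label_le_two {e : L} (h : IsChar e (D.tn n)) (i : Fin 7) : n i ≤ 2 := by
  by_contra! hn
  have h1 : deg n (Sum.inl ⟨s i, ip_s_self i⟩) = n i := iw_s n i
  obtain ⟨x, hx, hx'⟩ := D.exists_lie_eq h (m := n i - 2) (by omega)
    (z := D.basis (Sum.inl ⟨s i, ip_s_self i⟩)) (D.basis_mem_gr (by simp [h1]))
  have he : e ∈ D.gr n {2} := D.mem_gr_singleton.2 (by simpa using h.lie_e)
  have h2 := D.repr_lie_s' (D.gr_mono (T := Set.Ici 1) (by simp) he)
    (D.gr_mono (T := Set.Ici 1) (by simp; omega) hx) i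
  rw [hx', Module.Basis.repr_self, Finsupp.single_eq_same] at h2
  exact one_ne_zero h2

lemma finrank_ker_eq {e : L} (h : IsChar e (D.tn n)) :
    Module.finrank ℂ (LinearMap.ker (ad ℂ L e)) + posCodes.countP (fun c => 2 ≤ wn n c) =
      70 + posCodes.countP (fun c => wn n c = 0) := by
  have h1 := D.finrank_ker h
  rw [ncard_deg n (fun m => 2 ≤ m), ncard_deg n (fun m => 0 ≤ m)] at h1
  have h2 : posCodes.countP (fun c => (2 : ℤ) ≤ -wn n c) = 0 := by
    rw [List.countP_eq_zero]
    intro c _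
    rw [decide_eq_true_eq]
    omega
  have h3 : posCodes.countP (fun c => (0 : ℤ) ≤ wn n c) = 63 := by
    rw [List.countP_eq_length.2]
    · rfl
    · simp
  have h4 : posCodes.countP (fun c => (0 : ℤ) ≤ -wn n c) =
      posCodes.countP (fun c => wn n c = 0) := by
    refine List.countP_congr fun c _ => ?_
    simp
  have h5 : posCodes.countP (fun c => (2 : ℤ) ≤ wn n c) =
      posCodes.countP (fun c => 2 ≤ wn n c) := by
    refine List.countP_congr fun c _ => ?_
    simp
  rw [h2, h3, h4, h5] at h1
  norm_num at h1
  omega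

lemma countP_eq {m : ℕ} (hm : 0 < m) : {k | deg n k = m}.ncard =
    posCodes.countP (fun c => wn n c = m) := by
  rw [ncard_deg n (fun k => k = m)]
  have h2 : posCodes.countP (fun c => (-wn n c : ℤ) = m) = 0 := by
    rw [List.countP_eq_zero]
    intro c _
    simp
    omega
  have h5 : posCodes.countP (fun c => (wn n c : ℤ) = m) =
      posCodes.countP (fun c => wn n c = m) := by
    refine List.countP_congr fun c _ => ?_
    simp
  rw [h2, h5, if_neg (by omega)]
  simp

lemma countP_le {e : L} (h : IsChar e (D.tn n)) {m : ℕ} (hm : 0 < m) :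
    posCodes.countP (fun c => wn n c = m + 2) ≤ posCodes.countP (fun c => wn n c = m) := by
  rw [← countP_eq hm, ← countP_eq (by omega)]
  exact_mod_cast D.ncard_deg_le h (m := m) (by omega)

end Data

end E7

namespace E7

open LieAlgebra

/-- The number of positive roots whose degree satisfies `p`. -/
def cnt (n₀ n₁ n₂ n₃ n₄ n₅ n₆ : ℕ) (p : ℕ → Bool) : ℕ :=
  posCodes.countP fun c => p (c % 8 * n₀ + c / 8 % 8 * n₁ + c / 64 % 8 * n₂ + c / 512 % 8 * n₃ +
    c / 4096 % 8 * n₄ + c / 32768 % 8 * n₅ + c / 262144 % 8 * n₆)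

/-- The labels which are not excluded by dimension counts, with the dimension of the centralizer. -/
def labels : List (ℕ × List ℕ) := [(99, [1, 0, 0, 0, 0, 0, 0]), (81, [0, 0, 0, 0, 0, 1, 0]),
  (69, [0, 0, 1, 0, 0, 0, 0]), (63, [0, 1, 0, 0, 0, 0, 1]), (51, [0, 0, 0, 1, 0, 0, 0]),
  (43, [0, 0, 1, 0, 0, 1, 0]), (63, [0, 0, 0, 0, 1, 0, 0]), (51, [0, 0, 0, 0, 1, 0, 1]),
  (43, [0, 1, 0, 0, 0, 1, 1]), (63, [1, 0, 0, 0, 0, 0, 2]), (43, [1, 0, 1, 0, 0, 0, 1])]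

/-- The dimension counts. -/
def labelTest (n₀ n₁ n₂ n₃ n₄ n₅ n₆ : ℕ) : Bool :=
  [99, 81, 69, 63, 51, 43].all fun d =>
    !(Nat.beq (d + cnt n₀ n₁ n₂ n₃ n₄ n₅ n₆ (Nat.ble 2))
      (70 + cnt n₀ n₁ n₂ n₃ n₄ n₅ n₆ (Nat.beq 0))) ||
    !(Nat.ble (cnt n₀ n₁ n₂ n₃ n₄ n₅ n₆ (Nat.beq 3)) (cnt n₀ n₁ n₂ n₃ n₄ n₅ n₆ (Nat.beq 1))) ||
    !(Nat.ble (cnt n₀ n₁ n₂ n₃ n₄ n₅ n₆ (Nat.beq 4)) (cnt n₀ n₁ n₂ n₃ n₄ n₅ n₆ (Nat.beq 2))) ||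
    labels.contains (d, [n₀, n₁, n₂, n₃, n₄, n₅, n₆])

lemma labelTest_eq : ([0, 1, 2].all fun n₀ => [0, 1, 2].all fun n₁ => [0, 1, 2].all fun n₂ =>
    [0, 1, 2].all fun n₃ => [0, 1, 2].all fun n₄ => [0, 1, 2].all fun n₅ => [0, 1, 2].all fun n₆ =>
      labelTest n₀ n₁ n₂ n₃ n₄ n₅ n₆) = true := by
  decide +kernel

lemma cnt_eq (n : Fin 7 → ℕ) (p : ℕ → Bool) :
    cnt (n 0) (n 1) (n 2) (n 3) (n 4) (n 5) (n 6) p = posCodes.countP fun c => p (wn n c) := rfl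

/-- The labels of the nilpotent elements with the given centralizer dimensions. -/
lemma Data.mem_labels {L : Type*} [LieRing L] [LieAlgebra ℂ L] (D : Data L) [Nontrivial L]
    {n : Fin 7 → ℕ} {e : L} (h : IsChar e (D.tn n))
    (hd : Module.finrank ℂ (LinearMap.ker (ad ℂ L e)) ∈ ({99, 81, 69, 63, 51, 43} : Set ℕ)) :
    (Module.finrank ℂ (LinearMap.ker (ad ℂ L e)), [n 0, n 1, n 2, n 3, n 4, n 5, n 6]) ∈
      labels := by
  have h1 := D.finrank_ker_eq h
  have h2 := D.countP_le h (m := 1) (by norm_num)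
  have h3 := D.countP_le h (m := 2) (by norm_num)
  have hn : ∀ i, n i ∈ [0, 1, 2] := by
    intro i
    have := D.label_le_two h i
    interval_cases n i <;> simp
  generalize Module.finrank ℂ (LinearMap.ker (ad ℂ L e)) = d at hd h1 ⊢
  have hd' : d ∈ [99, 81, 69, 63, 51, 43] := by simpa using hd
  have key := labelTest_eq
  have h4 : labelTest (n 0) (n 1) (n 2) (n 3) (n 4) (n 5) (n 6) = true :=
    List.all_eq_true.1 (List.all_eq_true.1 (List.all_eq_true.1 (List.all_eq_true.1
      (List.all_eq_true.1 (List.all_eq_true.1 (List.all_eq_true.1 key _ (hn 0)) _ (hn 1)) _ (hn 2))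
      _ (hn 3)) _ (hn 4)) _ (hn 5)) _ (hn 6)
  have h5 := List.all_eq_true.1 h4 d hd'
  rw [cnt_eq, cnt_eq, cnt_eq, cnt_eq, cnt_eq, cnt_eq] at h5
  have e1 : (posCodes.countP fun c => Nat.ble 2 (wn n c)) =
      posCodes.countP (fun c => 2 ≤ wn n c) :=
    List.countP_congr fun c _ => by rw [decide_eq_true_iff, Nat.ble_eq]
  have e2 : ∀ m : ℕ, (posCodes.countP fun c => Nat.beq m (wn n c)) =
      posCodes.countP (fun c => wn n c = m) := fun m =>
    List.countP_congr fun c _ => by rw [decide_eq_true_iff, Nat.beq_eq, eq_comm]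
  rw [e1, e2, e2, e2, e2, e2, h1] at h5
  have e3 : Nat.ble (posCodes.countP fun c => wn n c = 3) (posCodes.countP fun c => wn n c = 1) =
      true := by rwa [Nat.ble_eq]
  have e4 : Nat.ble (posCodes.countP fun c => wn n c = 4) (posCodes.countP fun c => wn n c = 2) =
      true := by rwa [Nat.ble_eq]
  rw [e3, e4] at h5
  simpa using h5

end E7

namespace E7

/-- The element of the root lattice with signed octal encoding `k`. -/
def decZ : ℤ → V
  | .ofNat n => dec n
  | .negSucc n => -dec (n + 1)

/-- The signed octal encoding. -/
def enc (a : V) : ℤ :=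
  a 0 + 8 * a 1 + 64 * a 2 + 512 * a 3 + 4096 * a 4 + 32768 * a 5 + 262144 * a 6

lemma enc_add (a b : V) : enc (a + b) = enc a + enc b := by
  simp only [enc, Pi.add_apply]; ring

lemma enc_neg (a : V) : enc (-a) = -enc a := by
  simp only [enc, Pi.neg_apply]; ring

lemma enc_dec : ∀ c ∈ posCodes, enc (dec c) = c := by decide +kernel

lemma zero_notMem_posCodes : 0 ∉ posCodes := by decide +kernel

/-- The signed code of a root. -/
def IsCode (k : ℤ) : Prop := k.natAbs ∈ posCodes

namespace IsCode

lemma root {k : ℤ} (hk : IsCode k) : ip (decZ k) (decZ k) = 2 := by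
  rcases k with n | n
  · exact (dec_isPos hk).1
  · exact root_neg (dec_isPos (n := n + 1) hk).1

lemma enc_decZ {k : ℤ} (hk : IsCode k) : enc (decZ k) = k := by
  rcases k with n | n
  · exact enc_dec n hk
  · exact (enc_neg _).trans (by rw [enc_dec (n + 1) hk]; rfl)

end IsCode

lemma exists_decZ {a : V} (ha : ip a a = 2) : ∃ k, IsCode k ∧ decZ k = a := by
  rcases pos_or_neg ha with h | h
  · obtain ⟨n, h1, h2⟩ := h.exists_dec
    exact ⟨Int.ofNat n, h1, h2⟩
  · obtain ⟨n, h1, h2⟩ := h.exists_dec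
    rcases n with - | n
    · exact absurd h1 zero_notMem_posCodes
    · refine ⟨Int.negSucc n, h1, ?_⟩
      change -dec (n + 1) = a
      rw [h2, neg_neg]

namespace IsCode

lemma eq_enc {k : ℤ} {a : V} (hk : IsCode k) (h : decZ k = a) : k = enc a := by
  rw [← h, hk.enc_decZ]

lemma add {k l : ℤ} (hk : IsCode k) (hl : IsCode l) (h : ip (decZ k) (decZ l) = -1) :
    IsCode (k + l) ∧ decZ (k + l) = decZ k + decZ l := by
  obtain ⟨m, hm, h1⟩ := exists_decZ (root_add hk.root hl.root h)
  have := hm.eq_enc h1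
  rw [enc_add, hk.enc_decZ, hl.enc_decZ] at this
  rw [← this]
  exact ⟨hm, h1⟩

end IsCode

/-- Codes for root vectors (on the left) and coroots (on the right). -/
abbrev Key := ℤ ⊕ ℤ

/-- Formal combinations of root vectors and coroots. -/
abbrev Vec := List (Key × ℤ)

/-- A multiple of a root vector. -/
abbrev r (k c : ℤ) : Key × ℤ := (Sum.inl k, c)

/-- A multiple of a coroot. -/
abbrev t (k c : ℤ) : Key × ℤ := (Sum.inr k, c)

/-- The code under a key. -/
def Key.val : Key → ℤ := Sum.elim id id

/-- The structure constants. -/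
def Key.br : Key → Key → Key × ℤ
  | .inl k, .inl l => bif ip (decZ k) (decZ l) == -1 then r (k + l) (eps (decZ k) (decZ l)) else
      bif ip (decZ k) (decZ l) == -2 then t k (-1) else r k 0
  | .inl k, .inr l => r k (-ip (decZ l) (decZ k))
  | .inr k, .inl l => r l (ip (decZ k) (decZ l))
  | .inr k, .inr _ => t k 0

lemma Key.br_cases (k l : ℤ) :
    ip (decZ k) (decZ l) = -1 ∧ Key.br (.inl k) (.inl l) = r (k + l) (eps (decZ k) (decZ l)) ∨
    ip (decZ k) (decZ l) = -2 ∧ Key.br (.inl k) (.inl l) = t k (-1) ∨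
    (ip (decZ k) (decZ l) ≠ -1 ∧ ip (decZ k) (decZ l) ≠ -2) ∧
      Key.br (.inl k) (.inl l) = r k 0 := by
  have h0 : Key.br (.inl k) (.inl l) = bif ip (decZ k) (decZ l) == -1 then
      r (k + l) (eps (decZ k) (decZ l)) else
      bif ip (decZ k) (decZ l) == -2 then t k (-1) else r k 0 := rfl
  rw [h0]
  by_cases h1 : ip (decZ k) (decZ l) = -1
  · exact Or.inl ⟨h1, by rw [beq_iff_eq.2 h1, cond_true]⟩
  rw [beq_eq_false_iff_ne.2 h1, cond_false]
  by_cases h2 : ip (decZ k) (decZ l) = -2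
  · exact Or.inr (Or.inl ⟨h2, by rw [beq_iff_eq.2 h2, cond_true]⟩)
  · exact Or.inr (Or.inr ⟨⟨h1, h2⟩, by rw [beq_eq_false_iff_ne.2 h2, cond_false]⟩)

lemma isCode_br {k l : Key} (hk : IsCode k.val) (hl : IsCode l.val) :
    IsCode (Key.br k l).1.val := by
  rcases k with k | k <;> rcases l with l | l
  · rcases Key.br_cases k l with ⟨h1, h⟩ | ⟨h1, h⟩ | ⟨h1, h⟩ <;> rw [h]
    · exact (IsCode.add hk hl h1).1
    · exact hk
    · exact hk
  · exact hk
  · exact hl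
  · exact hk

/-- The bracket of formal combinations. -/
def Vec.br (u v : Vec) : Vec :=
  u.flatMap fun p => v.map fun q => ((Key.br p.1 q.1).1, p.2 * q.2 * (Key.br p.1 q.1).2)

/-- All codes which occur are codes of roots. -/
def Vec.IsValid (u : Vec) : Prop := ∀ p ∈ u, IsCode p.1.val

/-- The coefficients of root vectors and coroots with respect to the Chevalley basis. -/
def Key.coef : Key → ℤ ⊕ Fin 7 → ℤ
  | .inl k, .inl l => bif k == l then 1 else 0
  | .inr k, .inr i => decZ k i
  | .inl _, .inr _ => 0
  | .inr _, .inl _ => 0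

/-- The coefficients of a formal combination. -/
def Vec.coef (j : ℤ ⊕ Fin 7) : Vec → ℤ
  | [] => 0
  | p :: u => p.2 * p.1.coef j + Vec.coef j u

/-- The formal combination represents zero. -/
def Vec.isZero (u : Vec) : Bool :=
  (u.all fun p => Sum.elim (fun k => u.coef (Sum.inl k) == 0) (fun _ => true) p.1) &&
    [0, 1, 2, 3, 4, 5, 6].all fun i => u.coef (Sum.inr i) == 0

variable {L : Type*} [LieRing L] [LieAlgebra ℂ L]

namespace Data

variable (D : Data L)

lemma h_h (a c : V) : ⁅D.h a, D.h c⁆ = 0 := by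
  rw [h, h, hv, hv]
  simp [sum_lie, lie_sum, D.H_H]

/-- The element with a given key. -/
noncomputable def key : Key → L
  | .inl k => D.b (decZ k)
  | .inr k => D.h (decZ k)

/-- The element represented by a formal combination. -/
noncomputable def eval (u : Vec) : L := (u.map fun p => p.2 • D.key p.1).sum

lemma lie_key {k l : Key} (hk : IsCode k.val) (hl : IsCode l.val) :
    ⁅D.key k, D.key l⁆ = (Key.br k l).2 • D.key (Key.br k l).1 := by
  rcases k with k | k <;> rcases l with l | l
  · replace hk : IsCode k := hk
    replace hl : IsCode l := hl
    change ⁅D.b (decZ k), D.b (decZ l)⁆ = _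
    rcases Key.br_cases k l with ⟨h1, h⟩ | ⟨h1, h⟩ | ⟨h1, h⟩ <;> rw [h]
    · rw [D.b_b hk.root hl.root h1, ← (hk.add hl h1).2]
      rfl
    · have h6 : decZ l = -decZ k := by rw [eq_neg_of_ip hk.root hl.root h1, neg_neg]
      rw [h6, D.b_neg hk.root, neg_one_smul]
      rfl
    · have h3 := le_ip hk.root hl.root
      rw [D.b_b_zero hk.root hl.root (by omega), zero_smul]
  · change ⁅D.b (decZ k), D.h (decZ l)⁆ = (-ip (decZ l) (decZ k)) • D.b (decZ k)
    rw [← lie_skew, D.h_b (IsCode.root (k := k) hk), neg_smul]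
  · exact D.h_b (IsCode.root (k := l) hl)
  · exact (D.h_h _ _).trans (zero_smul ℤ _).symm

lemma eval_cons (p : Key × ℤ) (u : Vec) : D.eval (p :: u) = p.2 • D.key p.1 + D.eval u := by
  simp [eval]

lemma eval_append (u v : Vec) : D.eval (u ++ v) = D.eval u + D.eval v := by
  simp [eval]

lemma eval_br {u v : Vec} (hu : u.IsValid) (hv : v.IsValid) :
    D.eval (u.br v) = ⁅D.eval u, D.eval v⁆ := by
  induction u with
  | nil => simp [Vec.br, eval]
  | cons p u ih =>
    have h1 : Vec.br (p :: u) v =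
      v.map (fun q => ((Key.br p.1 q.1).1, p.2 * q.2 * (Key.br p.1 q.1).2)) ++ Vec.br u v := rfl
    rw [h1, eval_append, ih fun q hq => hu q (List.mem_cons_of_mem _ hq), eval_cons, add_lie]
    congr 1
    clear h1 ih
    induction v with
    | nil => simp [eval]
    | cons q v ih =>
      rw [List.map_cons, eval_cons, eval_cons, lie_add,
        ih fun q hq => hv q (List.mem_cons_of_mem _ hq), smul_lie p.2 (D.key p.1) (q.2 • _),
        lie_smul q.2, D.lie_key (hu p List.mem_cons_self) (hv q List.mem_cons_self), smul_smul,
        smul_smul]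

end Data

lemma Vec.IsValid.br {u v : Vec} (hu : u.IsValid) (hv : v.IsValid) : (u.br v).IsValid := by
  intro p hp
  simp only [Vec.br, List.mem_flatMap, List.mem_map] at hp
  obtain ⟨a, ha, c, hc, rfl⟩ := hp
  exact isCode_br (hu a ha) (hv c hc)

lemma Vec.IsValid.append {u v : Vec} (hu : u.IsValid) (hv : v.IsValid) : (u ++ v).IsValid := by
  intro p hp
  rcases List.mem_append.1 hp with h | h
  · exact hu p h
  · exact hv p h

/-- The pivots which are indices of basis vectors. -/
def IsPivot : ℤ ⊕ Fin 7 → Prop := Sum.elim IsCode fun _ => True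

lemma exists_index {j : ℤ ⊕ Fin 7} (hj : IsPivot j) : ∃ i : Rt ⊕ Fin 7,
    Sum.map (fun a : Rt => enc a.1) id i = j := by
  rcases j with k | i
  · exact ⟨Sum.inl ⟨decZ k, IsCode.root hj⟩, congrArg Sum.inl (IsCode.enc_decZ hj)⟩
  · exact ⟨Sum.inr i, rfl⟩

namespace Data

variable (D : Data L) [Nontrivial L]

lemma repr_key {k : Key} (hk : IsCode k.val) (i : Rt ⊕ Fin 7) :
    D.basis.repr (D.key k) i = (k.coef (Sum.map (fun a : Rt => enc a.1) id i) : ℂ) := by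
  rcases k with k | k
  · have h1 : D.key (Sum.inl k) = D.basis (Sum.inl ⟨decZ k, IsCode.root hk⟩) := by
      rw [basis_inl]; rfl
    rw [h1, Module.Basis.repr_self]
    rcases i with a | i
    · change _ = ((bif k == enc a.1 then (1 : ℤ) else 0 : ℤ) : ℂ)
      by_cases h : decZ k = a.1
      · have h2 : (⟨decZ k, IsCode.root hk⟩ : Rt) = a := Subtype.ext h
        rw [h2, Finsupp.single_eq_same, beq_iff_eq.2 (IsCode.eq_enc (k := k) hk h)]
        simp
      · have h2 : k ≠ enc a.1 := by
          rintro rfl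
          obtain ⟨l, hl, h3⟩ := exists_decZ a.2
          exact h (by rw [hl.eq_enc h3] at h3; exact h3)
        rw [beq_eq_false_iff_ne.2 h2, Finsupp.single_eq_of_ne]
        · simp
        · intro h3
          exact h (congrArg Subtype.val (Sum.inl_injective h3)).symm
    · rw [Finsupp.single_eq_of_ne (by simp)]
      exact Int.cast_zero.symm
  · have h1 : D.key (Sum.inr k) = ∑ i, (decZ k i : ℂ) • D.basis (Sum.inr i) := by
      change ∑ i, decZ k i • D.H i = _
      refine Finset.sum_congr rfl fun i _ => ?_
      rw [basis_inr, Int.cast_smul_eq_zsmul]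
    rw [h1, map_sum, Finsupp.finsetSum_apply]
    simp only [map_smul, Module.Basis.repr_self, Finsupp.smul_apply, smul_eq_mul]
    rcases i with a | i
    · rw [Finset.sum_eq_zero fun i _ => ?_]
      · exact Int.cast_zero.symm
      · rw [Finsupp.single_eq_of_ne (by simp), mul_zero]
    · rw [Finset.sum_eq_single i]
      · rw [Finsupp.single_eq_same, mul_one]; rfl
      · intro l _ hl
        rw [Finsupp.single_eq_of_ne (by simpa using Ne.symm hl), mul_zero]
      · simp

lemma repr_eval {u : Vec} (hu : u.IsValid) (i : Rt ⊕ Fin 7) :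
    D.basis.repr (D.eval u) i = (u.coef (Sum.map (fun a : Rt => enc a.1) id i) : ℂ) := by
  induction u with
  | nil => simp [eval, Vec.coef]
  | cons p u ih =>
    rw [eval_cons, map_add, Finsupp.add_apply, ih fun q hq => hu q (List.mem_cons_of_mem _ hq),
      ← Int.cast_smul_eq_zsmul ℂ, map_smul, Finsupp.smul_apply,
      D.repr_key (hu p List.mem_cons_self), Vec.coef]
    push_cast
    rfl

lemma eval_eq_zero {u : Vec} (hu : u.IsValid) (h : u.isZero = true) : D.eval u = 0 := by
  rw [Vec.isZero, Bool.and_eq_true, List.all_eq_true, List.all_eq_true] at h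
  refine D.basis.ext_elem fun i => ?_
  rw [D.repr_eval hu, map_zero, Finsupp.zero_apply]
  have hc : u.coef (Sum.map (fun a : Rt => enc a.1) id i) = 0 := by
    rcases i with a | i
    · change u.coef (Sum.inl (enc a.1)) = 0
      by_cases hm : ∃ p ∈ u, p.1 = Sum.inl (enc a.1)
      · obtain ⟨p, hp, h2⟩ := hm
        have := h.1 p hp
        rw [h2] at this
        simpa using this
      · push Not at hm
        clear h hu
        induction u with
        | nil => rfl
        | cons p u ih =>
          rw [Vec.coef, ih fun q hq => hm q (List.mem_cons_of_mem _ hq)]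
          have h3 := hm p List.mem_cons_self
          rcases p with ⟨k | k, c⟩
          · have h4 : k ≠ enc a.1 := fun h5 => h3 (congrArg Sum.inl h5)
            have h5 : (k == enc a.1) = false := beq_eq_false_iff_ne.2 h4
            simp [Key.coef, h5]
          · simp [Key.coef]
    · have := h.2 i (by fin_cases i <;> simp)
      simpa using this
  rw [hc, Int.cast_zero]

end Data

end E7

namespace E7

open LieAlgebra

/-- The labels in a list. -/
def lab (l : List ℕ) : Fin 7 → ℕ := fun i => l.getD i 0

/-- The degree of the root with signed code `k`. -/
def degZ (n : Fin 7 → ℕ) : ℤ → ℤ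
  | .ofNat k => wn n k
  | .negSucc k => -wn n (k + 1)

lemma iw_decZ (n : Fin 7 → ℕ) (k : ℤ) : iw n (decZ k) = degZ n k := by
  rcases k with k | k
  · exact iw_dec n k
  · exact (iw_neg n _).trans (congrArg _ (iw_dec n (k + 1)))

/-- A test for validity. -/
def Vec.valid (u : Vec) : Bool := u.all fun p => posCodes.contains p.1.val.natAbs

lemma Vec.isValid {u : Vec} (h : u.valid = true) : u.IsValid := by
  intro p hp
  simpa [IsCode] using List.all_eq_true.1 h p hp

/-- A test for homogeneity. -/
def Vec.inDeg (n : Fin 7 → ℕ) (m : ℤ) (u : Vec) : Bool :=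
  u.all fun p => Sum.elim (fun k => degZ n k == m) (fun _ => m == 0) p.1

/-- A test for the surjectivity of `ad e` from degree zero to degree two. -/
def surjTest (n : Fin 7 → ℕ) (e : Vec) (us : List (ℕ × ℤ × Vec)) : Bool :=
  e.valid && e.inDeg n 2 && (us.all fun q => q.2.1 != 0 && q.2.2.valid && q.2.2.inDeg n 0 &&
    Vec.isZero (e.br q.2.2 ++ [r q.1 (-q.2.1)])) &&
    posCodes.all fun c => wn n c != 2 || us.any fun q => q.1 == c

/-- A test for linear independence with given pivots. -/
def triTest : List (Vec × (ℤ ⊕ Fin 7)) → Bool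
  | [] => true
  | q :: ws => q.1.coef q.2 != 0 && (ws.all fun p => p.1.coef q.2 == 0) && triTest ws

/-- A test for pivots. -/
def pivotTest : ℤ ⊕ Fin 7 → Bool := Sum.elim (fun k => posCodes.contains k.natAbs) fun _ => true

lemma isPivot {j : ℤ ⊕ Fin 7} (h : pivotTest j = true) : IsPivot j := by
  rcases j with k | i
  · exact List.contains_iff_mem.1 h
  · trivial

/-- The brackets of elements of a list. -/
def brackets (vs : List Vec) (ps : List (ℕ × ℕ × (ℤ ⊕ Fin 7))) : List (Vec × (ℤ ⊕ Fin 7)) :=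
  ps.map fun q => ((vs.getD q.1 []).br (vs.getD q.2.1 []), q.2.2)

/-- A test for the existence of sufficiently many brackets in the centralizer of `e`. -/
def derivedTest (e : Vec) (vs : List Vec) (ps : List (ℕ × ℕ × (ℤ ⊕ Fin 7))) : Bool :=
  (vs.all fun v => v.valid && Vec.isZero (e.br v)) && (ps.all fun q => pivotTest q.2.2) &&
    triTest (brackets vs ps)

/-- A test for a root vector of negative degree in the centralizer of `e`. -/
def negTest (n : Fin 7 → ℕ) (e : Vec) (k : ℤ) : Bool :=
  Vec.valid [r k 1] && Vec.inDeg n (-1) [r k 1] && Vec.isZero (e.br [r k 1])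

variable {L : Type*} [LieRing L] [LieAlgebra ℂ L]

namespace Data

variable (D : Data L) [Nontrivial L] {n : Fin 7 → ℕ}

lemma eval_mem_gr {u : Vec} {m : ℤ} (hu : u.IsValid) (h : u.inDeg n m = true) :
    D.eval u ∈ D.gr n {m} := by
  refine list_sum_mem fun x hx => ?_
  obtain ⟨⟨k, c⟩, hp, rfl⟩ := List.mem_map.1 hx
  have h1 := List.all_eq_true.1 h _ hp
  have h2 := hu _ hp
  rw [← Int.cast_smul_eq_zsmul ℂ]
  refine Submodule.smul_mem _ _ ?_
  rcases k with k | k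
  · have h3 := D.basis_mem_gr (n := n) (S := {m}) (k := Sum.inl ⟨decZ k, IsCode.root h2⟩)
      ((iw_decZ n k).trans (by simpa using h1))
    rwa [basis_inl] at h3
  · change ∑ i, decZ k i • D.H i ∈ _
    refine Submodule.sum_mem _ fun i _ => ?_
    rw [← Int.cast_smul_eq_zsmul ℂ]
    refine Submodule.smul_mem _ _ ?_
    have h4 : m = 0 := by simpa using h1
    have h3 := D.basis_mem_gr (n := n) (S := {m}) (k := Sum.inr i) (show (0 : ℤ) = m from h4.symm)
    rwa [basis_inr] at h3

lemma exists_lie_eq_of_surjTest {e : Vec} {us : List (ℕ × ℤ × Vec)}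
    (h : surjTest n e us = true) {z : L} (hz : z ∈ D.gr n {2}) :
    ∃ u ∈ D.gr n {0}, ⁅D.eval e, u⁆ = z := by
  simp only [surjTest, Bool.and_eq_true] at h
  obtain ⟨⟨⟨he, -⟩, h1⟩, h2⟩ := h
  have key : D.gr n {2} ≤ (D.gr n {0}).map (ad ℂ L (D.eval e) : L →ₗ[ℂ] L) := by
    refine Submodule.span_le.2 ?_
    rintro _ ⟨k, hk, rfl⟩
    rcases k with a | i
    · have hk : iw n a.1 = 2 := hk
      have ha : IsPos a.1 := by
        rcases pos_or_neg a.2 with h3 | h3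
        · exact h3
        · have := h3.iw_nonneg n
          rw [iw_neg] at this
          omega
      obtain ⟨c, hc, hca⟩ := ha.exists_dec
      have h4 := List.all_eq_true.1 h2 c hc
      rw [← hca, iw_dec] at hk
      have h5 : wn n c = 2 := by exact_mod_cast hk
      rw [h5, show ((2 : ℕ) != 2) = false from rfl, Bool.false_or] at h4
      obtain ⟨⟨c', N, u⟩, hq, h6⟩ := List.any_eq_true.1 h4
      have h6 : c' = c := by simpa using h6
      subst h6
      have h7 := List.all_eq_true.1 h1 _ hq
      simp only [Bool.and_eq_true, bne_iff_ne] at h7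
      obtain ⟨⟨⟨h8, h9⟩, h10⟩, h11⟩ := h7
      have h12 := D.eval_eq_zero (((Vec.isValid he).br (Vec.isValid h9)).append (by
        rintro p hp
        rw [List.mem_singleton.1 hp]
        exact hc)) h11
      rw [eval_append, D.eval_br (Vec.isValid he) (Vec.isValid h9), eval_cons] at h12
      have h13 : D.key (Sum.inl (c' : ℤ)) = D.basis (Sum.inl a) := by
        rw [basis_inl, ← hca]; rfl
      have h14 : D.eval [] = 0 := rfl
      rw [h13, h14, add_zero, neg_smul, add_neg_eq_zero, ← Int.cast_smul_eq_zsmul ℂ] at h12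
      refine ⟨(N : ℂ)⁻¹ • D.eval u,
        Submodule.smul_mem _ _ (D.eval_mem_gr (Vec.isValid h9) h10), ?_⟩
      rw [map_smul, ad_apply, h12, smul_smul, inv_mul_cancel₀ (by exact_mod_cast h8), one_smul]
    · exact absurd (show (0 : ℤ) = 2 from hk) (by norm_num)
  obtain ⟨u, hu, h3⟩ := key hz
  exact ⟨u, hu, h3⟩

/-- Nilpotent elements with the same characteristic are conjugate. -/
lemma exists_equiv_eval {e : L} (h : IsChar e (D.tn n)) {e' : Vec} {us : List (ℕ × ℤ × Vec)}
    (ht : surjTest n e' us = true) :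
    ∃ φ : L ≃ₗ⁅ℂ⁆ L, φ (D.tn n) = D.tn n ∧ φ e = D.eval e' := by
  have := D.finiteDimensional
  let f : L ≃ₗ[ℂ] (Fin (Module.finrank ℂ L) → ℂ) := LinearEquiv.ofFinrankEq _ _ (by simp)
  let : TopologicalSpace L := TopologicalSpace.induced f inferInstance
  have hc : Continuous f := continuous_induced_dom
  have : IsTopologicalAddGroup L := topologicalAddGroup_induced f
  have : ContinuousSMul ℂ L := continuousSMul_induced f
  have : T2Space L := T2Space.of_injective_continuous f.injective hc
  have h1 := ht
  simp only [surjTest, Bool.and_eq_true] at h1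
  refine exists_equiv_of_surj h.ss h.lie_e ?_ (fun z hz => ?_) fun z hz => ?_
  · have := D.mem_gr_singleton.1 (D.eval_mem_gr (Vec.isValid h1.1.1.1) h1.1.1.2)
    simpa using this
  · obtain ⟨u, hu, h2⟩ := h.surj z 2 (by norm_num) (by simpa using hz)
    exact ⟨u, by simpa using hu, h2⟩
  · obtain ⟨u, hu, h2⟩ := D.exists_lie_eq_of_surjTest ht
      (D.mem_gr_singleton.2 (by simpa using hz))
    exact ⟨u, by simpa using D.mem_gr_singleton.1 hu, h2⟩

lemma not_isChar {e : L} {e' : Vec} {us : List (ℕ × ℤ × Vec)} {k : ℤ}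
    (h : (surjTest n e' us && negTest n e' k) = true) : ¬ IsChar e (D.tn n) := by
  intro hc
  obtain ⟨ht, hk⟩ := Bool.and_eq_true_iff.1 h
  obtain ⟨φ, hφ, hφ'⟩ := D.exists_equiv_eval hc ht
  have hc' := hc.map φ
  rw [hφ, hφ'] at hc'
  simp only [negTest, Bool.and_eq_true] at hk
  obtain ⟨⟨h1, h2⟩, h3⟩ := hk
  simp only [surjTest, Bool.and_eq_true] at ht
  have h1 := Vec.isValid h1
  have he := Vec.isValid ht.1.1.1
  have h4 := D.eval_eq_zero (he.br h1) h3
  rw [D.eval_br he h1] at h4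
  have h5 := D.mem_gr_singleton.1 (D.eval_mem_gr h1 h2)
  have h6 : D.eval [r k 1] ≠ 0 := by
    have : D.eval [r k 1] = D.b (decZ k) := by
      rw [eval_cons, one_smul]
      exact add_zero _
    rw [this]
    exact D.b_ne_zero (IsCode.root (h1 _ List.mem_cons_self))
  obtain ⟨m, hm⟩ := hc'.ker_nat _ _ h4 h5 h6
  have h7 : (-1 : ℤ) = (m : ℤ) := by exact_mod_cast hm
  omega

lemma length_le_finrank [FiniteDimensional ℂ L] :
    ∀ (ws : List (Vec × (ℤ ⊕ Fin 7))), triTest ws = true →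
    (∀ q ∈ ws, q.1.IsValid ∧ IsPivot q.2) → ∀ W : Submodule ℂ L, (∀ q ∈ ws, D.eval q.1 ∈ W) →
    ws.length ≤ Module.finrank ℂ W := by
  intro ws
  induction ws with
  | nil => intro _ _ W _; exact Nat.zero_le _
  | cons q ws ih =>
    intro h hv W hW
    simp only [triTest, Bool.and_eq_true, bne_iff_ne] at h
    obtain ⟨⟨h1, h2⟩, h3⟩ := h
    have hq := hv q List.mem_cons_self
    obtain ⟨i, hi⟩ := exists_index hq.2
    have h4 : ∀ p ∈ q :: ws, D.basis.coord i (D.eval p.1) = (p.1.coef q.2 : ℂ) := by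
      intro p hp
      rw [Module.Basis.coord_apply, D.repr_eval (hv p hp).1, hi]
    set W' := W ⊓ LinearMap.ker (D.basis.coord i)
    have h5 := ih h3 (fun p hp => hv p (List.mem_cons_of_mem _ hp)) W' fun p hp => by
      refine ⟨hW p (List.mem_cons_of_mem _ hp), ?_⟩
      rw [SetLike.mem_coe, LinearMap.mem_ker, h4 p (List.mem_cons_of_mem _ hp)]
      have : p.1.coef q.2 = 0 := by simpa using List.all_eq_true.1 h2 p hp
      rw [this, Int.cast_zero]
    have h6 : W' < W := by
      refine lt_of_le_of_ne inf_le_left fun h7 => ?_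
      have h8 : D.eval q.1 ∈ W' := by rw [h7]; exact hW q List.mem_cons_self
      have h9 := LinearMap.mem_ker.1 h8.2
      rw [h4 q List.mem_cons_self] at h9
      exact h1 (by exact_mod_cast h9)
    have := Submodule.finrank_lt_finrank_of_lt h6
    rw [List.length_cons]
    omega

lemma isValid_getD {vs : List Vec} (h : ∀ v ∈ vs, v.IsValid) (i : ℕ) :
    (vs.getD i []).IsValid := by
  rw [List.getD_eq_getElem?_getD]
  rcases hi : vs[i]? with - | v
  · intro p hp
    exact absurd hp List.not_mem_nil
  · exact h v (List.mem_of_getElem? hi)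

/-- The centralizer of `e` is perfect. -/
lemma span_lie_eq {e : L} (hc : IsChar e (D.tn n)) {e' : Vec} {us : List (ℕ × ℤ × Vec)}
    {vs : List Vec} {ps : List (ℕ × ℕ × (ℤ ⊕ Fin 7))}
    (h : (surjTest n e' us && derivedTest e' vs ps) = true)
    (hd : Module.finrank ℂ (LinearMap.ker (ad ℂ L e)) ≤ ps.length) :
    Submodule.span ℂ {z : L | ∃ x ∈ LinearMap.ker (ad ℂ L e), ∃ y ∈ LinearMap.ker (ad ℂ L e),
      ⁅x, y⁆ = z} = LinearMap.ker (ad ℂ L e) := by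
  have := D.finiteDimensional
  obtain ⟨ht, hk⟩ := Bool.and_eq_true_iff.1 h
  obtain ⟨φ, hφ, hφ'⟩ := D.exists_equiv_eval hc ht
  simp only [derivedTest, Bool.and_eq_true] at hk
  obtain ⟨⟨h1, h2⟩, h3⟩ := hk
  simp only [surjTest, Bool.and_eq_true] at ht
  have he := Vec.isValid ht.1.1.1
  have hv : ∀ v ∈ vs, v.IsValid := fun v hv =>
    Vec.isValid (Bool.and_eq_true_iff.1 (List.all_eq_true.1 h1 v hv)).1
  set S := Submodule.span ℂ {z : L | ∃ x ∈ LinearMap.ker (ad ℂ L e),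
    ∃ y ∈ LinearMap.ker (ad ℂ L e), ⁅x, y⁆ = z} with hS
  have hle : S ≤ LinearMap.ker (ad ℂ L e) := by
    refine Submodule.span_le.2 ?_
    rintro _ ⟨x, hx, y, hy, rfl⟩
    rw [LinearMap.mem_ker, ad_apply] at hx hy
    rw [SetLike.mem_coe, LinearMap.mem_ker, ad_apply, leibniz_lie, hx, hy, zero_lie, lie_zero,
      add_zero]
  refine Submodule.eq_of_le_of_finrank_le hle (hd.trans ?_)
  have h0 : ∀ i, φ.symm (D.eval (vs.getD i [])) ∈ LinearMap.ker (ad ℂ L e) := by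
    intro i
    rw [LinearMap.mem_ker, ad_apply, ← equiv_lie_eq_zero, hφ']
    rw [List.getD_eq_getElem?_getD]
    rcases hi : vs[i]? with - | v
    · exact lie_zero _
    · have hm := List.mem_of_getElem? hi
      change ⁅D.eval e', D.eval v⁆ = 0
      rw [← D.eval_br he (hv v hm)]
      exact D.eval_eq_zero (he.br (hv v hm))
        (Bool.and_eq_true_iff.1 (List.all_eq_true.1 h1 v hm)).2
  have h4 := D.length_le_finrank (brackets vs ps) h3 (fun q hq => by
    obtain ⟨p, hp, rfl⟩ := List.mem_map.1 hq
    exact ⟨(isValid_getD hv _).br (isValid_getD hv _),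
      isPivot (List.all_eq_true.1 h2 p hp)⟩)
    (S.map (φ.toLinearEquiv : L →ₗ[ℂ] L)) fun q hq => by
    obtain ⟨p, hp, rfl⟩ := List.mem_map.1 hq
    change D.eval ((vs.getD p.1 []).br (vs.getD p.2.1 [])) ∈ _
    rw [D.eval_br (isValid_getD hv _) (isValid_getD hv _)]
    refine ⟨⁅φ.symm (D.eval (vs.getD p.1 [])), φ.symm (D.eval (vs.getD p.2.1 []))⁆,
      Submodule.subset_span ⟨_, h0 _, _, h0 _, rfl⟩, ?_⟩
    refine (φ.toLieHom.map_lie _ _).trans ?_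
    exact congrArg₂ _ (φ.apply_symm_apply _) (φ.apply_symm_apply _)
  rw [brackets, List.length_map] at h4
  exact h4.trans (LinearEquiv.finrank_map_eq φ.toLinearEquiv S).le

end Data

end E7

namespace E7

namespace C99

/-- A representative of the orbit `A₁`. -/
def e : Vec := [r 342226 1]

/-- Preimages of the root vectors of degree two. -/
def us : List (ℕ × ℤ × Vec) := [(342226, (-1), [t 1 1])]

/-- A basis of the centralizer. -/
def vs : List Vec := [[r 1 1], [r 65 1], [r 577 1], [r 585 1], [r 4673 1], [r 4681 1],
  [r 37441 1], [r 5193 1], [r 37449 1], [r 299585 1], [r 5257 1], [r 37961 1], [r 299593 1],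
  [r 38025 1], [r 42057 1], [r 300105 1], [r 42121 1], [r 300169 1], [r 304201 1], [r 42633 1],
  [r 304265 1], [r 336969 1], [r 42641 1], [r 304777 1], [r 337033 1], [r 304785 1],
  [r 337545 1], [r 337553 1], [r 341641 1], [r 341649 1], [r 342161 1], [r 342225 1], [r 8 1],
  [r 64 1], [r 512 1], [r 4096 1], [r 32768 1], [r 262144 1], [r 520 1], [r 576 1], [r 4608 1],
  [r 36864 1], [r 294912 1], [r 584 1], [r 4616 1], [r 4672 1], [r 37376 1], [r 299008 1],
  [r 4680 1], [r 37384 1], [r 37440 1], [r 299520 1], [r 5192 1], [r 37448 1], [r 299528 1],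
  [r 299584 1], [r 37960 1], [r 299592 1], [r 42056 1], [r 300104 1], [r 304200 1], [r 336968 1],
  [r (-8) 1], [r (-64) 1], [r (-512) 1], [r (-4096) 1], [r (-32768) 1], [r (-262144) 1],
  [r (-520) 1], [r (-576) 1], [r (-4608) 1], [r (-36864) 1], [r (-294912) 1], [r (-584) 1],
  [r (-4616) 1], [r (-4672) 1], [r (-37376) 1], [r (-299008) 1], [r (-4680) 1], [r (-37384) 1],
  [r (-37440) 1], [r (-299520) 1], [r (-5192) 1], [r (-37448) 1], [r (-299528) 1],
  [r (-299584) 1], [r (-37960) 1], [r (-299592) 1], [r (-42056) 1], [r (-300104) 1],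
  [r (-304200) 1], [r (-336968) 1], [t 262144 1], [t 32768 1], [t 4096 1], [t 512 1], [t 64 1],
  [t 8 1], [r 342226 1]]

/-- Brackets which span the centralizer, with pivots. -/
def ps : List (ℕ × ℕ × (ℤ ⊕ Fin 7)) := [(63, 1, .inl 1), (33, 0, .inl 65), (34, 1, .inl 577),
  (32, 2, .inl 585), (35, 2, .inl 4673), (32, 4, .inl 4681), (36, 4, .inl 37441),
  (34, 5, .inl 5193), (32, 6, .inl 37449), (37, 6, .inl 299585), (33, 7, .inl 5257),
  (34, 8, .inl 37961), (32, 9, .inl 299593), (33, 11, .inl 38025), (35, 11, .inl 42057),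
  (34, 12, .inl 300105), (33, 14, .inl 42121), (33, 15, .inl 300169), (35, 15, .inl 304201),
  (34, 16, .inl 42633), (33, 18, .inl 304265), (36, 18, .inl 336969), (32, 19, .inl 42641),
  (34, 20, .inl 304777), (33, 21, .inl 337033), (32, 23, .inl 304785), (34, 24, .inl 337545),
  (32, 26, .inl 337553), (35, 26, .inl 341641), (32, 28, .inl 341649), (34, 29, .inl 342161),
  (33, 30, .inl 342225), (64, 38, .inl 8), (64, 39, .inl 64), (62, 38, .inl 512),
  (64, 40, .inl 4096), (65, 41, .inl 32768), (66, 42, .inl 262144), (34, 32, .inl 520),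
  (34, 33, .inl 576), (35, 34, .inl 4608), (36, 35, .inl 36864), (37, 36, .inl 294912),
  (38, 33, .inl 584), (38, 35, .inl 4616), (39, 35, .inl 4672), (40, 36, .inl 37376),
  (41, 37, .inl 299008), (43, 35, .inl 4680), (41, 38, .inl 37384), (41, 39, .inl 37440),
  (42, 40, .inl 299520), (43, 40, .inl 5192), (43, 41, .inl 37448), (44, 42, .inl 299528),
  (45, 42, .inl 299584), (46, 43, .inl 37960), (47, 43, .inl 299592), (48, 46, .inl 42056),
  (51, 43, .inl 300104), (51, 48, .inl 304200), (53, 51, .inl 336968), (68, 34, .inl (-8)),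
  (69, 34, .inl (-64)), (68, 32, .inl (-512)), (70, 34, .inl (-4096)), (71, 35, .inl (-32768)),
  (72, 36, .inl (-262144)), (64, 62, .inl (-520)), (64, 63, .inl (-576)), (65, 64, .inl (-4608)),
  (66, 65, .inl (-36864)), (67, 66, .inl (-294912)), (68, 63, .inl (-584)),
  (68, 65, .inl (-4616)), (69, 65, .inl (-4672)), (70, 66, .inl (-37376)),
  (71, 67, .inl (-299008)), (73, 65, .inl (-4680)), (71, 68, .inl (-37384)),
  (71, 69, .inl (-37440)), (72, 70, .inl (-299520)), (73, 70, .inl (-5192)),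
  (73, 71, .inl (-37448)), (74, 72, .inl (-299528)), (75, 72, .inl (-299584)),
  (76, 73, .inl (-37960)), (77, 73, .inl (-299592)), (78, 76, .inl (-42056)),
  (81, 73, .inl (-300104)), (81, 78, .inl (-304200)), (83, 81, .inl (-336968)), (67, 37, .inr 6),
  (66, 36, .inr 5), (62, 32, .inr 1), (63, 33, .inr 2), (64, 34, .inr 3), (65, 35, .inr 4),
  (16, 15, .inl 342226)]

lemma test : (surjTest (lab [1, 0, 0, 0, 0, 0, 0]) e us &&
    derivedTest e vs ps) = true := by
  decide +kernel

end C99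

namespace C81

/-- A representative of the orbit `2A₁`. -/
def e : Vec := [r 337033 1, r 342161 1]

/-- Preimages of the root vectors of degree two. -/
def us : List (ℕ × ℤ × Vec) := [(336968, (-1), [r (-5193) 1]), (336969, 1, [r (-5192) 1]),
  (337033, (-1), [t 32768 1]), (337545, (-1), [r (-4616) 1]), (337553, (-1), [r (-4608) 1]),
  (341641, 1, [r (-520) 1]), (341649, 1, [r (-512) 1]), (342161, (-1), [t 512 1, t 32768 1]),
  (342225, (-1), [r 64 1]), (342226, 1, [r 65 1])]

/-- A basis of the centralizer. -/
def vs : List Vec := [[r 1 1], [r 8 1], [r 64 1, r 5192 1], [r 512 1, r (-4616) (-1)],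
  [r 4096 1], [r 262144 1], [r 65 1, r 5193 1], [r 520 1, r (-4608) 1], [r 576 1],
  [r 4608 1, r (-520) 1], [r 577 1], [r 584 1], [r 4616 1, r (-512) (-1)], [r 4672 1], [r 585 1],
  [r 4673 1], [r 4680 1], [r 4681 1], [r 5257 1], [r (-1) 1], [r (-8) 1],
  [r (-64) 1, r (-5192) 1], [r (-4096) 1], [r (-262144) 1], [r (-65) 1, r (-5193) 1],
  [r (-576) 1], [r (-577) 1], [r (-584) 1], [r (-4672) 1], [r (-585) 1], [r (-4673) 1],
  [r (-4680) 1], [r (-4681) 1], [r (-5257) 1], [t 262144 1], [t 4096 1], [t 64 1, t 512 1],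
  [t 8 1], [t 1 1], [r 32768 1], [r 36864 1], [r 294912 1], [r 37376 1], [r 299008 1],
  [r 37384 1], [r 37440 1], [r 299520 1], [r 37441 1], [r 37448 1], [r 299528 1], [r 299584 1],
  [r 37449 1], [r 299585 1], [r 37960 1], [r 299592 1], [r 37961 1], [r 299593 1], [r 42056 1],
  [r 300104 1], [r 38025 1], [r 42057 1], [r 300105 1], [r 304200 1], [r 42121 1], [r 300169 1],
  [r 304201 1], [r 42633 1], [r 304265 1], [r 42641 1], [r 304777 1], [r 304785 1], [r 336968 1],
  [r 336969 1], [r 342161 1], [r 337033 1], [r 337545 1], [r 337553 1], [r 341641 1],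
  [r 341649 1], [r 342225 1], [r 342226 1]]

/-- Brackets which span the centralizer, with pivots. -/
def ps : List (ℕ × ℕ × (ℤ ⊕ Fin 7)) := [(25, 10, .inl 1), (37, 1, .inl 8), (11, 9, .inl 5192),
  (20, 7, .inl 512), (25, 13, .inl 4096), (34, 5, .inl 262144), (2, 0, .inl 65),
  (3, 1, .inl 520), (19, 10, .inl 576), (4, 3, .inl 4608), (8, 0, .inl 577), (8, 1, .inl 584),
  (7, 4, .inl 4616), (8, 4, .inl 4672), (10, 1, .inl 585), (10, 4, .inl 4673),
  (11, 4, .inl 4680), (14, 4, .inl 4681), (14, 13, .inl 5257), (26, 8, .inl (-1)),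
  (27, 8, .inl (-8)), (24, 0, .inl (-64)), (35, 22, .inl (-4096)), (34, 23, .inl (-262144)),
  (21, 19, .inl (-65)), (26, 0, .inl (-576)), (25, 19, .inl (-577)), (25, 20, .inl (-584)),
  (25, 22, .inl (-4672)), (26, 20, .inl (-585)), (26, 22, .inl (-4673)), (27, 22, .inl (-4680)),
  (29, 22, .inl (-4681)), (29, 28, .inl (-5257)), (23, 5, .inr 6), (19, 0, .inr 0),
  (25, 8, .inr 2), (20, 1, .inr 1), (22, 4, .inr 4), (39, 34, .inl 32768), (39, 4, .inl 36864),
  (39, 5, .inl 294912), (42, 34, .inl 37376), (40, 5, .inl 299008), (42, 1, .inl 37384),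
  (39, 13, .inl 37440), (46, 37, .inl 299520), (39, 15, .inl 37441), (39, 16, .inl 37448),
  (46, 1, .inl 299528), (41, 13, .inl 299584), (39, 17, .inl 37449), (41, 15, .inl 299585),
  (44, 8, .inl 37960), (41, 16, .inl 299592), (44, 10, .inl 37961), (41, 17, .inl 299593),
  (42, 16, .inl 42056), (49, 8, .inl 300104), (39, 18, .inl 38025), (42, 17, .inl 42057),
  (49, 10, .inl 300105), (46, 16, .inl 304200), (40, 18, .inl 42121), (41, 18, .inl 300169),
  (46, 17, .inl 304201), (42, 18, .inl 42633), (43, 18, .inl 304265), (44, 18, .inl 42641),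
  (46, 18, .inl 304777), (49, 18, .inl 304785), (48, 46, .inl 336968), (49, 47, .inl 336969),
  (51, 50, .inl 337033), (60, 58, .inl 342161), (53, 52, .inl 337545), (55, 54, .inl 337553),
  (57, 52, .inl 341641), (57, 56, .inl 341649), (62, 59, .inl 342225), (63, 61, .inl 342226)]

lemma test : (surjTest (lab [0, 0, 0, 0, 0, 1, 0]) e us &&
    derivedTest e vs ps) = true := by
  decide +kernel

end C81

namespace C69

/-- A representative of the orbit `3A₁`. -/
def e : Vec := [r 304265 1, r 42641 1, r 337545 1]

/-- Preimages of the root vectors of degree two. -/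
def us : List (ℕ × ℤ × Vec) := [(5257, (-1), [r (-299008) 1]), (38025, 1, [r (-4616) 1]),
  (42121, (-1), [r (-520) 1]), (300169, (-1), [r (-37376) 1]), (42633, (-1), [r (-294912) 1]),
  (304265, (-1), [t 64 1]), (42641, (-1), [t 64 1, t 262144 (-1)]), (304777, 1, [r (-32768) 1]),
  (337033, 1, [r (-512) 1]), (304785, 1, [r 520 1]), (337545, (-1), [t 64 1, t 4096 (-1)]),
  (337553, 1, [r 294912 1]), (341641, (-1), [r 4096 1]), (341649, (-1), [r 299008 1]),
  (342161, 1, [r 4616 1])]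

/-- A basis of the centralizer. -/
def vs : List Vec := [[r 1 1], [r 8 1, r 294912 1], [r 512 1, r (-32768) 1],
  [r 4096 1, r 37376 1], [r 32768 1, r (-512) 1], [r 262144 1, r 520 1], [r 4608 1], [r 36864 1],
  [r 4616 1, r 299520 (-1)], [r 299008 1, r 37384 (-1)], [r 299528 1], [r (-1) 1],
  [r (-8) 1, r (-294912) 1], [r (-4096) 1, r (-37376) 1], [r (-262144) 1, r (-520) 1],
  [r (-4608) 1], [r (-36864) 1], [r (-4616) 1, r (-299520) (-1)],
  [r (-299008) 1, r (-37384) (-1)], [r (-299528) 1], [t 4096 1, t 32768 1],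
  [t 512 1, t 32768 (-1)], [t 8 1, t 32768 1, t 262144 1], [t 1 1], [r 64 1], [r 65 1],
  [r 576 1], [r 577 1], [r 584 1], [r 4672 1], [r 585 1], [r 4673 1], [r 299584 1, r 37960 (-1)],
  [r 4680 1, r 37960 (-1)], [r 37440 1], [r 299585 1, r 37961 (-1)], [r 4681 1, r 37961 (-1)],
  [r 37441 1], [r 5192 1], [r 37448 1], [r 5193 1], [r 37449 1], [r 299592 1], [r 299593 1],
  [r 42056 1], [r 300104 1], [r 42057 1], [r 300105 1], [r 304200 1], [r 304201 1], [r 336968 1],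
  [r 336969 1], [r 5257 1], [r 38025 1], [r 42121 1], [r 300169 1], [r 42633 1], [r 337545 1],
  [r 42641 1], [r 304265 1], [r 304777 1], [r 337033 1], [r 304785 1], [r 337553 1],
  [r 341641 1], [r 341649 1], [r 342161 1], [r 342225 1], [r 342226 1]]

/-- Brackets which span the centralizer, with pivots. -/
def ps : List (ℕ × ℕ × (ℤ ⊕ Fin 7)) := [(23, 0, .inl 1), (17, 10, .inl 294912),
  (13, 6, .inl 512), (6, 4, .inl 37376), (13, 7, .inl 32768), (16, 9, .inl 262144),
  (21, 6, .inl 4608), (20, 7, .inl 36864), (12, 10, .inl 299520), (7, 5, .inl 299008),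
  (8, 1, .inl 299528), (23, 11, .inl (-1)), (17, 6, .inl (-8)), (15, 2, .inl (-4096)),
  (18, 7, .inl (-262144)), (21, 15, .inl (-4608)), (20, 16, .inl (-36864)),
  (15, 12, .inl (-4616)), (16, 14, .inl (-299008)), (17, 12, .inl (-299528)), (11, 0, .inr 0),
  (12, 1, .inr 1), (15, 6, .inr 3), (16, 7, .inr 4), (24, 23, .inl 64), (24, 0, .inl 65),
  (27, 11, .inl 576), (27, 23, .inl 577), (30, 11, .inl 584), (24, 6, .inl 4672),
  (30, 23, .inl 585), (25, 6, .inl 4673), (24, 8, .inl 4680), (26, 9, .inl 299584),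
  (26, 7, .inl 37440), (25, 8, .inl 4681), (27, 9, .inl 299585), (27, 7, .inl 37441),
  (40, 11, .inl 5192), (39, 23, .inl 37448), (40, 23, .inl 5193), (39, 0, .inl 37449),
  (24, 10, .inl 299592), (25, 10, .inl 299593), (38, 7, .inl 42056), (26, 10, .inl 300104),
  (40, 7, .inl 42057), (27, 10, .inl 300105), (29, 10, .inl 304200), (31, 10, .inl 304201),
  (34, 10, .inl 336968), (37, 10, .inl 336969), (30, 29, .inl 5257), (37, 28, .inl 38025),
  (39, 31, .inl 42121), (43, 26, .inl 300169), (38, 37, .inl 42633), (42, 31, .inl 304265),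
  (40, 39, .inl 42641), (45, 37, .inl 337545), (47, 29, .inl 304777), (43, 34, .inl 337033),
  (42, 40, .inl 304785), (45, 41, .inl 337553), (49, 34, .inl 341641), (44, 43, .inl 341649),
  (46, 45, .inl 342161), (52, 50, .inl 342225), (52, 51, .inl 342226)]

lemma test : (surjTest (lab [0, 0, 1, 0, 0, 0, 0]) e us &&
    derivedTest e vs ps) = true := by
  decide +kernel

end C69

namespace C63

/-- A representative of the orbit `4A₁`. -/
def e : Vec := [r 300105 1, r 336968 1, r 304265 1, r 42641 1]

/-- Preimages of the root vectors of degree two. -/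
def us : List (ℕ × ℤ × Vec) := [(299528, (-1), [r (-577) 1]), (299592, 1, [r (-37376) 1]),
  (299593, 1, [r (-4672) 1]), (300104, 1, [r (-36864) 1]),
  (300105, (-2), [t 8 1, t 4096 (-1), t 262144 1]), (304200, 1, [r (-32768) 1]),
  (300169, 1, [r 64 1]), (304201, (-1), [r 4096 1]),
  (336968, (-2), [t 8 1, t 64 1, t 32768 2, t 262144 1]),
  (304265, (-2), [t 8 1, t 64 1, t 262144 1]), (336969, (-1), [r 36864 1]),
  (42641, (-1), [t 8 1]), (304777, (-1), [r 4672 1]), (337033, (-1), [r 65 1]),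
  (337545, (-1), [r 577 1]), (341641, (-1), [r 4673 1])]

/-- A basis of the centralizer. -/
def vs : List Vec := [[r 1 1, r 36864 1], [r 64 1, r (-4096) (-1)], [r 512 1, r 4672 (-1)],
  [r 4096 1, r (-64) (-1)], [r 32768 1, r 65 (-1)], [r 576 1], [r 4608 1],
  [r 577 1, r 37440 (-1)], [r 37376 1, r 4673 1], [r 37441 1], [r (-1) 1, r (-36864) 1],
  [r (-512) 1, r (-4672) (-1)], [r (-32768) 1, r (-65) (-1)], [r (-576) 1], [r (-4608) 1],
  [r (-577) 1, r (-37440) (-1)], [r (-37376) 1, r (-4673) 1], [r (-37441) 1],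
  [t 512 1, t 4096 1], [t 64 1, t 4096 (-1)], [t 1 1, t 4096 1, t 32768 1], [r 8 1],
  [r 520 1, r 4680 (-1)], [r 262144 1, r 4680 1], [r 585 1, r 37448 (-1)],
  [r 294912 1, r 37448 (-1)], [r 584 1], [r 4616 1], [r 37384 1, r 4681 1],
  [r 299008 1, r 4681 1], [r 5193 1, r 42056 1], [r 299520 1, r 42056 1], [r 5192 1],
  [r 37960 1, r 5257 (-1)], [r 299584 1, r 5257 (-1)], [r 37449 1], [r 37961 1, r 42121 (-1)],
  [r 299585 1, r 42121 (-1)], [r 38025 1], [r 42057 1], [r 42633 1], [r 299528 1], [r 299592 1],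
  [r 299593 1], [r 300104 1], [r 42641 1], [r 304265 1], [r 336968 1], [r 300105 1],
  [r 304200 1], [r 300169 1], [r 304201 1], [r 336969 1], [r 304777 1], [r 337033 1],
  [r 337545 1], [r 341641 1], [r 304785 1], [r 337553 1], [r 341649 1], [r 342161 1],
  [r 342225 1], [r 342226 1]]

/-- Brackets which span the centralizer, with pivots. -/
def ps : List (ℕ × ℕ × (ℤ ⊕ Fin 7)) := [(15, 9, .inl 36864), (11, 5, .inl 64), (5, 3, .inl 4672),
  (11, 6, .inl 4096), (14, 8, .inl 32768), (19, 5, .inl 576), (18, 6, .inl 4608),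
  (5, 0, .inl 577), (6, 4, .inl 37376), (7, 0, .inl 37441), (17, 7, .inl (-36864)),
  (13, 1, .inl (-512)), (16, 6, .inl (-32768)), (19, 13, .inl (-576)), (19, 14, .inl (-4608)),
  (13, 10, .inl (-577)), (14, 12, .inl (-37376)), (15, 10, .inl (-37441)), (10, 0, .inr 0),
  (13, 5, .inr 2), (14, 6, .inr 3), (26, 13, .inl 8), (21, 2, .inl 520), (37, 17, .inl 262144),
  (21, 7, .inl 585), (31, 14, .inl 294912), (21, 5, .inl 584), (21, 6, .inl 4616),
  (21, 8, .inl 37384), (34, 13, .inl 299008), (39, 10, .inl 5193), (25, 6, .inl 299520),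
  (26, 6, .inl 5192), (26, 8, .inl 37960), (29, 5, .inl 299584), (21, 9, .inl 37449),
  (22, 9, .inl 37961), (23, 9, .inl 299585), (26, 9, .inl 38025), (27, 9, .inl 42057),
  (32, 9, .inl 42633), (44, 13, .inl 299528), (49, 14, .inl 299592), (50, 13, .inl 299593),
  (55, 17, .inl 300104), (35, 32, .inl 42641), (41, 7, .inl 300105), (31, 25, .inl 336968),
  (34, 29, .inl 304265), (42, 6, .inl 304200), (43, 5, .inl 300169), (43, 6, .inl 304201),
  (41, 9, .inl 336969), (50, 6, .inl 304777), (42, 9, .inl 337033), (44, 9, .inl 337545),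
  (49, 9, .inl 341641), (62, 17, .inl 304785), (41, 38, .inl 337553), (42, 39, .inl 341649),
  (41, 40, .inl 342161), (42, 40, .inl 342225), (43, 40, .inl 342226)]

lemma test : (surjTest (lab [0, 1, 0, 0, 0, 0, 1]) e us &&
    derivedTest e vs ps) = true := by
  decide +kernel

end C63

namespace C51

/-- A representative of the orbit `A₂+2A₁`. -/
def e : Vec := [r 5193 1, r 37960 1, r 304200 1, r 337033 1]

/-- Preimages of the root vectors of degree two. -/
def us : List (ℕ × ℤ × Vec) := [(5192, (-1), [r (-1) 1]),
  (5193, (-1), [t 1 1, t 64 2, t 512 2, t 4096 1]), (37960, (-1), [t 64 1, t 512 1]),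
  (5257, 1, [r 64 1]), (37961, (-1), [r 32768 1, r (-65) 1]), (42056, (-1), [r 4096 1]),
  (300104, (-1), [r 262144 1]), (38025, 1, [r (-1) 1, r (-299008) (-1)]),
  (42057, 1, [r 36864 1]), (300105, (-1), [r 294912 1]),
  (304200, (-1), [t 512 1, t 4096 2, t 32768 1]), (42121, (-1), [r (-294912) 1]),
  (300169, 1, [r (-36864) 1]), (304201, 1, [r 299008 1, r (-65) (-1)]), (336968, 1, [r (-65) 1]),
  (304265, 1, [r (-1) 1, r (-32768) 1]), (336969, (-1), [r (-64) 1]),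
  (337033, (-1), [t 1 1, t 64 3, t 512 2, t 4096 1])]

/-- A basis of the centralizer. -/
def vs : List Vec := [[r 1 1, r 32768 1, r 299008 (-1), r (-65) 2], [r 8 1],
  [r 4096 1, r (-262144) 1], [r 262144 1, r (-4096) 1],
  [r 65 1, r (-1) 2, r (-32768) 1, r (-299008) (-1)], [r (-8) 1], [t 4096 1, t 262144 (-1)],
  [t 64 1, t 32768 (-1), t 262144 (-1)], [t 8 1], [r 512 1, r 299585 (-1)],
  [r 520 1, r 299593 (-1)], [r 576 1], [r 4608 1, r 37441 1], [r 577 1, r 299584 1], [r 584 1],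
  [r 4616 1, r 37449 1], [r 4672 1], [r 37376 1], [r 585 1, r 299592 1],
  [r 4673 1, r 37440 (-1)], [r 4680 1], [r 37384 1], [r 299520 1], [r 4681 1, r 37448 (-1)],
  [r 299528 1], [r 38025 1, r 304265 (-1)], [r 5192 1, r 304265 (-1)], [r 304200 1], [r 37960 1],
  [r 5193 1, r 337033 1], [r 5257 1], [r 304201 1, r 336968 (-1)], [r 37961 1, r 336968 (-1)],
  [r 42056 1], [r 300104 1], [r 42057 1], [r 300105 1], [r 42121 1], [r 300169 1], [r 336969 1],
  [r 42633 1], [r 42641 1], [r 304777 1], [r 304785 1], [r 337545 1], [r 337553 1], [r 341641 1],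
  [r 341649 1], [r 342161 1], [r 342225 1], [r 342226 1]]

/-- Brackets which span the centralizer, with pivots. -/
def ps : List (ℕ × ℕ × (ℤ ⊕ Fin 7)) := [(7, 0, .inl 1), (8, 1, .inl 8), (6, 2, .inl 4096),
  (6, 3, .inl (-4096)), (7, 4, .inl 65), (8, 5, .inl (-8)), (5, 1, .inr 1), (4, 0, .inr 2),
  (3, 2, .inr 6), (9, 8, .inl 512), (9, 1, .inl 520), (11, 8, .inl 576), (15, 5, .inl 4608),
  (13, 8, .inl 577), (11, 1, .inl 584), (15, 8, .inl 4616), (20, 5, .inl 4672),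
  (21, 5, .inl 37376), (13, 1, .inl 585), (23, 5, .inl 4673), (20, 8, .inl 4680),
  (17, 1, .inl 37384), (24, 5, .inl 299520), (23, 8, .inl 4681), (24, 8, .inl 299528),
  (14, 12, .inl 5192), (37, 3, .inl 304265), (15, 13, .inl 5193), (17, 14, .inl 37960),
  (22, 20, .inl 304200), (18, 16, .inl 5257), (18, 17, .inl 336968), (35, 3, .inl 304201),
  (20, 17, .inl 42056), (24, 11, .inl 300104), (35, 6, .inl 42057), (36, 6, .inl 300105),
  (16, 15, .inl 42121), (11, 10, .inl 300169), (17, 10, .inl 336969), (35, 11, .inl 42633),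
  (35, 14, .inl 42641), (42, 8, .inl 304777), (42, 1, .inl 304785), (38, 17, .inl 337545),
  (38, 21, .inl 337553), (37, 22, .inl 341641), (37, 24, .inl 341649), (40, 24, .inl 342161),
  (37, 34, .inl 342225), (37, 36, .inl 342226)]

lemma test : (surjTest (lab [0, 0, 0, 1, 0, 0, 0]) e us &&
    derivedTest e vs ps) = true := by
  decide +kernel

end C51

namespace C43

/-- A representative of the orbit `2A₂+A₁`. -/
def e : Vec := [r 299584 1, r 37449 1, r 37960 1, r 5257 1, r 304201 1]

/-- Preimages of the root vectors of degree two. -/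
def us : List (ℕ × ℤ × Vec) := [(37440, (-1), [r (-520) 1]), (37441, (-1), [r (-8) 1]),
  (37448, 1, [r (-512) 1]), (299584, (-1), [t 64 1, t 512 1, t 4096 2, t 32768 1]),
  (37449, (-1), [t 1 2, t 8 (-1), t 64 1, t 512 1, t 32768 1]), (299585, (-1), [r (-4616) 1]),
  (37960, (-1), [t 8 1, t 64 1, t 512 2, t 4096 2, t 32768 1]), (299592, 1, [r 8 1]),
  (5257, (-1), [t 1 1, t 64 1, t 512 1]), (37961, (-1), [r 512 1]), (299593, 1, [r (-4608) 1]),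
  (42056, (-1), [r 4096 1]), (300104, 1, [r 520 1]), (42057, (-1), [r 4608 1]),
  (300105, 1, [r (-4096) 1]), (304200, 1, [r 4616 1]),
  (304201, (-1), [t 8 1, t 64 1, t 512 2, t 4096 3, t 32768 1])]

/-- A basis of the centralizer. -/
def vs : List Vec := [[r 1 1, r 512 1, r (-4616) 1], [r 262144 1, r 520 1, r (-4608) 1],
  [r 4608 1, r (-262144) 1, r (-520) 1], [r 4616 1, r (-1) 1, r (-512) 1],
  [t 8 1, t 4096 (-1), t 262144 1], [t 1 1, t 4096 (-2), t 262144 1],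
  [r 299008 1, r 37384 (-1), r 4681 1, r 5192 (-2)], [r 64 1, r 4681 1, r 5192 (-1)],
  [r 65 1, r 576 (-1), r 5193 (-1)], [r 32768 1, r 576 (-1), r 299520 1, r 5193 (-2)],
  [r 36864 1, r 4672 1], [r 294912 1, r 585 (-1)], [r 577 1], [r 584 1, r 299528 1],
  [r 37376 1, r 4673 1], [r 4680 1], [r 37440 1, r 42057 (-1)], [r 37441 1],
  [r 37448 1, r 304200 (-1)], [r 5257 1], [r 37960 1, r 304201 1], [r 299584 1, r 37449 1],
  [r 299585 1, r 37961 (-1)], [r 299592 1], [r 299593 1, r 300104 (-1)], [r 42056 1],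
  [r 300105 1], [r 336969 1, r 304777 1], [r 38025 1, r 304777 1], [r 42121 1], [r 300169 1],
  [r 304265 1, r 42641 (-1)], [r 336968 1, r 42641 (-1)], [r 42633 1], [r 304785 1],
  [r 342161 1], [r 337033 1], [r 337545 1], [r 337553 1], [r 341641 1], [r 341649 1],
  [r 342225 1], [r 342226 1]]

/-- Brackets which span the centralizer, with pivots. -/
def ps : List (ℕ × ℕ × (ℤ ⊕ Fin 7)) := [(5, 0, .inl 1), (4, 1, .inl (-4608)), (4, 2, .inl 4608),
  (5, 3, .inl (-1)), (2, 1, .inr 6), (3, 0, .inr 1), (10, 1, .inl 299008), (15, 0, .inl 4681),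
  (11, 2, .inl 299520), (12, 3, .inl 5193), (10, 4, .inl 36864), (11, 4, .inl 294912),
  (12, 5, .inl 577), (11, 3, .inl 299528), (14, 4, .inl 37376), (15, 5, .inl 4680),
  (17, 3, .inl 42057), (12, 10, .inl 37441), (23, 2, .inl 304200), (11, 10, .inl 299584),
  (14, 13, .inl 37960), (15, 12, .inl 5257), (14, 11, .inl 37961), (15, 11, .inl 299592),
  (23, 0, .inl 299593), (15, 14, .inl 42056), (13, 12, .inl 300105), (17, 13, .inl 38025),
  (26, 10, .inl 336969), (17, 15, .inl 42121), (23, 12, .inl 300169), (22, 15, .inl 304265),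
  (25, 11, .inl 336968), (25, 12, .inl 42633), (26, 15, .inl 304785), (23, 17, .inl 337033),
  (26, 25, .inl 342161), (30, 14, .inl 337545), (23, 22, .inl 337553), (18, 17, .inl 341641),
  (25, 24, .inl 341649), (30, 25, .inl 342225), (29, 26, .inl 342226)]

lemma test : (surjTest (lab [0, 0, 1, 0, 0, 1, 0]) e us &&
    derivedTest e vs ps) = true := by
  decide +kernel

end C43

namespace N0000100

/-- An element with label `0000100`. -/
def e : Vec := [r 336968 1, r 42641 1, r 304777 1]

/-- Preimages of the root vectors of degree two. -/
def us : List (ℕ × ℤ × Vec) := [(42056, (-1), [r (-294912) 1]), (42057, 1, [r (-584) 1]),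
  (304200, 1, [r (-32768) 1]), (42121, (-1), [r (-520) 1]), (304201, (-1), [r (-576) 1]),
  (336968, 1, [t 1 1]), (42633, 1, [r (-8) 1]), (304265, 1, [r (-512) 1]), (336969, 1, [r 1 1]),
  (42641, (-1), [t 512 1, t 262144 (-1)]), (304777, (-1), [t 512 1]), (337033, (-1), [r 65 1]),
  (304785, (-1), [r 262144 1]), (337545, (-1), [r 577 1]), (337553, 1, [r 294912 1])]

lemma test : (surjTest (lab [0, 0, 0, 0, 1, 0, 0]) e us &&
    negTest (lab [0, 0, 0, 0, 1, 0, 0]) e (-4096)) = true := by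
  decide +kernel

end N0000100

namespace N0000101

/-- An element with label `0000101`. -/
def e : Vec := [r 299008 1, r 300105 1, r 42633 1]

/-- Preimages of the root vectors of degree two. -/
def us : List (ℕ × ℤ × Vec) := [(299008, (-1), [t 1 1, t 4096 1]), (299520, 1, [r (-585) 1]),
  (299528, 1, [r 520 1]), (299584, 1, [r 576 1]), (299585, 1, [r 577 1]), (299592, 1, [r 584 1]),
  (299593, 1, [r 585 1]), (42056, 1, [r 520 1, r (-577) 1]), (300104, (-1), [r (-1) 1]),
  (42057, (-1), [r (-576) 1]), (300105, 1, [t 64 1]), (42121, (-1), [r 585 1, r (-512) (-1)]),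
  (300169, 1, [r 64 1]), (42633, 1, [t 8 1]), (42641, (-1), [r 8 1])]

lemma test : (surjTest (lab [0, 0, 0, 0, 1, 0, 1]) e us &&
    negTest (lab [0, 0, 0, 0, 1, 0, 1]) e (-4616)) = true := by
  decide +kernel

end N0000101

namespace N0100011

/-- An element with label `0100011`. -/
def e : Vec := [r 299008 1, r 37449 1, r 42633 1]

/-- Preimages of the root vectors of degree two. -/
def us : List (ℕ × ℤ × Vec) := [(294912, (-1), [r (-4096) 1]), (299008, (-1), [t 4096 1]),
  (37384, (-1), [r (-65) 1]), (299520, 1, [r 512 1, r (-4672) 1]), (37448, (-1), [r (-1) 1]),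
  (299584, (-1), [r 576 (-1), r (-4608) 1]), (37449, (-1), [t 32768 1]), (299585, 1, [r 577 1]),
  (37960, (-1), [r (-4673) 1]), (37961, 1, [r (-4672) 1]), (42056, 1, [r (-577) 1]),
  (38025, (-1), [r (-4608) 1]), (42057, (-1), [r (-576) 1]), (42121, (-1), [r 4672 1]),
  (42633, 1, [t 1 (-1), t 8 1])]

lemma test : (surjTest (lab [0, 1, 0, 0, 0, 1, 1]) e us &&
    negTest (lab [0, 1, 0, 0, 0, 1, 1]) e (-520)) = true := by
  decide +kernel

end N0100011

namespace N1000002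

/-- An element with label `1000002`. -/
def e : Vec := [r 299528 1, r 299584 1]

/-- Preimages of the root vectors of degree two. -/
def us : List (ℕ × ℤ × Vec) := [(262144, (-1), [r (-37384) 1]), (294912, (-1), [r (-4616) 1]),
  (299008, (-1), [r (-576) 1]), (299520, (-1), [r (-64) 1]), (299528, 1, [t 1 1, t 64 1]),
  (299584, 1, [t 1 1]), (299592, 1, [r 8 1]), (300104, 1, [r 520 1]), (304200, 1, [r 4616 1]),
  (336968, 1, [r 37384 1])]

lemma test : (surjTest (lab [1, 0, 0, 0, 0, 0, 2]) e us &&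
    negTest (lab [1, 0, 0, 0, 0, 0, 2]) e (-1)) = true := by
  decide +kernel

end N1000002

namespace N1010001

/-- An element with label `1010001`. -/
def e : Vec := [r 577 1, r 4681 1, r 336968 1]

/-- Preimages of the root vectors of degree two. -/
def us : List (ℕ × ℤ × Vec) := [(65, 1, [r (-4616) 1]), (577, (-1), [t 1 1, t 32768 1]),
  (585, 1, [r (-4096) 1]), (4673, (-1), [r 4096 1]),
  (4681, (-1), [t 1 1, t 512 (-1), t 32768 1]), (37441, (-1), [r 36864 1]),
  (299584, (-1), [r (-37384) 1]), (5193, (-1), [r 4616 1]), (37449, (-1), [r 32768 1]),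
  (299592, 1, [r (-37376) 1]), (37961, (-1), [r 37384 1]), (300104, 1, [r (-36864) 1]),
  (42057, 1, [r 37376 1]), (304200, 1, [r (-32768) 1]),
  (336968, (-1), [t 1 1, t 8 1, t 32768 2])]

lemma test : (surjTest (lab [1, 0, 1, 0, 0, 0, 1]) e us &&
    negTest (lab [1, 0, 1, 0, 0, 0, 1]) e (-64)) = true := by
  decide +kernel

end N1010001

end E7

namespace E7

open LieAlgebra Module

variable {L : Type*} [LieRing L] [LieAlgebra ℂ L]

namespace Data

lemma span_lie_eq_of_isChar (D : Data L) [Nontrivial L] {n : Fin 7 → ℕ} {e : L}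
    (h : IsChar e (D.tn n))
    (hd : finrank ℂ (LinearMap.ker (ad ℂ L e)) ∈ ({99, 81, 69, 63, 51, 43} : Set ℕ)) :
    Submodule.span ℂ {z : L | ∃ x ∈ LinearMap.ker (ad ℂ L e),
      ∃ y ∈ LinearMap.ker (ad ℂ L e), ⁅x, y⁆ = z} = LinearMap.ker (ad ℂ L e) := by
  have hl := D.mem_labels h hd
  have key : ∀ (d : ℕ) (l : List ℕ), (finrank ℂ (LinearMap.ker (ad ℂ L e)),
      [n 0, n 1, n 2, n 3, n 4, n 5, n 6]) = (d, l) →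
      finrank ℂ (LinearMap.ker (ad ℂ L e)) ≤ d ∧ IsChar e (D.tn (lab l)) := by
    intro d l hdl
    obtain ⟨h1, rfl⟩ := Prod.mk.inj hdl
    refine ⟨h1.le, ?_⟩
    have h2 : lab [n 0, n 1, n 2, n 3, n 4, n 5, n 6] = n := by
      funext i
      fin_cases i <;> rfl
    rwa [h2]
  simp only [labels, List.mem_cons, List.not_mem_nil, or_false] at hl
  rcases hl with hl | hl | hl | hl | hl | hl | hl | hl | hl | hl | hl <;>
    obtain ⟨h1, h2⟩ := key _ _ hl
  · exact D.span_lie_eq h2 C99.test h1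
  · exact D.span_lie_eq h2 C81.test h1
  · exact D.span_lie_eq h2 C69.test h1
  · exact D.span_lie_eq h2 C63.test h1
  · exact D.span_lie_eq h2 C51.test h1
  · exact D.span_lie_eq h2 C43.test h1
  · exact absurd h2 (D.not_isChar N0000100.test)
  · exact absurd h2 (D.not_isChar N0000101.test)
  · exact absurd h2 (D.not_isChar N0100011.test)
  · exact absurd h2 (D.not_isChar N1000002.test)
  · exact absurd h2 (D.not_isChar N1010001.test)

end Data

lemma ker_ad_equiv (φ : L ≃ₗ⁅ℂ⁆ L) (e : L) : LinearMap.ker (ad ℂ L (φ e)) =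
    (LinearMap.ker (ad ℂ L e)).map (φ.toLinearEquiv : L →ₗ[ℂ] L) := by
  ext x
  rw [Submodule.mem_map]
  constructor
  · intro hx
    exact ⟨φ.symm x, (equiv_lie_eq_zero φ).1 hx, φ.apply_symm_apply x⟩
  · rintro ⟨y, hy, rfl⟩
    refine (equiv_lie_eq_zero φ).2 ?_
    change ⁅e, φ.symm (φ y)⁆ = 0
    rw [φ.symm_apply_apply]
    exact hy

lemma span_lie_equiv (φ : L ≃ₗ⁅ℂ⁆ L) (K : Submodule ℂ L) :
    Submodule.span ℂ {z : L | ∃ x ∈ K.map (φ.toLinearEquiv : L →ₗ[ℂ] L),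
      ∃ y ∈ K.map (φ.toLinearEquiv : L →ₗ[ℂ] L), ⁅x, y⁆ = z} =
    (Submodule.span ℂ {z : L | ∃ x ∈ K, ∃ y ∈ K, ⁅x, y⁆ = z}).map
      (φ.toLinearEquiv : L →ₗ[ℂ] L) := by
  rw [Submodule.map_span]
  congr 1
  ext z
  constructor
  · rintro ⟨_, ⟨x, hx, rfl⟩, _, ⟨y, hy, rfl⟩, rfl⟩
    exact ⟨⁅x, y⁆, ⟨x, hx, y, hy, rfl⟩, φ.toLieHom.map_lie x y⟩
  · rintro ⟨_, ⟨x, hx, y, hy, rfl⟩, rfl⟩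
    exact ⟨_, ⟨x, hx, rfl⟩, _, ⟨y, hy, rfl⟩, (φ.toLieHom.map_lie x y).symm⟩

lemma Data.span_lie_eq_ker (D : Data L) {e : L} (hnil : IsNilpotent (ad ℂ L e))
    (hd : finrank ℂ (LinearMap.ker (ad ℂ L e)) ∈ ({99, 81, 69, 63, 51, 43} : Set ℕ)) :
    Submodule.span ℂ {z : L | ∃ x ∈ LinearMap.ker (ad ℂ L e),
      ∃ y ∈ LinearMap.ker (ad ℂ L e), ⁅x, y⁆ = z} = LinearMap.ker (ad ℂ L e) := by
  have : Nontrivial L := by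
    by_contra hL
    rw [not_nontrivial_iff_subsingleton] at hL
    rw [finrank_zero_of_subsingleton] at hd
    simp at hd
  have := D.finiteDimensional
  have := D.isKilling
  obtain ⟨s, hs⟩ := exists_isChar hnil
  obtain ⟨φ, n, hφ⟩ := D.exists_dominant hs
  have hc := hs.map φ
  rw [hφ] at hc
  have h1 := ker_ad_equiv φ e
  have h2 := D.span_lie_eq_of_isChar hc (by rwa [h1, LinearEquiv.finrank_map_eq])
  rw [h1, span_lie_equiv] at h2
  exact Submodule.map_injective_of_injective φ.toLinearEquiv.injective h2

end E7

/-- In type E₇, nilpotent elements with `dim g_e ∈ {99, 81, 69, 63, 51, 43}` are strongly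
reachable. -/
theorem strongly_reachable_E7 (e : LieAlgebra.e₇ ℂ)
    (hnil : IsNilpotent (LieAlgebra.ad ℂ (LieAlgebra.e₇ ℂ) e))
    (hdim : Module.finrank ℂ ↥(centralizer e) ∈ ({99, 81, 69, 63, 51, 43} : Set ℕ)) :
    derived e = centralizer e := by
  exact E7.e7data.span_lie_eq_ker hnil hdim
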